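/- Fix integers m,n ≥ 1 and a real number 1 ≤ p < n+1. Let Z ⊂ ℝ^m be compact, L ≥ 0, and let f : Z → ℍⁿ be an L-Lipschitz map (Lipschitz from the Euclidean metric to the Carnot–Carathéodory metric). Then there exists a map F̃ : ℝ^m → ℍⁿ with F̃(x) = f(x) for all x ∈ Z such that F̃ belongs to W^{1,p}_{loc}(ℝ^m,ℍⁿ), i.e. F̃ ∈ W^{1,p}(U,ℝ^{2n+1}) for every bounded open U ⊂ ℝ^m and the weak contact equation holds for a.e. x ∈ ℝ^m. -/

import Mathlib

open MeasureTheory Metric Set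
noncomputable section

/-- `Euc d` is `ℝ^d` with the Euclidean metric. -/
abbrev Euc (d : ℕ) := EuclideanSpace ℝ (Fin d)

/-- The index of the coordinate `x_j` in `ℍⁿ = ℝ^{2n+1}`. -/
def xIdx (n : ℕ) (j : Fin n) : Fin (2*n+1) := ⟨2*(j:ℕ), by have := j.isLt; omega⟩

/-- The index of the coordinate `y_j` in `ℍⁿ = ℝ^{2n+1}`. -/
def yIdx (n : ℕ) (j : Fin n) : Fin (2*n+1) := ⟨2*(j:ℕ)+1, by have := j.isLt; omega⟩

/-- The index of the coordinate `t` in `ℍⁿ = ℝ^{2n+1}`. -/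
def tIdx (n : ℕ) : Fin (2*n+1) := ⟨2*n, by omega⟩

/-- `γ` is an absolutely continuous curve on `[a,b]` with a.e. derivative `g`
(each component is the integral of the corresponding component of `g`), which is
horizontal: the derivative of the `t`-component satisfies the contact condition. -/
def IsHorizontalWith (n : ℕ) (a b : ℝ) (γ g : ℝ → Euc (2*n+1)) : Prop :=
  (∀ i, IntervalIntegrable (fun s => g s i) volume a b) ∧
  (∀ i, ∀ x ∈ Set.Icc a b, γ x i = γ a i + ∫ s in a..x, g s i) ∧
  (∀ᵐ s ∂(volume.restrict (Set.Icc a b)),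
    g s (tIdx n) = 2 * ∑ j : Fin n,
      (γ s (yIdx n j) * g s (xIdx n j) - γ s (xIdx n j) * g s (yIdx n j)))

/-- The horizontal length of a horizontal curve with a.e. derivative `g`:
the Euclidean length of the projection to `ℝ^{2n}`. -/
def horizLength (n : ℕ) (a b : ℝ) (g : ℝ → Euc (2*n+1)) : ℝ :=
  ∫ s in a..b, Real.sqrt (∑ j : Fin n, ((g s (xIdx n j))^2 + (g s (yIdx n j))^2))

/-- The Carnot–Carathéodory distance on `ℍⁿ`. -/
def ccDist (n : ℕ) (p q : Euc (2*n+1)) : ℝ :=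
  sInf { ℓ : ℝ | ∃ a b γ g, a ≤ b ∧ IsHorizontalWith n a b γ g ∧
    γ a = p ∧ γ b = q ∧ ℓ = horizLength n a b g }

/-- `f` is `L`-Lipschitz on `Z` as a map into `ℍⁿ` with the Carnot–Carathéodory metric. -/
def LipschitzOnCC (m n : ℕ) (L : ℝ) (Z : Set (Euc m)) (f : Euc m → Euc (2*n+1)) : Prop :=
  ∀ x ∈ Z, ∀ y ∈ Z, ccDist n (f x) (f y) ≤ L * dist x y

/-- `v` represents the distributional partial derivative `∂u/∂x_k` on `Ω`. -/
def IsWeakPartialDeriv (m : ℕ) (Ω : Set (Euc m)) (u : Euc m → ℝ) (k : Fin m)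
    (v : Euc m → ℝ) : Prop :=
  ∀ φ : Euc m → ℝ, ContDiff ℝ (⊤ : ℕ∞) φ → HasCompactSupport φ → tsupport φ ⊆ Ω →
    ∫ x in Ω, u x * fderiv ℝ φ x (EuclideanSpace.single k 1) = - ∫ x in Ω, v x * φ x

/-- `u ∈ L^p(Ω)`. -/
def MemLpOn (m : ℕ) (p : ℝ) (Ω : Set (Euc m)) (u : Euc m → ℝ) : Prop :=
  MemLp u (ENNReal.ofReal p) (volume.restrict Ω)

/-- `u ∈ W^{1,p}(Ω)` with weak partial derivatives `v k = ∂u/∂x_k ∈ L^p(Ω)`. -/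
def MemW1pWith (m : ℕ) (p : ℝ) (Ω : Set (Euc m)) (u : Euc m → ℝ)
    (v : Fin m → Euc m → ℝ) : Prop :=
  MemLpOn m p Ω u ∧ ∀ k, MemLpOn m p Ω (v k) ∧ IsWeakPartialDeriv m Ω u k (v k)

/-- The weak contact equation holds a.e. on `Ω` for `F` with weak partial
derivatives `v i k = ∂F_i/∂x_k`. -/
def ContactAEOn (m n : ℕ) (Ω : Set (Euc m)) (F : Euc m → Euc (2*n+1))
    (v : Fin (2*n+1) → Fin m → Euc m → ℝ) : Prop :=
  ∀ᵐ x ∂(volume.restrict Ω), ∀ k : Fin m,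
    v (tIdx n) k x = 2 * ∑ j : Fin n,
      (F x (yIdx n j) * v (xIdx n j) k x - F x (xIdx n j) * v (yIdx n j) k x)

/-- `F ∈ W^{1,p}(Ω,ℍⁿ)` with weak partial derivatives `v`:
all components belong to `W^{1,p}(Ω)` and the weak contact equation holds a.e. -/
def MemW1pHeisWith (m n : ℕ) (p : ℝ) (Ω : Set (Euc m)) (F : Euc m → Euc (2*n+1))
    (v : Fin (2*n+1) → Fin m → Euc m → ℝ) : Prop :=
  (∀ i, MemW1pWith m p Ω (fun x => F x i) (fun k => v i k)) ∧ ContactAEOn m n Ω F v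

/-- The point of the Heisenberg group with coordinates `x`, `y`, `t`. -/
def heisMk (n : ℕ) (x y : ℕ → ℝ) (t : ℝ) : Euc (2*n+1) :=
  WithLp.toLp 2 fun i : Fin (2*n+1) =>
    if (i : ℕ) = 2*n then t else if (i : ℕ) % 2 = 0 then x (i / 2) else y (i / 2)

@[simp] lemma heisMk_xIdx (n : ℕ) (x y : ℕ → ℝ) (t : ℝ) (j : Fin n) :
    heisMk n x y t (xIdx n j) = x j := by
  have := j.isLt
  have h1 : ¬ (2 * (j : ℕ) = 2 * n) := by omega
  simp [heisMk, xIdx]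
  intro h; omega

@[simp] lemma heisMk_yIdx (n : ℕ) (x y : ℕ → ℝ) (t : ℝ) (j : Fin n) :
    heisMk n x y t (yIdx n j) = y j := by
  have h1 : ¬ (2 * (j : ℕ) + 1 = 2 * n) := by omega
  have h2 : (2 * (j : ℕ) + 1) % 2 = 1 := by omega
  have h3 : (2 * (j : ℕ) + 1) / 2 = j := by omega
  simp [heisMk, yIdx, h1, h2, h3]

@[simp] lemma heisMk_tIdx (n : ℕ) (x y : ℕ → ℝ) (t : ℝ) :
    heisMk n x y t (tIdx n) = t := by
  simp [heisMk, tIdx]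

lemma heis_index_cases {n : ℕ} (i : Fin (2*n+1)) :
    (∃ j, i = xIdx n j) ∨ (∃ j, i = yIdx n j) ∨ i = tIdx n := by
  obtain ⟨i, hi⟩ := i
  rcases eq_or_ne i (2*n) with h | h
  · right; right; exact Fin.ext h
  · rcases Nat.mod_two_eq_zero_or_one i with h2 | h2
    · left; exact ⟨⟨i / 2, by omega⟩, Fin.ext (by simp [xIdx]; omega)⟩
    · right; left; exact ⟨⟨i / 2, by omega⟩, Fin.ext (by simp [yIdx]; omega)⟩

lemma heis_ext {n : ℕ} {p q : Euc (2*n+1)} (hx : ∀ j, p (xIdx n j) = q (xIdx n j))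
    (hy : ∀ j, p (yIdx n j) = q (yIdx n j)) (ht : p (tIdx n) = q (tIdx n)) : p = q := by
  ext i
  rcases heis_index_cases i with ⟨j, rfl⟩ | ⟨j, rfl⟩ | rfl
  exacts [hx j, hy j, ht]

/-- The `x`-coordinates of a point, indexed by `ℕ`. -/
def heisX (n : ℕ) (p : Euc (2*n+1)) (j : ℕ) : ℝ := if h : j < n then p (xIdx n ⟨j, h⟩) else 0

/-- The `y`-coordinates of a point, indexed by `ℕ`. -/
def heisY (n : ℕ) (p : Euc (2*n+1)) (j : ℕ) : ℝ := if h : j < n then p (yIdx n ⟨j, h⟩) else 0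

@[simp] lemma heisX_coe {n : ℕ} (p : Euc (2*n+1)) (j : Fin n) : heisX n p j = p (xIdx n j) := by
  simp [heisX]

@[simp] lemma heisY_coe {n : ℕ} (p : Euc (2*n+1)) (j : Fin n) : heisY n p j = p (yIdx n j) := by
  simp [heisY]

/-- Any two points of the Heisenberg group are joined by a horizontal curve. -/
lemma exists_horizontal_curve (n : ℕ) (hn : 1 ≤ n) (p q : Euc (2*n+1)) :
    ∃ a b γ g, a ≤ b ∧ IsHorizontalWith n a b γ g ∧ γ a = p ∧ γ b = q := by
  set X : ℕ → ℝ → ℝ := fun j s => heisX n p j + s * (heisX n q j - heisX n p j) +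
    (if j = 0 then 15 / 2 * (s - s ^ 2) else 0) with hX
  set X' : ℕ → ℝ → ℝ := fun j s => (heisX n q j - heisX n p j) +
    (if j = 0 then 15 / 2 * (1 - 2 * s) else 0) with hX'
  set Y : ℝ → ℕ → ℝ → ℝ := fun β j s => heisY n p j + s * (heisY n q j - heisY n p j) +
    (if j = 0 then β * (s - 3 * s ^ 2 + 2 * s ^ 3) else 0) with hY
  set Y' : ℝ → ℕ → ℝ → ℝ := fun β j s => (heisY n q j - heisY n p j) +
    (if j = 0 then β * (1 - 6 * s + 6 * s ^ 2) else 0) with hY'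
  set T' : ℝ → ℝ → ℝ := fun β s => 2 * ∑ j : Fin n, (Y β j s * X' j s - X j s * Y' β j s)
    with hT'
  set K : ℝ → ℝ := fun s => 2 * ((s - 3 * s ^ 2 + 2 * s ^ 3) * X' 0 s
    - X 0 s * (1 - 6 * s + 6 * s ^ 2)) with hK
  have cX : ∀ j, Continuous (X j) := by
    intro j; by_cases h : j = 0 <;> simp only [hX, h, if_true, if_false] <;> fun_prop
  have cX' : ∀ j, Continuous (X' j) := by
    intro j; by_cases h : j = 0 <;> simp only [hX', h, if_true, if_false] <;> fun_prop
  have cY : ∀ β j, Continuous (Y β j) := by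
    intro β j; by_cases h : j = 0 <;> simp only [hY, h, if_true, if_false] <;> fun_prop
  have cY' : ∀ β j, Continuous (Y' β j) := by
    intro β j; by_cases h : j = 0 <;> simp only [hY', h, if_true, if_false] <;> fun_prop
  have cT' : ∀ β, Continuous (T' β) := by
    intro β
    refine continuous_const.mul (continuous_finsetSum _ fun j _ => ?_)
    exact ((cY β j).mul (cX' j)).sub ((cX j).mul (cY' β j))
  have cK : Continuous K := by
    have := cX 0
    have := cX' 0
    simp only [hK]; fun_prop
  have hsplit : ∀ β s, T' β s = T' 0 s + β * K s := by
    intro β s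
    obtain ⟨k, rfl⟩ : ∃ k, n = k + 1 := ⟨n - 1, by omega⟩
    simp only [hT', Fin.sum_univ_succ, hK, hY, hY', Fin.val_zero, if_true, Fin.val_succ,
      Nat.add_eq_zero_iff, one_ne_zero, and_false, if_false]
    ring
  have hKint : ∫ s in (0:ℝ)..1, K s = 1 := by
    set x := heisX n p 0
    set Δ := heisX n q 0 - heisX n p 0
    have hd : ∀ s ∈ Set.uIcc (0:ℝ) 1, HasDerivAt (fun s : ℝ =>
        4 * (Δ * (s ^ 2 / 2 - s ^ 3 + s ^ 4 / 2) +
          15 / 2 * (s ^ 2 / 2 - 5 * s ^ 3 / 3 + 2 * s ^ 4 - 4 * s ^ 5 / 5)) -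
        2 * ((x + s * Δ + 15 / 2 * (s - s ^ 2)) * (s - 3 * s ^ 2 + 2 * s ^ 3))) (K s) s := by
      intro s _
      have h1 := hasDerivAt_id' s
      have h2 := hasDerivAt_pow 2 s
      have h3 := hasDerivAt_pow 3 s
      have h4 := hasDerivAt_pow 4 s
      have h5 := hasDerivAt_pow 5 s
      have := (((((h2.div_const 2).sub h3).add (h4.div_const 2)).const_mul Δ).add
        (((((h2.div_const 2).sub ((h3.const_mul 5).div_const 3)).add (h4.const_mul 2)).sub
          ((h5.const_mul 4).div_const 5)).const_mul (15/2))).const_mul 4 |>.sub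
        (((((h1.mul_const Δ).const_add x).add ((h1.sub h2).const_mul (15/2))).mul
          ((h1.sub (h2.const_mul 3)).add (h3.const_mul 2))).const_mul 2)
      refine this.congr_deriv ?_
      simp only [hK, hX, hX', if_true, x, Δ, Pi.add_apply, Pi.sub_apply]
      push_cast
      ring
    rw [intervalIntegral.integral_eq_sub_of_hasDerivAt hd (cK.intervalIntegrable _ _)]
    norm_num
  obtain ⟨β, hβ⟩ : ∃ β, ∫ s in (0:ℝ)..1, T' β s = q (tIdx n) - p (tIdx n) := by
    clear_value T' K
    refine ⟨q (tIdx n) - p (tIdx n) - ∫ s in (0:ℝ)..1, T' 0 s, ?_⟩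
    rw [show T' (q (tIdx n) - p (tIdx n) - ∫ s in (0:ℝ)..1, T' 0 s) = fun s => T' 0 s +
      (q (tIdx n) - p (tIdx n) - ∫ s in (0:ℝ)..1, T' 0 s) * K s from funext (hsplit _)]
    rw [intervalIntegral.integral_add ((cT' 0).intervalIntegrable _ _)
      ((cK.intervalIntegrable _ _).const_mul _), intervalIntegral.integral_const_mul, hKint]
    ring
  refine ⟨0, 1, fun s => heisMk n (fun j => X j s) (fun j => Y β j s)
    (p (tIdx n) + ∫ r in (0:ℝ)..s, T' β r),
    fun s => heisMk n (fun j => X' j s) (fun j => Y' β j s) (T' β s), zero_le_one,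
    ⟨?_, ?_, ?_⟩, ?_, ?_⟩
  · intro i
    rcases heis_index_cases i with ⟨j, rfl⟩ | ⟨j, rfl⟩ | rfl
    · simpa using (cX' j).intervalIntegrable _ _
    · simpa using (cY' β j).intervalIntegrable _ _
    · simpa using (cT' β).intervalIntegrable _ _
  · intro i x _
    rcases heis_index_cases i with ⟨j, rfl⟩ | ⟨j, rfl⟩ | rfl
    · simp only [heisMk_xIdx]
      rw [intervalIntegral.integral_eq_sub_of_hasDerivAt (f := X j) _
        ((cX' j).intervalIntegrable _ _)]
      · ring
      · intro s _
        have h1 := (((hasDerivAt_id' s).mul_const (heisX n q j - heisX n p j)).const_add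
          (heisX n p j))
        have h2 := (((hasDerivAt_id' s).sub (hasDerivAt_pow 2 s)).const_mul (15/2))
        by_cases h : (j : ℕ) = 0
        · simp only [hX, hX', h, if_true] at h1 ⊢
          exact (h1.add h2).congr_deriv (by push_cast; ring)
        · simp only [hX, hX', h, if_false]
          exact (h1.add_const (0 : ℝ)).congr_deriv (by ring)
    · simp only [heisMk_yIdx]
      rw [intervalIntegral.integral_eq_sub_of_hasDerivAt (f := Y β j) _
        ((cY' β j).intervalIntegrable _ _)]
      · ring
      · intro s _
        have h1 := (((hasDerivAt_id' s).mul_const (heisY n q j - heisY n p j)).const_add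
          (heisY n p j))
        have h2 := (((hasDerivAt_id' s).sub ((hasDerivAt_pow 2 s).const_mul 3)).add
          ((hasDerivAt_pow 3 s).const_mul 2)).const_mul β
        by_cases h : (j : ℕ) = 0
        · simp only [hY, hY', h, if_true] at h1 ⊢
          exact (h1.add h2).congr_deriv (by push_cast; ring)
        · simp only [hY, hY', h, if_false]
          exact (h1.add_const (0 : ℝ)).congr_deriv (by ring)
    · simp
  · refine Filter.Eventually.of_forall fun s => ?_
    simp [hT']
  · refine heis_ext ?_ ?_ ?_ <;> simp [hX, hY]
  · refine heis_ext ?_ ?_ ?_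
    · intro j; simp [hX]
    · intro j; simp [hY]; intro _; right; norm_num
    · simp [hβ]

/-- The speed of a horizontal curve. -/
abbrev horizSpeed (n : ℕ) (g : ℝ → Euc (2*n+1)) (s : ℝ) : ℝ :=
  Real.sqrt (∑ j : Fin n, ((g s (xIdx n j))^2 + (g s (yIdx n j))^2))

lemma abs_x_le_horizSpeed (n : ℕ) (g : ℝ → Euc (2*n+1)) (s : ℝ) (j : Fin n) :
    |g s (xIdx n j)| ≤ horizSpeed n g s := by
  refine Real.abs_le_sqrt ?_
  have := Finset.single_le_sum (f := fun j : Fin n => (g s (xIdx n j))^2 + (g s (yIdx n j))^2)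
    (fun i _ => by positivity) (Finset.mem_univ j)
  simp only at this
  nlinarith [sq_nonneg (g s (yIdx n j))]

lemma abs_y_le_horizSpeed (n : ℕ) (g : ℝ → Euc (2*n+1)) (s : ℝ) (j : Fin n) :
    |g s (yIdx n j)| ≤ horizSpeed n g s := by
  refine Real.abs_le_sqrt ?_
  have := Finset.single_le_sum (f := fun j : Fin n => (g s (xIdx n j))^2 + (g s (yIdx n j))^2)
    (fun i _ => by positivity) (Finset.mem_univ j)
  simp only at this
  nlinarith [sq_nonneg (g s (xIdx n j))]

lemma IsHorizontalWith.intervalIntegrable_horizSpeed {n : ℕ} {a b : ℝ}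
    {γ g : ℝ → Euc (2*n+1)} (h : IsHorizontalWith n a b γ g) :
    IntervalIntegrable (horizSpeed n g) volume a b := by
  have hx := fun j => h.1 (xIdx n j)
  have hy := fun j => h.1 (yIdx n j)
  have hsum : IntervalIntegrable (fun s => ∑ j : Fin n,
      (|g s (xIdx n j)| + |g s (yIdx n j)|)) volume a b := by
    have := IntervalIntegrable.sum (μ := volume) (a := a) (b := b) Finset.univ
      (f := fun (j : Fin n) s => |g s (xIdx n j)| + |g s (yIdx n j)|)
      (fun j _ => (hx j).abs.add (hy j).abs)
    rwa [Finset.sum_fn] at this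
  refine hsum.mono_fun ?_ ?_
  · refine Real.continuous_sqrt.comp_aestronglyMeasurable ?_
    refine Finset.aestronglyMeasurable_fun_sum _ fun j _ => ?_
    exact ((hx j).def'.aestronglyMeasurable.pow 2).add ((hy j).def'.aestronglyMeasurable.pow 2)
  · refine Filter.Eventually.of_forall fun s => ?_
    beta_reduce
    rw [Real.norm_of_nonneg (Real.sqrt_nonneg _),
      Real.norm_of_nonneg (Finset.sum_nonneg fun j _ => by positivity)]
    refine Real.sqrt_le_iff.2 ⟨by positivity, ?_⟩
    calc ∑ j : Fin n, ((g s (xIdx n j))^2 + (g s (yIdx n j))^2)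
        ≤ ∑ j : Fin n, (|g s (xIdx n j)| + |g s (yIdx n j)|) ^ 2 := by
          refine Finset.sum_le_sum fun j _ => ?_
          rw [add_sq, sq_abs, sq_abs]
          nlinarith [mul_nonneg (abs_nonneg (g s (xIdx n j))) (abs_nonneg (g s (yIdx n j)))]
      _ ≤ _ := Finset.sum_sq_le_sq_sum_of_nonneg fun j _ => by positivity

lemma IsHorizontalWith.abs_sub_le {n : ℕ} {a b : ℝ} {γ g : ℝ → Euc (2*n+1)}
    (h : IsHorizontalWith n a b γ g) {i : Fin (2*n+1)}
    (hi : ∀ s, |g s i| ≤ horizSpeed n g s) {x : ℝ} (hx : x ∈ Set.Icc a b) :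
    |γ x i - γ a i| ≤ horizLength n a b g := by
  have hsp := h.intervalIntegrable_horizSpeed
  have hab : a ≤ b := hx.1.trans hx.2
  rw [h.2.1 i x hx, add_sub_cancel_left]
  have hsub : Set.uIcc a x ⊆ Set.uIcc a b := by
    rw [uIcc_of_le hx.1, uIcc_of_le hab]; exact Icc_subset_Icc_right hx.2
  rw [← Real.norm_eq_abs]
  calc ‖∫ s in a..x, g s i‖ ≤ ∫ s in a..x, horizSpeed n g s :=
        intervalIntegral.norm_integral_le_of_norm_le hx.1
          (Filter.Eventually.of_forall fun s _ => hi s) (hsp.mono_set hsub)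
    _ ≤ ∫ s in a..b, horizSpeed n g s :=
        intervalIntegral.integral_mono_interval le_rfl hx.1 hx.2
          (Filter.Eventually.of_forall fun s => Real.sqrt_nonneg _) hsp

/-- A horizontal curve controls the coordinates of its endpoints by its length. -/
lemma IsHorizontalWith.estimates {n : ℕ} {a b : ℝ} {γ g : ℝ → Euc (2*n+1)} (hab : a ≤ b)
    (h : IsHorizontalWith n a b γ g) :
    (∀ j, |γ b (xIdx n j) - γ a (xIdx n j)| ≤ horizLength n a b g) ∧
    (∀ j, |γ b (yIdx n j) - γ a (yIdx n j)| ≤ horizLength n a b g) ∧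
    |γ b (tIdx n) - γ a (tIdx n) - 2 * ∑ j : Fin n,
      (γ a (yIdx n j) * (γ b (xIdx n j) - γ a (xIdx n j))
        - γ a (xIdx n j) * (γ b (yIdx n j) - γ a (yIdx n j)))| ≤
      4 * n * horizLength n a b g ^ 2 := by
  have hb := right_mem_Icc.2 hab
  have hX := fun j => fun x (hx : x ∈ Icc a b) =>
    h.abs_sub_le (fun s => abs_x_le_horizSpeed n g s j) hx
  have hY := fun j => fun x (hx : x ∈ Icc a b) =>
    h.abs_sub_le (fun s => abs_y_le_horizSpeed n g s j) hx
  refine ⟨fun j => hX j b hb, fun j => hY j b hb, ?_⟩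
  set lam := horizLength n a b g with hlam
  have hI : ∀ j : Fin n, IntervalIntegrable (fun s => γ a (yIdx n j) * g s (xIdx n j)
      - γ a (xIdx n j) * g s (yIdx n j)) volume a b := fun j =>
    ((h.1 (xIdx n j)).const_mul _).sub ((h.1 (yIdx n j)).const_mul _)
  have hII : IntervalIntegrable (fun s => ∑ j : Fin n, (γ a (yIdx n j) * g s (xIdx n j)
      - γ a (xIdx n j) * g s (yIdx n j))) volume a b := by
    have := IntervalIntegrable.sum (μ := volume) (a := a) (b := b) Finset.univ (fun j _ => hI j)
    rwa [Finset.sum_fn] at this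
  have e : γ b (tIdx n) - γ a (tIdx n) - 2 * ∑ j : Fin n,
      (γ a (yIdx n j) * (γ b (xIdx n j) - γ a (xIdx n j))
        - γ a (xIdx n j) * (γ b (yIdx n j) - γ a (yIdx n j))) =
      ∫ s in a..b, (g s (tIdx n) - 2 * ∑ j : Fin n, (γ a (yIdx n j) * g s (xIdx n j)
      - γ a (xIdx n j) * g s (yIdx n j))) := by
    rw [intervalIntegral.integral_sub (h.1 _) (hII.const_mul _),
      intervalIntegral.integral_const_mul, intervalIntegral.integral_finsetSum fun j _ => hI j]
    have h1 := fun i => h.2.1 i b hb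
    rw [h1 (tIdx n), add_sub_cancel_left]
    congr 2
    refine Finset.sum_congr rfl fun j _ => ?_
    rw [intervalIntegral.integral_sub ((h.1 _).const_mul _) ((h.1 _).const_mul _),
      intervalIntegral.integral_const_mul, intervalIntegral.integral_const_mul,
      h1 (xIdx n j), h1 (yIdx n j)]
    ring
  rw [e]
  have hle : ∀ᵐ s, s ∈ Ioc a b → ‖g s (tIdx n) - 2 * ∑ j : Fin n,
      (γ a (yIdx n j) * g s (xIdx n j) - γ a (xIdx n j) * g s (yIdx n j))‖ ≤
      4 * n * lam * horizSpeed n g s := by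
    have h3 := (ae_restrict_iff' measurableSet_Icc).1 h.2.2
    filter_upwards [h3] with s hs hs'
    have hs2 : s ∈ Icc a b := Ioc_subset_Icc_self hs'
    rw [hs hs2, ← mul_sub, ← Finset.sum_sub_distrib, norm_mul, Real.norm_ofNat]
    have : ∀ j ∈ (Finset.univ : Finset (Fin n)),
        ‖γ s (yIdx n j) * g s (xIdx n j) - γ s (xIdx n j) * g s (yIdx n j) -
        (γ a (yIdx n j) * g s (xIdx n j) - γ a (xIdx n j) * g s (yIdx n j))‖ ≤
        2 * (lam * horizSpeed n g s) := by
      intro j _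
      have e2 : γ s (yIdx n j) * g s (xIdx n j) - γ s (xIdx n j) * g s (yIdx n j) -
        (γ a (yIdx n j) * g s (xIdx n j) - γ a (xIdx n j) * g s (yIdx n j)) =
        (γ s (yIdx n j) - γ a (yIdx n j)) * g s (xIdx n j) -
        (γ s (xIdx n j) - γ a (xIdx n j)) * g s (yIdx n j) := by ring
      have h6 : ‖(γ s (yIdx n j) - γ a (yIdx n j)) * g s (xIdx n j)‖ ≤
          lam * horizSpeed n g s := by
        rw [norm_mul]
        exact mul_le_mul (hY j s hs2) (abs_x_le_horizSpeed n g s j) (norm_nonneg _)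
          ((abs_nonneg _).trans (hY j s hs2))
      have h7 : ‖(γ s (xIdx n j) - γ a (xIdx n j)) * g s (yIdx n j)‖ ≤
          lam * horizSpeed n g s := by
        rw [norm_mul]
        exact mul_le_mul (hX j s hs2) (abs_y_le_horizSpeed n g s j) (norm_nonneg _)
          ((abs_nonneg _).trans (hX j s hs2))
      rw [e2]
      exact (norm_sub_le _ _).trans (by linarith)
    have h4 := norm_sum_le_of_le _ this
    rw [Finset.sum_const, Finset.card_univ, Fintype.card_fin, nsmul_eq_mul] at h4
    linarith
  have h5 := intervalIntegral.norm_integral_le_of_norm_le hab hle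
    (h.intervalIntegrable_horizSpeed.const_mul _)
  rw [intervalIntegral.integral_const_mul] at h5
  calc _ ≤ _ := h5
    _ = _ := by rw [sq, ← mul_assoc, hlam]; rfl

lemma LipschitzOnCC.estimates {m n : ℕ} (hn : 1 ≤ n) {L : ℝ} {Z : Set (Euc m)}
    {f : Euc m → Euc (2*n+1)} (hL : 0 ≤ L) (hf : LipschitzOnCC m n L Z f)
    {z w : Euc m} (hz : z ∈ Z) (hw : w ∈ Z) :
    (∀ j, |f w (xIdx n j) - f z (xIdx n j)| ≤ L * dist z w) ∧
    (∀ j, |f w (yIdx n j) - f z (yIdx n j)| ≤ L * dist z w) ∧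
    |f w (tIdx n) - f z (tIdx n) - 2 * ∑ j : Fin n,
      (f z (yIdx n j) * (f w (xIdx n j) - f z (xIdx n j))
        - f z (xIdx n j) * (f w (yIdx n j) - f z (yIdx n j)))| ≤
      4 * n * (L * dist z w) ^ 2 := by
  have key : ∀ ε > 0, ∃ l, 0 ≤ l ∧ l < L * dist z w + ε ∧
    (∀ j, |f w (xIdx n j) - f z (xIdx n j)| ≤ l) ∧
    (∀ j, |f w (yIdx n j) - f z (yIdx n j)| ≤ l) ∧
    |f w (tIdx n) - f z (tIdx n) - 2 * ∑ j : Fin n,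
      (f z (yIdx n j) * (f w (xIdx n j) - f z (xIdx n j))
        - f z (xIdx n j) * (f w (yIdx n j) - f z (yIdx n j)))| ≤ 4 * n * l ^ 2 := by
    intro ε hε
    have h1 := hf z hz w hw
    have hne : { ℓ : ℝ | ∃ a b γ g, a ≤ b ∧ IsHorizontalWith n a b γ g ∧
        γ a = f z ∧ γ b = f w ∧ ℓ = horizLength n a b g }.Nonempty := by
      obtain ⟨a, b, γ, g, h⟩ := exists_horizontal_curve n hn (f z) (f w)
      exact ⟨_, a, b, γ, g, h.1, h.2.1, h.2.2.1, h.2.2.2, rfl⟩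
    obtain ⟨l, ⟨a, b, γ, g, hab, hγ, ha, hb, rfl⟩, hl⟩ :=
      Real.lt_sInf_add_pos hne hε
    obtain ⟨e1, e2, e3⟩ := hγ.estimates hab
    rw [ha, hb] at e1 e2 e3
    refine ⟨_, ?_, ?_, e1, e2, e3⟩
    · exact intervalIntegral.integral_nonneg hab fun s _ => Real.sqrt_nonneg _
    · unfold ccDist at h1; linarith
  have h0 : 0 ≤ L * dist z w := by positivity
  refine ⟨fun j => le_of_forall_pos_le_add fun ε hε => ?_,
    fun j => le_of_forall_pos_le_add fun ε hε => ?_, ?_⟩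
  · obtain ⟨l, _, hl, h1, -, -⟩ := key ε hε
    exact (h1 j).trans hl.le
  · obtain ⟨l, _, hl, -, h1, -⟩ := key ε hε
    exact (h1 j).trans hl.le
  · have hlim : Filter.Tendsto (fun ε : ℝ => 4 * (n : ℝ) * (L * dist z w + ε) ^ 2)
        (nhdsWithin 0 (Ioi 0)) (nhds (4 * n * (L * dist z w + 0) ^ 2)) :=
      (Continuous.tendsto (by fun_prop) _).mono_left nhdsWithin_le_nhds
    rw [add_zero] at hlim
    refine ge_of_tendsto hlim ?_
    filter_upwards [self_mem_nhdsWithin] with ε hε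
    obtain ⟨l, hl0, hl, -, -, h1⟩ := key ε hε
    exact h1.trans (by gcongr)

lemma Euc.dist_le_sqrt_mul {m : ℕ} (a b : Euc m) {r : ℝ} (hr : 0 ≤ r)
    (h : ∀ i, |a i - b i| ≤ r) : dist a b ≤ √m * r := by
  rw [EuclideanSpace.dist_eq]
  refine (Real.sqrt_le_left (by positivity)).2 ?_
  rw [mul_pow, Real.sq_sqrt (Nat.cast_nonneg m)]
  calc ∑ i, dist (a i) (b i) ^ 2 ≤ ∑ _i : Fin m, r ^ 2 := by
        refine Finset.sum_le_sum fun i _ => ?_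
        rw [Real.dist_eq]
        have := h i
        gcongr
    _ = m * r ^ 2 := by simp

/-- A Whitney bump at scale `2 ^ i.1` centred at the lattice point `2 ^ i.1 • i.2`. -/
def whitneyBump {m : ℕ} (Z : Set (Euc m)) (i : ℤ × (Fin m → ℤ)) (a : Euc m) : ℝ :=
  max 0 (min ((2:ℝ) ^ i.1 - ‖fun l => a l - (2:ℝ) ^ i.1 * i.2 l‖)
    (min (infDist a Z - (2:ℝ) ^ i.1) (8 * (2:ℝ) ^ i.1 - infDist a Z)))

lemma whitneyBump_nonneg {m : ℕ} (Z : Set (Euc m)) (i : ℤ × (Fin m → ℤ)) (a : Euc m) :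
    0 ≤ whitneyBump Z i a := le_max_left _ _

lemma whitneyBump_sub_le {m : ℕ} (Z : Set (Euc m)) (i : ℤ × (Fin m → ℤ)) (a b : Euc m) :
    whitneyBump Z i a ≤ whitneyBump Z i b + dist a b := by
  have h1 : infDist a Z ≤ infDist b Z + dist a b := infDist_le_infDist_add_dist
  have h2 : infDist b Z ≤ infDist a Z + dist a b := by
    rw [dist_comm]; exact infDist_le_infDist_add_dist
  have h3 : ‖fun l => b l - (2:ℝ) ^ i.1 * i.2 l‖ ≤
      ‖fun l => a l - (2:ℝ) ^ i.1 * i.2 l‖ + dist a b := by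
    rw [pi_norm_le_iff_of_nonneg (by positivity)]
    intro l
    have h4 := norm_le_pi_norm (fun l => a l - (2:ℝ) ^ i.1 * i.2 l) l
    have h5 : ‖(b - a) l‖ ≤ ‖b - a‖ := PiLp.norm_apply_le (b - a) l
    rw [← dist_eq_norm, dist_comm] at h5
    calc ‖b l - (2:ℝ) ^ i.1 * i.2 l‖
        = ‖(a l - (2:ℝ) ^ i.1 * i.2 l) + (b - a) l‖ := by congr 1; simp
      _ ≤ _ := (norm_add_le _ _).trans (add_le_add h4 h5)
  unfold whitneyBump
  have h0 : 0 ≤ dist a b := dist_nonneg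
  rcases max_cases 0 (min ((2:ℝ) ^ i.1 - ‖fun l => a l - (2:ℝ) ^ i.1 * i.2 l‖)
    (min (infDist a Z - (2:ℝ) ^ i.1) (8 * (2:ℝ) ^ i.1 - infDist a Z))) with ⟨h, -⟩ | ⟨h, -⟩
  · rw [h]; have := le_max_left 0 (min ((2:ℝ) ^ i.1 - ‖fun l => b l - (2:ℝ) ^ i.1 * i.2 l‖)
      (min (infDist b Z - (2:ℝ) ^ i.1) (8 * (2:ℝ) ^ i.1 - infDist b Z)))
    linarith
  · rw [h]
    refine le_trans ?_ (add_le_add_left (le_max_right _ _) _)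
    rw [← min_add_add_right, ← min_add_add_right]
    refine min_le_min (by linarith) (min_le_min (by linarith) (by linarith))

lemma whitneyBump_pos {m : ℕ} {Z : Set (Euc m)} {i : ℤ × (Fin m → ℤ)} {a : Euc m}
    (h : 0 < whitneyBump Z i a) : (∀ l, |a l - (2:ℝ) ^ i.1 * i.2 l| < (2:ℝ) ^ i.1) ∧
      (2:ℝ) ^ i.1 < infDist a Z ∧ infDist a Z < 8 * (2:ℝ) ^ i.1 := by
  unfold whitneyBump at h
  rcases lt_max_iff.1 h with h | h
  · exact absurd h (lt_irrefl _)
  · rw [lt_min_iff, lt_min_iff] at h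
    refine ⟨fun l => ?_, by linarith [h.2.1], by linarith [h.2.2]⟩
    have := norm_le_pi_norm (fun l => a l - (2:ℝ) ^ i.1 * i.2 l) l
    rw [Real.norm_eq_abs] at this
    linarith [h.1]

lemma whitneyBump_le {m : ℕ} (Z : Set (Euc m)) (i : ℤ × (Fin m → ℤ)) (a : Euc m) :
    whitneyBump Z i a ≤ infDist a Z := by
  refine max_le infDist_nonneg ((min_le_right _ _).trans ((min_le_left _ _).trans ?_))
  have : (0:ℝ) < 2 ^ i.1 := by positivity
  linarith

lemma exists_whitneyBump_ge {m : ℕ} (Z : Set (Euc m)) (a : Euc m) :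
    ∃ i, infDist a Z / 8 ≤ whitneyBump Z i a := by
  rcases (infDist_nonneg (x := a) (s := Z)).eq_or_lt with h | h
  · exact ⟨(0, 0), by rw [← h, zero_div]; exact whitneyBump_nonneg _ _ _⟩
  · obtain ⟨k, hk1, hk2⟩ := exists_mem_Ico_zpow h one_lt_two
    rw [zpow_add_one₀ two_ne_zero] at hk2
    have e : (2:ℝ) ^ k = 2 * 2 ^ (k - 1) := by
      rw [mul_comm, ← zpow_add_one₀ two_ne_zero, sub_add_cancel]
    rw [e] at hk1 hk2
    have hp : (0:ℝ) < 2 ^ (k - 1) := by positivity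
    refine ⟨(k - 1, fun l => round (a l / 2 ^ (k - 1))), le_trans ?_ (le_max_right _ _)⟩
    have h3 : ‖fun l => a l - (2:ℝ) ^ (k - 1) * (round (a l / 2 ^ (k - 1)) : ℝ)‖ ≤
        2 ^ (k - 1) / 2 := by
      rw [pi_norm_le_iff_of_nonneg (by positivity)]
      intro l
      have := abs_sub_round (a l / 2 ^ (k - 1))
      have e2 : a l - (2:ℝ) ^ (k - 1) * (round (a l / 2 ^ (k - 1)) : ℝ) =
        2 ^ (k - 1) * (a l / 2 ^ (k - 1) - (round (a l / 2 ^ (k - 1)) : ℝ)) := by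
        field_simp
      rw [e2, Real.norm_eq_abs, abs_mul, abs_of_pos hp]
      nlinarith
    refine le_min ?_ (le_min ?_ ?_)
    · simp only; linarith
    · simp only; linarith
    · simp only; linarith

/-- The colour of a Whitney index. -/
def whitneyColor {m : ℕ} (i : ℤ × (Fin m → ℤ)) : ZMod 3 × (Fin m → ZMod 2) :=
  ((i.1 : ZMod 3), fun l => (i.2 l : ZMod 2))

lemma eq_of_whitneyColor_eq {m : ℕ} {Z : Set (Euc m)} {i j : ℤ × (Fin m → ℤ)} {a : Euc m}
    (hi : 0 < whitneyBump Z i a) (hj : 0 < whitneyBump Z j a)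
    (h : whitneyColor i = whitneyColor j) : i = j := by
  obtain ⟨hi1, hi2, hi3⟩ := whitneyBump_pos hi
  obtain ⟨hj1, hj2, hj3⟩ := whitneyBump_pos hj
  have e8 : ∀ k : ℤ, 8 * (2:ℝ) ^ k = 2 ^ (k + 3) := fun k => by
    rw [zpow_add₀ two_ne_zero]; norm_num; ring
  have h1 : i.1 < j.1 + 3 := by
    rw [← zpow_lt_zpow_iff_right₀ (one_lt_two (α := ℝ)), ← e8]; linarith
  have h2 : j.1 < i.1 + 3 := by
    rw [← zpow_lt_zpow_iff_right₀ (one_lt_two (α := ℝ)), ← e8]; linarith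
  have h3 := (ZMod.intCast_eq_intCast_iff_dvd_sub i.1 j.1 3).1 (congrArg Prod.fst h)
  have h4 : i.1 = j.1 := by push_cast at h3; omega
  refine Prod.ext h4 (funext fun l => ?_)
  have h5 := (ZMod.intCast_eq_intCast_iff_dvd_sub (i.2 l) (j.2 l) 2).1
    (congrFun (congrArg Prod.snd h) l)
  have h6 := abs_lt.1 (hi1 l)
  have h7 := abs_lt.1 (hj1 l)
  rw [← h4] at h7
  have hp : (0:ℝ) < 2 ^ i.1 := by positivity
  have h8 : ((i.2 l - j.2 l : ℤ) : ℝ) < 2 := by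
    push_cast
    by_contra hc
    nlinarith
  have h9 : (-2 : ℝ) < ((i.2 l - j.2 l : ℤ) : ℝ) := by
    push_cast
    by_contra hc
    nlinarith
  have h8' : i.2 l - j.2 l < 2 := by exact_mod_cast h8
  have h9' : -2 < i.2 l - j.2 l := by exact_mod_cast h9
  push_cast at h5; omega

/-- Finitely many families of Whitney bumps for the complement of `Z`, with locally constant
base points and scales. -/
lemma exists_colored_bumps {m : ℕ} {Z : Set (Euc m)} (hZ : IsClosed Z) (hne : Z.Nonempty) :
    ∃ (Col : Type) (_ : Fintype Col) (lam : Col → Euc m → ℝ) (z : Col → Euc m → Euc m)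
      (l : Col → Euc m → ℝ) (C : ℝ), 1 ≤ C ∧ (∀ c a, 0 ≤ lam c a) ∧
      (∀ c a b, lam c a ≤ lam c b + dist a b) ∧ (∀ c a, lam c a ≤ infDist a Z) ∧
      (∀ a, ∃ c, infDist a Z / 8 ≤ lam c a) ∧ (∀ c a, z c a ∈ Z) ∧
      (∀ c a, dist a (z c a) ≤ C * infDist a Z) ∧
      (∀ c a, infDist a Z ≤ C * l c a ∧ l c a ≤ C * infDist a Z) ∧
      (∀ c a, 0 < lam c a → ∀ᶠ b in nhds a, z c b = z c a ∧ l c b = l c a) := by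
  classical
  have near : ∀ a : Euc m, ∃ z ∈ Z, dist a z = infDist a Z := fun a => by
    obtain ⟨z, hz, h⟩ := hZ.exists_infDist_eq_dist hne a
    exact ⟨z, hz, h.symm⟩
  choose nr nrZ nrd using near
  let P : (ZMod 3 × (Fin m → ZMod 2)) → Euc m → Prop := fun c a =>
    ∃ i, whitneyColor i = c ∧ 0 < whitneyBump Z i a
  let lam : (ZMod 3 × (Fin m → ZMod 2)) → Euc m → ℝ := fun c a =>
    if h : P c a then whitneyBump Z h.choose a else 0
  let cen : ℤ × (Fin m → ℤ) → Euc m := fun i => WithLp.toLp 2 fun l => (2:ℝ) ^ i.1 * i.2 l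
  let z : (ZMod 3 × (Fin m → ZMod 2)) → Euc m → Euc m := fun c a =>
    if h : P c a then nr (cen h.choose) else nr a
  let l : (ZMod 3 × (Fin m → ZMod 2)) → Euc m → ℝ := fun c a =>
    if h : P c a then (2:ℝ) ^ h.choose.1 else infDist a Z
  have hch : ∀ c a i, whitneyColor i = c → 0 < whitneyBump Z i a →
      ∃ h : P c a, h.choose = i := fun c a i hc hi => by
    have h : P c a := ⟨i, hc, hi⟩
    exact ⟨h, eq_of_whitneyColor_eq h.choose_spec.2 hi (h.choose_spec.1.trans hc.symm)⟩
  have hlam : ∀ c a i, whitneyColor i = c → 0 < whitneyBump Z i a →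
      lam c a = whitneyBump Z i a := fun c a i hc hi => by
    obtain ⟨h, e⟩ := hch c a i hc hi
    simp only [lam, dif_pos h, e]
  have hge : ∀ c a i, whitneyColor i = c → whitneyBump Z i a ≤ lam c a := fun c a i hc => by
    rcases (whitneyBump_nonneg Z i a).eq_or_lt with h | h
    · rw [← h]
      simp only [lam]
      split_ifs
      · exact whitneyBump_nonneg _ _ _
      · exact le_rfl
    · exact (hlam c a i hc h).ge
  have hz : ∀ c a i, whitneyColor i = c → 0 < whitneyBump Z i a → z c a = nr (cen i) :=
    fun c a i hc hi => by
    obtain ⟨h, e⟩ := hch c a i hc hi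
    simp only [z, dif_pos h, e]
  have hl : ∀ c a i, whitneyColor i = c → 0 < whitneyBump Z i a → l c a = 2 ^ i.1 :=
    fun c a i hc hi => by
    obtain ⟨h, e⟩ := hch c a i hc hi
    simp only [l, dif_pos h, e]
  have hnn : ∀ c a, 0 ≤ lam c a := fun c a => by
    by_cases h : P c a
    · simp only [lam, dif_pos h]; exact whitneyBump_nonneg _ _ _
    · simp only [lam, dif_neg h]; exact le_rfl
  have hd : ∀ a : Euc m, 0 ≤ infDist a Z := fun a => infDist_nonneg
  refine ⟨_, inferInstance, lam, z, l, 8 + 2 * √m, ?_, hnn, ?_, ?_, ?_, ?_, ?_, ?_, ?_⟩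
  · have := Real.sqrt_nonneg m; linarith
  · intro c a b
    by_cases h : P c a
    · obtain ⟨i, hc, hi⟩ := h
      rw [hlam c a i hc hi]
      exact (whitneyBump_sub_le Z i a b).trans (add_le_add_left (hge c b i hc) _)
    · simp only [lam, dif_neg h]; exact add_nonneg (hnn c b) dist_nonneg
  · intro c a
    by_cases h : P c a
    · simp only [lam, dif_pos h]; exact whitneyBump_le _ _ _
    · simp only [lam, dif_neg h]; exact hd a
  · intro a
    obtain ⟨i, hi⟩ := exists_whitneyBump_ge Z a
    exact ⟨whitneyColor i, hi.trans (hge _ a i rfl)⟩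
  · intro c a
    by_cases h : P c a
    · simp only [z, dif_pos h]; exact nrZ _
    · simp only [z, dif_neg h]; exact nrZ _
  · intro c a
    by_cases h : P c a
    · obtain ⟨i, hc, hi⟩ := h
      rw [hz c a i hc hi]
      obtain ⟨h1, h2, h3⟩ := whitneyBump_pos hi
      have h4 : dist a (cen i) ≤ √m * 2 ^ i.1 :=
        Euc.dist_le_sqrt_mul _ _ (by positivity) fun l => (h1 l).le
      have h5 : infDist (cen i) Z ≤ infDist a Z + dist (cen i) a := infDist_le_infDist_add_dist
      rw [dist_comm] at h5
      have h6 := dist_triangle a (cen i) (nr (cen i))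
      rw [nrd] at h6
      have h7 : √m * 2 ^ i.1 ≤ √m * infDist a Z := by gcongr
      linarith [hd a]
    · simp only [z, dif_neg h, nrd]
      have := mul_nonneg (Real.sqrt_nonneg m) (hd a)
      linarith [hd a]
  · intro c a
    by_cases h : P c a
    · obtain ⟨i, hc, hi⟩ := h
      rw [hl c a i hc hi]
      obtain ⟨h1, h2, h3⟩ := whitneyBump_pos hi
      have h4 : 0 ≤ √m * 2 ^ i.1 := by positivity
      have h5 : 0 ≤ √m * infDist a Z := mul_nonneg (Real.sqrt_nonneg m) (hd a)
      constructor <;> linarith [hd a]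
    · simp only [l, dif_neg h]
      have := mul_nonneg (Real.sqrt_nonneg m) (hd a)
      constructor <;> linarith [hd a]
  · intro c a hpos
    by_cases h : P c a
    · obtain ⟨i, hc, hi⟩ := h
      have : ∀ᶠ b in nhds a, dist a b < whitneyBump Z i a := by
        filter_upwards [ball_mem_nhds a hi] with b hb
        rwa [dist_comm]
      filter_upwards [this] with b hb
      have hb' : 0 < whitneyBump Z i b := by linarith [whitneyBump_sub_le Z i a b]
      rw [hz c a i hc hi, hl c a i hc hi, hz c b i hc hb', hl c b i hc hb']
      exact ⟨rfl, rfl⟩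
    · simp only [lam, dif_neg h, lt_irrefl] at hpos

section Gap
variable {K : Type*}

/-- The amount by which the values of `μ` on `J` exceed the values outside of `J`. -/
def gap (J : Finset K) (μ : K → ℝ) : ℝ :=
  max 0 (⨅ q : {q : K × K // q.1 ∈ J ∧ q.2 ∉ J}, (μ q.1.1 - μ q.1.2))

lemma gap_nonneg (J : Finset K) (μ : K → ℝ) : 0 ≤ gap J μ := le_max_left _ _

lemma exists_of_gap_pos {J : Finset K} {μ : K → ℝ} (h : 0 < gap J μ) :
    (∃ c, c ∈ J) ∧ ∃ b, b ∉ J := by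
  by_contra hne
  have : IsEmpty {q : K × K // q.1 ∈ J ∧ q.2 ∉ J} :=
    ⟨fun q => hne ⟨⟨_, q.2.1⟩, ⟨_, q.2.2⟩⟩⟩
  rw [gap, Real.iInf_of_isEmpty, max_self] at h
  exact lt_irrefl _ h

lemma le_gap {J : Finset K} {μ : K → ℝ} {t : ℝ} (h1 : ∃ c, c ∈ J) (h2 : ∃ b, b ∉ J)
    (h : ∀ c ∈ J, ∀ b ∉ J, t ≤ μ c - μ b) : t ≤ gap J μ := by
  obtain ⟨c, hc⟩ := h1
  obtain ⟨b, hb⟩ := h2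
  have : Nonempty {q : K × K // q.1 ∈ J ∧ q.2 ∉ J} := ⟨⟨(c, b), hc, hb⟩⟩
  exact (le_ciInf fun q : {q : K × K // q.1 ∈ J ∧ q.2 ∉ J} =>
    h _ q.2.1 _ q.2.2).trans (le_max_right _ _)

variable [Fintype K]

lemma gap_le_sub {J : Finset K} {μ : K → ℝ} (h : 0 < gap J μ) {c b : K} (hc : c ∈ J)
    (hb : b ∉ J) : gap J μ ≤ μ c - μ b := by
  rcases lt_max_iff.1 h with h' | h'
  · exact absurd h' (lt_irrefl _)
  · rw [gap, max_eq_right h'.le]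
    exact ciInf_le (f := fun q : {q : K × K // q.1 ∈ J ∧ q.2 ∉ J} => μ q.1.1 - μ q.1.2)
      (Set.finite_range _).bddBelow ⟨(c, b), hc, hb⟩

lemma gap_le_add {μ ν : K → ℝ} {δ : ℝ} (hδ : 0 ≤ δ) (h1 : ∀ c, μ c ≤ ν c + δ)
    (h2 : ∀ c, ν c ≤ μ c + δ) (J : Finset K) : gap J μ ≤ gap J ν + 2 * δ := by
  rcases (gap_nonneg J μ).eq_or_lt with h | h
  · rw [← h]; have := gap_nonneg J ν; linarith
  · obtain ⟨hc, hb⟩ := exists_of_gap_pos h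
    have : gap J μ - 2 * δ ≤ gap J ν := le_gap hc hb fun c hc b hb => by
      linarith [gap_le_sub h hc hb, h1 c, h2 b]
    linarith

lemma eq_of_gap_pos {J J' : Finset K} {μ : K → ℝ} (h : 0 < gap J μ) (h' : 0 < gap J' μ)
    (hcard : J.card = J'.card) : J = J' := by
  classical
  by_contra hne
  have h1 : ¬ J ⊆ J' := fun hs => hne (Finset.eq_of_subset_of_card_le hs hcard.ge)
  have h2 : ¬ J' ⊆ J := fun hs => hne (Finset.eq_of_subset_of_card_le hs hcard.le).symm
  obtain ⟨c, hc, hc'⟩ := Finset.not_subset.1 h1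
  obtain ⟨b, hb, hb'⟩ := Finset.not_subset.1 h2
  linarith [gap_le_sub h hc hb', gap_le_sub h' hb hc']

/-- The gap between the `k`-th and `k+1`-st largest values of `μ`. -/
def orderGap (k : ℕ) (μ : K → ℝ) : ℝ :=
  ∑ J ∈ Finset.univ.powersetCard (k + 1), gap J μ

lemma orderGap_nonneg (k : ℕ) (μ : K → ℝ) : 0 ≤ orderGap k μ :=
  Finset.sum_nonneg fun J _ => gap_nonneg J μ

lemma gap_le_orderGap {k : ℕ} (μ : K → ℝ) {J : Finset K} (hJ : J.card = k + 1) :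
    gap J μ ≤ orderGap k μ :=
  Finset.single_le_sum (f := fun J => gap J μ) (fun J _ => gap_nonneg J μ)
    (Finset.mem_powersetCard.2 ⟨Finset.subset_univ _, hJ⟩)

lemma exists_gap_pos {k : ℕ} {μ : K → ℝ} (h : 0 < orderGap k μ) :
    ∃ J : Finset K, J.card = k + 1 ∧ 0 < gap J μ := by
  by_contra! hc
  refine h.not_ge (Finset.sum_nonpos fun J hJ => hc J (Finset.mem_powersetCard.1 hJ).2)

lemma orderGap_le_add (k : ℕ) {μ ν : K → ℝ} {δ : ℝ} (hδ : 0 ≤ δ) (h1 : ∀ c, μ c ≤ ν c + δ)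
    (h2 : ∀ c, ν c ≤ μ c + δ) :
    orderGap k μ ≤ orderGap k ν + 2 * Fintype.card (Finset K) * δ := by
  classical
  calc orderGap k μ ≤ ∑ J ∈ Finset.univ.powersetCard (k + 1), (gap J ν + 2 * δ) :=
        Finset.sum_le_sum fun J _ => gap_le_add hδ h1 h2 J
    _ = orderGap k ν + ((Finset.univ : Finset K).powersetCard (k + 1)).card * (2 * δ) := by
        rw [Finset.sum_add_distrib, Finset.sum_const, nsmul_eq_mul, orderGap]
    _ ≤ orderGap k ν + Fintype.card (Finset K) * (2 * δ) := by
        gcongr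
        exact Finset.card_le_univ _
    _ = _ := by ring

lemma exists_order_statistics {n : ℕ} (hK : n + 2 ≤ Fintype.card K) (μ : K → ℝ) :
    ∃ e : Fin (n + 2) ↪ K, (∀ c, μ c ≤ μ (e 0)) ∧
      ∀ i, μ (e 0) - μ (e i) ≤ ∑ k ∈ Finset.range (n + 1), orderGap k μ := by
  classical
  set N := Fintype.card K with hN
  let eq := Fintype.equivFin K
  let σ : Fin N ≃ K := (Tuple.sort fun i => - μ (eq.symm i)).trans eq.symm
  have hanti : ∀ i j : Fin N, i ≤ j → μ (σ j) ≤ μ (σ i) := fun i j hij =>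
    neg_le_neg_iff.1 (Tuple.monotone_sort (fun i => - μ (eq.symm i)) hij)
  let s : ℕ → ℝ := fun k => if h : k < N then μ (σ ⟨k, h⟩) else 0
  have hgap : ∀ k ∈ Finset.range (n + 1), s k - s (k + 1) ≤ orderGap k μ := by
    intro k hk
    have hk' := Finset.mem_range.1 hk
    let J : Finset K := (Finset.univ.filter fun i : Fin N => (i : ℕ) ≤ k).map σ.toEmbedding
    have hJ : J.card = k + 1 := by
      rw [Finset.card_map]
      have : (Finset.univ.filter fun i : Fin N => (i : ℕ) ≤ k) = Finset.Iic ⟨k, by omega⟩ := by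
        ext i; simp [Fin.le_def]
      rw [this, Fin.card_Iic]
    have hmem : ∀ i, σ i ∈ J ↔ (i : ℕ) ≤ k := fun i => by simp [J]
    refine le_trans (le_gap ⟨σ ⟨k, by omega⟩, (hmem _).2 le_rfl⟩
      ⟨σ ⟨k + 1, by omega⟩, by rw [hmem]; simp⟩ ?_) (gap_le_orderGap μ hJ)
    intro c hc b hb
    obtain ⟨i, rfl⟩ := σ.surjective c
    obtain ⟨j, rfl⟩ := σ.surjective b
    rw [hmem] at hc hb
    have h1 := hanti i ⟨k, by omega⟩ hc
    have h2 := hanti ⟨k + 1, by omega⟩ j (by rw [Fin.le_def]; simp only; omega)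
    simp only [s]
    rw [dif_pos (by omega), dif_pos (by omega)]
    linarith
  refine ⟨(Fin.castLEEmb hK).trans σ.toEmbedding, fun c => ?_, fun i => ?_⟩
  · obtain ⟨i, rfl⟩ := σ.surjective c
    exact hanti _ _ (by rw [Fin.le_def]; simp)
  · have h1 : s 0 - s i ≤ ∑ k ∈ Finset.range (n + 1), orderGap k μ := by
      rw [← Finset.sum_range_sub' s i]
      have hsub : Finset.range (i : ℕ) ⊆ Finset.range (n + 1) :=
        Finset.range_subset_range.2 (by have := i.isLt; omega)
      exact (Finset.sum_le_sum fun k hk => hgap k (hsub hk)).trans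
        (Finset.sum_le_sum_of_subset_of_nonneg hsub fun k _ _ => orderGap_nonneg k μ)
    have hi := i.isLt
    simp only [s] at h1
    rw [dif_pos (by omega), dif_pos (by omega)] at h1
    exact h1

end Gap

/-- Lipschitz weights `G k` on the complement of `Z`, with base points `z k` in `Z` and scales
`l k` comparable to the distance to `Z` which are locally constant where `G k` is positive. -/
structure WhitneySystem {m : ℕ} (Z : Set (Euc m)) where
  G : ℕ → Euc m → ℝ
  z : ℕ → Euc m → Euc m
  l : ℕ → Euc m → ℝ
  C : ℝ
  one_le_C : 1 ≤ C
  G_nonneg : ∀ k a, 0 ≤ G k a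
  G_lip : ∀ k a b, G k a ≤ G k b + C * dist a b
  G_eq_zero : ∀ k, ∀ a ∈ Z, G k a = 0
  z_mem : ∀ k a, z k a ∈ Z
  dist_z : ∀ k a, dist a (z k a) ≤ C * infDist a Z
  infDist_le : ∀ k a, infDist a Z ≤ C * l k a
  l_le : ∀ k a, l k a ≤ C * infDist a Z
  eventually_eq : ∀ k a, 0 < G k a → ∀ᶠ b in nhds a, z k b = z k a ∧ l k b = l k a

/-- The total weight of the first `n + 1` functions of a Whitney system. -/
def WhitneySystem.S {m : ℕ} {Z : Set (Euc m)} (W : WhitneySystem Z) (n : ℕ) (a : Euc m) : ℝ :=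
  ∑ k ∈ Finset.range (n + 1), W.G k a

lemma exists_whitneySystem_of_shift {m : ℕ} (n : ℕ) {Z : Set (Euc m)} (hZ : IsClosed Z)
    (hne : Z.Nonempty) :
    ∃ (Col : Type) (_ : Fintype Col) (lam : Col → Euc m → ℝ), (∀ c, Continuous (lam c)) ∧
      ∀ ξ : Col → ℝ, (∀ c, ξ c ∈ Icc (0 : ℝ) (1 / 16)) → ∃ W : WhitneySystem Z,
        ∀ a, infDist a Z / 16 ≤ W.S n a ∨ ∃ e : Fin (n + 2) ↪ Col, ∀ i,
          |lam (e 0) a - ξ (e 0) * infDist a Z - (lam (e i) a - ξ (e i) * infDist a Z)| ≤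
            W.S n a := by
  classical
  obtain ⟨Col, _, lam, z, l, C, hC, hlam0, hlip, hlamd, hcov, hzZ, hzd, hl, hloc⟩ :=
    exists_colored_bumps hZ hne
  have hcol : Nonempty Col := by
    obtain ⟨a, -⟩ := hne
    exact ⟨(hcov a).choose⟩
  refine ⟨Col, inferInstance, lam, fun c => ?_, fun ξ hξ => ?_⟩
  · refine (LipschitzWith.of_le_add_mul 1 fun a b => ?_).continuous
    simpa using hlip c a b
  set N : ℝ := (Fintype.card (Finset (Col ⊕ Fin (n + 2))) : ℝ) with hN
  have hN1 : 1 ≤ N := by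
    have : 0 < Fintype.card (Finset (Col ⊕ Fin (n + 2))) := Fintype.card_pos
    rw [hN]
    exact_mod_cast this
  have hd : ∀ a : Euc m, 0 ≤ infDist a Z := fun a => infDist_nonneg
  let μ : Euc m → Col ⊕ Fin (n + 2) → ℝ := fun a =>
    Sum.elim (fun c => max 0 (lam c a - ξ c * infDist a Z)) fun _ => 0
  have μlip : ∀ a b c, μ a c ≤ μ b c + 2 * dist a b := by
    rintro a b (c | c)
    · simp only [μ, Sum.elim_inl]
      have h0 : 0 ≤ dist a b := dist_nonneg
      have h1 := hlip c a b
      have h2 : infDist b Z ≤ infDist a Z + dist a b := by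
        rw [dist_comm]; exact infDist_le_infDist_add_dist
      have h3 := (hξ c).1
      have h4 := (hξ c).2
      refine max_le (by have := le_max_left 0 (lam c b - ξ c * infDist b Z); linarith) ?_
      have := le_max_right 0 (lam c b - ξ c * infDist b Z)
      nlinarith
    · simp only [μ, Sum.elim_inr]
      have h0 : 0 ≤ dist a b := dist_nonneg
      linarith
  have μlip' : ∀ a b c, μ b c ≤ μ a c + 2 * dist a b := fun a b c => by
    rw [dist_comm]; exact μlip b a c
  have μ0 : ∀ a c, 0 ≤ μ a c := by
    rintro a (c | c)
    · exact le_max_left _ _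
    · exact le_rfl
  have μpos : ∀ a c, 0 < μ a c → ∃ c', c = Sum.inl c' ∧ 0 < lam c' a ∧
      μ a c = lam c' a - ξ c' * infDist a Z := by
    rintro a (c | c) h
    · rcases lt_max_iff.1 h with h' | h'
      · exact absurd h' (lt_irrefl _)
      · refine ⟨c, rfl, ?_, max_eq_right h'.le⟩
        have := mul_nonneg (hξ c).1 (hd a)
        linarith
    · exact absurd h (lt_irrefl _)
  let pick : Finset (Col ⊕ Fin (n + 2)) → Col := fun J =>
    if h : ∃ c, Sum.inl c ∈ J then h.choose else hcol.some
  have hpick : ∀ J a, 0 < gap J (μ a) → 0 < lam (pick J) a := by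
    intro J a h
    obtain ⟨⟨c, hc⟩, b, hb⟩ := exists_of_gap_pos h
    have hpos : ∀ c ∈ J, 0 < μ a c := fun c hc => by
      linarith [gap_le_sub h hc hb, μ0 a b]
    obtain ⟨c', rfl, -, -⟩ := μpos a c (hpos c hc)
    have hex : ∃ c, Sum.inl c ∈ J := ⟨c', hc⟩
    obtain ⟨c'', h1, h2, -⟩ := μpos a _ (hpos _ hex.choose_spec)
    simp only [pick, dif_pos hex]
    rwa [Sum.inl_injective h1]
  let act : ℕ → Euc m → Col := fun k a =>
    if h : ∃ J : Finset (Col ⊕ Fin (n + 2)), J.card = k + 1 ∧ 0 < gap J (μ a) then pick h.choose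
    else hcol.some
  have hact : ∀ k a J, J.card = k + 1 → 0 < gap J (μ a) → act k a = pick J := by
    intro k a J hJ h
    have hex : ∃ J : Finset (Col ⊕ Fin (n + 2)), J.card = k + 1 ∧ 0 < gap J (μ a) := ⟨J, hJ, h⟩
    simp only [act, dif_pos hex]
    rw [eq_of_gap_pos hex.choose_spec.2 h (hex.choose_spec.1.trans hJ.symm)]
  have gaplip : ∀ J a b, gap J (μ a) ≤ gap J (μ b) + 4 * dist a b := fun J a b => by
    have := gap_le_add (by positivity) (μlip a b) (μlip' a b) J
    linarith
  refine ⟨WhitneySystem.mk (fun k a => orderGap k (μ a)) (fun k a => z (act k a) a)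
    (fun k a => l (act k a) a)
    (max C (4 * N)) (hC.trans (le_max_left _ _)) (fun k a => orderGap_nonneg _ _) ?_ ?_
    (fun k a => hzZ _ _) (fun k a => (hzd (act k a) a).trans ?_) (fun k a => (hl (act k a) a).1.trans ?_)
    (fun k a => (hl (act k a) a).2.trans ?_) ?_, ?_⟩
  · intro k a b
    have := orderGap_le_add k (by positivity) (μlip a b) (μlip' a b)
    rw [← hN] at this
    have h2 : 4 * N * dist a b ≤ max C (4 * N) * dist a b := by gcongr; exact le_max_right _ _
    linarith
  · intro k a ha
    refine Finset.sum_eq_zero fun J _ => ?_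
    by_contra hc
    have := hpick J a ((gap_nonneg J _).lt_of_ne' hc)
    have h2 := hlamd (pick J) a
    rw [infDist_zero_of_mem ha] at h2
    linarith
  · gcongr
    exacts [hd a, le_max_left _ _]
  · have : 0 ≤ l (act k a) a := by
      by_contra hc
      have h1 := (hl (act k a) a).1
      nlinarith [hd a]
    gcongr
    exact le_max_left _ _
  · gcongr
    exacts [hd a, le_max_left _ _]
  · intro k a h
    obtain ⟨J, hJ, hg⟩ := exists_gap_pos h
    have h1 : ∀ᶠ b in nhds a, dist a b < gap J (μ a) / 4 := by
      filter_upwards [ball_mem_nhds a (show 0 < gap J (μ a) / 4 by positivity)] with b hb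
      rwa [dist_comm]
    filter_upwards [h1, hloc _ a (hpick J a hg)] with b hb hb2
    have hgb : 0 < gap J (μ b) := by linarith [gaplip J a b]
    rw [hact k a J hJ hg, hact k b J hJ hgb]
    exact hb2
  · intro a
    obtain ⟨e, he1, he2⟩ := exists_order_statistics (n := n) (K := Col ⊕ Fin (n + 2))
      (by rw [Fintype.card_sum, Fintype.card_fin]; omega) (μ a)
    by_cases hall : ∀ i, 0 < μ a (e i)
    · right
      have := fun i => μpos a (e i) (hall i)
      choose c hc1 hc2 hc3 using this
      refine ⟨⟨c, fun i j hij => e.injective (by rw [hc1 i, hc1 j, hij])⟩, fun i => ?_⟩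
      have h1 := he2 i
      have h2 := he1 (e i)
      change |lam (c 0) a - ξ (c 0) * infDist a Z - (lam (c i) a - ξ (c i) * infDist a Z)| ≤ _
      rw [← hc3, ← hc3, abs_of_nonneg (by linarith)]
      exact h1
    · left
      push Not at hall
      obtain ⟨i, hi⟩ := hall
      have h1 := he2 i
      obtain ⟨c, hc⟩ := hcov a
      have h2 := he1 (Sum.inl c)
      have h3 : lam c a - ξ c * infDist a Z ≤ μ a (Sum.inl c) := le_max_right _ _
      have h4 := mul_le_mul_of_nonneg_right (hξ c).2 (hd a)
      change infDist a Z / 16 ≤ ∑ k ∈ Finset.range (n + 1), orderGap k (μ a)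
      linarith

lemma ENNReal.rpow_neg_le_rpow_neg {x y : ENNReal} {r : ℝ} (hr : 0 ≤ r) (h : x ≤ y) :
    y ^ (-r) ≤ x ^ (-r) := by
  rw [ENNReal.rpow_neg, ENNReal.rpow_neg]
  exact ENNReal.inv_le_inv.2 (ENNReal.rpow_le_rpow h hr)

lemma lintegral_abs_rpow_neg_lt_top {r : ℝ} (hr : r < 1) :
    ∫⁻ x in Ioo (-1 : ℝ) 1, (ENNReal.ofReal |x|) ^ (-r) < ⊤ := by
  have h1 : IntegrableOn (fun x : ℝ => |x| ^ (-r)) (Ioo 0 1) := by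
    refine ((intervalIntegral.integrableOn_Ioo_rpow_iff one_pos).2
      (by linarith : -1 < -r)).congr_fun (fun x hx => ?_) measurableSet_Ioo
    simp only [abs_of_pos hx.1]
  have h2 : IntegrableOn (fun x : ℝ => |x| ^ (-r)) (Ioo (-1) 0) := by
    have := h1.comp_neg
    simpa using this
  have h3 : IntegrableOn (fun x : ℝ => |x| ^ (-r)) (Ioo (-1) 0 ∪ Ioo 0 1) := h2.union h1
  have h4 : (Ioo (-1 : ℝ) 1 : Set ℝ) =ᵐ[volume] (Ioo (-1) 0 ∪ Ioo 0 1 : Set ℝ) := by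
    have : ∀ᵐ x : ℝ, x ≠ 0 := by simp [ae_iff]
    filter_upwards [this] with x hx
    refine propext ⟨fun h => ?_, fun h => ?_⟩
    · rcases lt_or_gt_of_ne hx with h0 | h0
      · exact Or.inl ⟨h.1, h0⟩
      · exact Or.inr ⟨h0, h.2⟩
    · rcases h with h | h
      · exact ⟨h.1, h.2.trans one_pos⟩
      · exact ⟨by linarith [h.1], h.2⟩
  rw [setLIntegral_congr h4]
  have h5 := h3.lintegral_lt_top
  refine lt_of_le_of_lt (le_of_eq ?_) h5
  refine setLIntegral_congr_fun (measurableSet_Ioo.union measurableSet_Ioo) fun x hx => ?_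
  have hx0 : x ≠ 0 := by
    rcases hx with h | h
    · exact h.2.ne
    · exact h.1.ne'
  rw [ENNReal.ofReal_rpow_of_pos (abs_pos.2 hx0)]

lemma exists_lintegral_shift_le {r : ℝ} (hr0 : 0 ≤ r) (hr : r < 1) :
    ∃ A : ENNReal, A ≠ ⊤ ∧ ∀ b : ℝ,
      ∫⁻ x in Icc (0 : ℝ) (1 / 16), (ENNReal.ofReal |b + x|) ^ (-r) ≤ A := by
  set g : ℝ → ENNReal := fun x => (ENNReal.ofReal |x|) ^ (-r) with hg
  refine ⟨volume (Icc (0 : ℝ) (1 / 16)) + ∫⁻ x in Ioo (-1 : ℝ) 1, g x,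
    ENNReal.add_ne_top.2 ⟨by simp, (lintegral_abs_rpow_neg_lt_top hr).ne⟩, fun b => ?_⟩
  have hle : ∀ x, g x ≤ 1 + (Ioo (-1 : ℝ) 1).indicator g x := by
    intro x
    by_cases hx : x ∈ Ioo (-1 : ℝ) 1
    · rw [indicator_of_mem hx]; exact le_add_self
    · rw [indicator_of_notMem hx, add_zero]
      have h1 : 1 ≤ |x| := by
        by_contra hc
        exact hx (abs_lt.1 (not_le.1 hc))
      calc g x ≤ 1 ^ (-r) := ENNReal.rpow_neg_le_rpow_neg hr0
            (by rw [← ENNReal.ofReal_one]; exact ENNReal.ofReal_le_ofReal h1)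
        _ = 1 := ENNReal.one_rpow _
  have hm : Measurable ((Ioo (-1 : ℝ) 1).indicator g) := by
    refine Measurable.indicator ?_ measurableSet_Ioo
    fun_prop
  calc ∫⁻ x in Icc (0 : ℝ) (1 / 16), g (b + x)
      ≤ ∫⁻ x in Icc (0 : ℝ) (1 / 16), (1 + (Ioo (-1 : ℝ) 1).indicator g (b + x)) :=
        lintegral_mono fun x => hle _
    _ = volume (Icc (0 : ℝ) (1 / 16)) +
        ∫⁻ x in Icc (0 : ℝ) (1 / 16), (Ioo (-1 : ℝ) 1).indicator g (b + x) := by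
        rw [lintegral_add_left measurable_const, setLIntegral_one]
    _ ≤ volume (Icc (0 : ℝ) (1 / 16)) + ∫⁻ x, (Ioo (-1 : ℝ) 1).indicator g (b + x) := by
        gcongr; exact Measure.restrict_le_self
    _ = _ := by
        rw [lintegral_add_left_eq_self, lintegral_indicator measurableSet_Ioo]

lemma lintegral_pi_prod_le {K : Type*} [Fintype K] (ν : Measure ℝ) [IsFiniteMeasure ν]
    {g : ℝ → ENNReal} (hg : Measurable g) {A : ENNReal} (hA : ∀ b, ∫⁻ x, g (b + x) ∂ν ≤ A)
    (o : K) (s : Finset K) (ho : o ∉ s) (β : K → ℝ) :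
    ∫⁻ ξ, ∏ c ∈ s, g (β c - ξ o + ξ c) ∂Measure.pi (fun _ : K => ν) ≤
      A ^ s.card * ν univ ^ (Fintype.card K - s.card) := by
  classical
  have hmeas : ∀ s : Finset K, Measurable fun ξ : K → ℝ => ∏ c ∈ s, g (β c - ξ o + ξ c) :=
    fun s => Finset.measurable_fun_prod _ fun c _ => hg.comp (by fun_prop)
  have key : ∀ s : Finset K, o ∉ s → ∀ x,
      (∫⋯∫⁻_s, (fun ξ : K → ℝ => ∏ c ∈ s, g (β c - ξ o + ξ c)) ∂fun _ => ν) x ≤ A ^ s.card := by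
    intro s
    induction s using Finset.induction with
    | empty => intro _ x; simp
    | insert i s hi ih =>
      intro ho x
      rw [Finset.mem_insert, not_or] at ho
      rw [lmarginal_insert' _ (hmeas _) hi, Finset.card_insert_of_notMem hi, pow_succ']
      have h1 : (fun ξ : K → ℝ => ∫⁻ t, ∏ c ∈ insert i s,
          g (β c - Function.update ξ i t o + Function.update ξ i t c) ∂ν) ≤
          fun ξ => A * ∏ c ∈ s, g (β c - ξ o + ξ c) := by
        intro ξ
        have h2 : ∀ t, ∏ c ∈ insert i s,
            g (β c - Function.update ξ i t o + Function.update ξ i t c) =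
            g ((β i - ξ o) + t) * ∏ c ∈ s, g (β c - ξ o + ξ c) := fun t => by
          rw [Finset.prod_insert hi, Function.update_self, Function.update_of_ne ho.1]
          congr 1
          refine Finset.prod_congr rfl fun c hc => ?_
          rw [Function.update_of_ne (ne_of_mem_of_not_mem hc hi)]
        simp only [h2]
        have h3 : Measurable fun t => g (β i - ξ o + t) := hg.comp (measurable_const_add _)
        rw [lintegral_mul_const _ h3]
        gcongr
        exact hA _
      refine (lmarginal_mono h1 x).trans ?_
      have h3 : (∫⋯∫⁻_s, (fun ξ : K → ℝ => A * ∏ c ∈ s, g (β c - ξ o + ξ c)) ∂fun _ => ν) x =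
          A * (∫⋯∫⁻_s, (fun ξ : K → ℝ => ∏ c ∈ s, g (β c - ξ o + ξ c)) ∂fun _ => ν) x := by
        unfold lmarginal
        exact lintegral_const_mul _ ((hmeas s).comp measurable_updateFinset)
      rw [h3]
      gcongr
      exact ih ho.2 x
  rw [lintegral_eq_lmarginal_univ 0, ← Finset.union_compl s,
    lmarginal_union' _ _ (hmeas s) disjoint_compl_right]
  refine (lmarginal_mono (g := fun _ => A ^ s.card) (key s ho) 0).trans ?_
  unfold lmarginal
  rw [lintegral_const, Measure.pi_univ, ← Finset.card_compl]
  simp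

lemma exists_whitneySystem {m : ℕ} (n : ℕ) {Z : Set (Euc m)} (hZ : IsClosed Z)
    (hne : Z.Nonempty) {p : ℝ} (hp0 : 0 ≤ p) (hp : p < n + 1) :
    ∃ W : WhitneySystem Z, ∀ R : ℝ,
      ∫⁻ a in ball 0 R \ Z, (ENNReal.ofReal (W.S n a / infDist a Z)) ^ (-p) < ⊤ := by
  classical
  obtain ⟨Col, _, lam, hlam, hW⟩ := exists_whitneySystem_of_shift n hZ hne
  have hn : (0 : ℝ) < n + 1 := by positivity
  set r : ℝ := p / (n + 1) with hr
  have hr0 : 0 ≤ r := by positivity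
  have hr1 : r < 1 := (div_lt_one hn).2 hp
  obtain ⟨A, hA, hAb⟩ := exists_lintegral_shift_le hr0 hr1
  set g : ℝ → ENNReal := fun x => (ENNReal.ofReal |x|) ^ (-r) with hg
  have hgm : Measurable g := by fun_prop
  set ν : Measure ℝ := volume.restrict (Icc (0 : ℝ) (1 / 16)) with hν
  let s : (Fin (n + 2) ↪ Col) → Finset Col := fun e =>
    Finset.univ.map ((Fin.succEmb (n + 1)).trans e)
  let K₀ : ENNReal := (ENNReal.ofReal (1 / 16)) ^ (-p)
  have hK₀ : K₀ ≠ ⊤ := by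
    refine ENNReal.rpow_ne_top_of_ne_zero ?_ ENNReal.ofReal_ne_top
    simp
  let B : Euc m → (Col → ℝ) → ENNReal := fun a ξ => K₀ + ∑ e : Fin (n + 2) ↪ Col,
    ∏ c ∈ s e, g ((lam (e 0) a - lam c a) / infDist a Z - ξ (e 0) + ξ c)
  have hBm : Measurable (Function.uncurry B) := by
    refine measurable_const.add (Finset.measurable_fun_sum _ fun e _ =>
      Finset.measurable_fun_prod _ fun c _ => hgm.comp ?_)
    have h1 := fun c => (hlam c).measurable
    have h2 : Measurable fun a : Euc m => infDist a Z := (continuous_infDist_pt Z).measurable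
    fun_prop
  have hcard : ∀ e, (s e).card = n + 1 := fun e => by simp [s]
  have ho : ∀ e : Fin (n + 2) ↪ Col, e 0 ∉ s e := fun e => by
    simp only [s, Finset.mem_map, Finset.mem_univ, true_and, not_exists]
    intro i hi
    exact Fin.succ_ne_zero i (e.injective hi)
  set P : Measure (Col → ℝ) := Measure.pi fun _ : Col => ν with hP
  obtain ⟨M, hM, hMb⟩ : ∃ M : ENNReal, M ≠ ⊤ ∧ ∀ a, ∫⁻ ξ, B a ξ ∂P ≤ M := by
    refine ⟨K₀ * P univ + ∑ e : Fin (n + 2) ↪ Col,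
      A ^ (s e).card * ν univ ^ (Fintype.card Col - (s e).card), ?_, fun a => ?_⟩
    · refine ENNReal.add_ne_top.2 ⟨ENNReal.mul_ne_top hK₀ (measure_ne_top _ _),
        ENNReal.sum_ne_top.2 fun e _ => ENNReal.mul_ne_top (ENNReal.pow_ne_top hA)
          (ENNReal.pow_ne_top (measure_ne_top _ _))⟩
    · rw [lintegral_add_left measurable_const, lintegral_const, lintegral_finsetSum]
      · gcongr with e
        exact lintegral_pi_prod_le ν hgm hAb _ _ (ho e) _
      · exact fun e _ => Finset.measurable_fun_prod _ fun c _ => hgm.comp (by fun_prop)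
  have hae : ∀ᵐ ξ ∂P, ∀ R : ℕ, ∫⁻ a in ball (0 : Euc m) R \ Z, B a ξ < ⊤ := by
    rw [ae_all_iff]
    intro R
    refine ae_lt_top ?_ ?_
    · exact (hBm.comp measurable_swap).lintegral_prod_right'
    · rw [← lintegral_lintegral_swap hBm.aemeasurable]
      refine ne_top_of_le_ne_top ?_ (lintegral_mono hMb)
      rw [lintegral_const]
      refine ENNReal.mul_ne_top hM ?_
      rw [Measure.restrict_apply_univ]
      exact ((measure_mono sdiff_subset).trans_lt measure_ball_lt_top).ne
  have hae2 : ∀ᵐ ξ ∂P, ∀ c, ξ c ∈ Icc (0 : ℝ) (1 / 16) := by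
    rw [hP, hν, ← Measure.restrict_pi_pi]
    filter_upwards [ae_restrict_mem (MeasurableSet.univ_pi fun _ => measurableSet_Icc)]
      with ξ hξ c
    exact hξ c (mem_univ c)
  have hP0 : P ≠ 0 := by
    intro h0
    have : P univ = 0 := by rw [h0]; simp
    rw [hP, Measure.pi_univ] at this
    simp [hν] at this
  have : (ae P).NeBot := ae_neBot.2 hP0
  obtain ⟨ξ, h1, h2⟩ := (hae.and hae2).exists
  obtain ⟨W, hWξ⟩ := hW ξ h2
  refine ⟨W, fun R => ?_⟩
  obtain ⟨N, hN⟩ := exists_nat_ge R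
  have hsub : ball (0 : Euc m) R \ Z ⊆ ball (0 : Euc m) N \ Z :=
    sdiff_subset_sdiff_left (ball_subset_ball hN)
  refine lt_of_le_of_lt ((lintegral_mono_set hsub).trans
    (setLIntegral_mono' (measurableSet_ball.diff hZ.measurableSet) fun a ha => ?_)) (h1 N)
  have hd : 0 < infDist a Z := (hZ.notMem_iff_infDist_pos hne).1 ha.2
  rcases hWξ a with h | ⟨e, he⟩
  · refine le_trans ?_ le_self_add
    refine ENNReal.rpow_neg_le_rpow_neg hp0 (ENNReal.ofReal_le_ofReal ?_)
    rw [le_div_iff₀ hd]; linarith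
  · refine le_trans ?_ le_add_self
    refine le_trans ?_ (Finset.single_le_sum (fun _ _ => zero_le) (Finset.mem_univ e))
    have e1 : (ENNReal.ofReal (W.S n a / infDist a Z)) ^ (-p) =
        ∏ c ∈ s e, (ENNReal.ofReal (W.S n a / infDist a Z)) ^ (-r) := by
      rw [Finset.prod_const, hcard, ← ENNReal.rpow_natCast, ← ENNReal.rpow_mul]
      congr 1
      rw [hr]; push_cast; field_simp
    rw [e1]
    refine Finset.prod_le_prod' fun c hc => ?_
    simp only [s, Finset.mem_map, Finset.mem_univ, true_and] at hc
    obtain ⟨i, rfl⟩ := hc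
    refine ENNReal.rpow_neg_le_rpow_neg hr0 (ENNReal.ofReal_le_ofReal ?_)
    rw [le_div_iff₀ hd, ← abs_of_pos hd, ← abs_mul, abs_of_pos hd]
    refine le_trans (le_of_eq ?_) (he i.succ)
    congr 1
    change ((lam (e 0) a - lam (e i.succ) a) / infDist a Z - ξ (e 0) + ξ (e i.succ)) *
      infDist a Z = _
    field_simp
    ring

/-- `h` is `K`-Lipschitz on some neighbourhood of `a`. -/
def LipAt {m : ℕ} (K : ℝ) (h : Euc m → ℝ) (a : Euc m) : Prop :=
  ∀ᶠ q : Euc m × Euc m in nhds (a, a), |h q.1 - h q.2| ≤ K * dist q.1 q.2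

section LipAt
variable {m : ℕ} {K K' : ℝ} {h h' : Euc m → ℝ} {a : Euc m}

lemma LipAt.mono (hh : LipAt K h a) (hK : K ≤ K') : LipAt K' h a := by
  filter_upwards [hh] with q hq
  exact hq.trans (mul_le_mul_of_nonneg_right hK dist_nonneg)

lemma Filter.Eventually.fst_snd_diag {P : Euc m → Prop} (hP : ∀ᶠ b in nhds a, P b) :
    ∀ᶠ q : Euc m × Euc m in nhds (a, a), P q.1 ∧ P q.2 := by
  rw [nhds_prod_eq]
  exact (hP.prod_inl (nhds a)).and (hP.prod_inr (nhds a))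

lemma LipAt.congr (hh : LipAt K h a) (he : ∀ᶠ b in nhds a, h' b = h b) : LipAt K h' a := by
  filter_upwards [hh, he.fst_snd_diag] with q hq ⟨h1, h2⟩
  rwa [h1, h2]

lemma LipAt.add (hh : LipAt K h a) (hh' : LipAt K' h' a) :
    LipAt (K + K') (fun b => h b + h' b) a := by
  filter_upwards [hh, hh'] with q h1 h2
  calc |h q.1 + h' q.1 - (h q.2 + h' q.2)| = |(h q.1 - h q.2) + (h' q.1 - h' q.2)| := by
        congr 1; ring
    _ ≤ _ := (abs_add_le _ _).trans (by linarith)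

lemma LipAt.neg (hh : LipAt K h a) : LipAt K (fun b => - h b) a := by
  filter_upwards [hh] with q h1
  rwa [show - h q.1 - - h q.2 = -(h q.1 - h q.2) by ring, abs_neg]

lemma LipAt.const (c : ℝ) : LipAt 0 (fun _ => c) a := by
  refine Filter.Eventually.of_forall fun q => ?_
  simp

lemma LipAt.continuousAt (hh : LipAt K h a) : ContinuousAt h a := by
  rw [ContinuousAt, tendsto_iff_dist_tendsto_zero]
  have h1 : ∀ᶠ b in nhds a, |h b - h a| ≤ K * dist b a := by
    have : Filter.Tendsto (fun b : Euc m => (b, a)) (nhds a) (nhds (a, a)) :=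
      Continuous.tendsto' (by fun_prop) _ _ rfl
    exact this.eventually hh
  have h2 : Filter.Tendsto (fun b => K * dist b a) (nhds a) (nhds 0) :=
    Continuous.tendsto' (by fun_prop) _ _ (by simp)
  exact squeeze_zero' (Filter.Eventually.of_forall fun _ => dist_nonneg) h1 h2

lemma LipAt.norm_fderiv_le (hh : LipAt K h a) (hK : 0 ≤ K) : ‖fderiv ℝ h a‖ ≤ K := by
  refine norm_fderiv_le_of_lip' ℝ hK ?_
  have : Filter.Tendsto (fun b : Euc m => (b, a)) (nhds a) (nhds (a, a)) :=
    Continuous.tendsto' (by fun_prop) _ _ rfl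
  filter_upwards [this.eventually hh] with b hb
  simpa [dist_eq_norm] using hb

lemma LipAt.mul {A B : ℝ} (hh : LipAt K h a) (hh' : LipAt K' h' a) (hA : |h a| < A)
    (hB : |h' a| < B) :
    LipAt (A * K' + B * K) (fun b => h b * h' b) a := by
  have e1 : ∀ᶠ b in nhds a, |h b| < A :=
    hh.continuousAt.abs.eventually_lt_const hA
  have e2 : ∀ᶠ b in nhds a, |h' b| < B :=
    hh'.continuousAt.abs.eventually_lt_const hB
  filter_upwards [hh, hh', e1.fst_snd_diag, e2.fst_snd_diag] with q h1 h2 h3 h4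
  calc |h q.1 * h' q.1 - h q.2 * h' q.2|
      = |h q.1 * (h' q.1 - h' q.2) + h' q.2 * (h q.1 - h q.2)| := by congr 1; ring
    _ ≤ |h q.1| * |h' q.1 - h' q.2| + |h' q.2| * |h q.1 - h q.2| := by
        refine (abs_add_le _ _).trans ?_
        rw [abs_mul, abs_mul]
    _ ≤ A * (K' * dist q.1 q.2) + B * (K * dist q.1 q.2) := by
        have := h3.1; have := h4.2
        have := (abs_nonneg (h a)).trans_lt hA
        have := (abs_nonneg (h' a)).trans_lt hB
        gcongr
    _ = _ := by ring

lemma lipAt_of_forall (hh : ∀ b c, h b - h c ≤ K * dist b c) : LipAt K h a := by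
  refine Filter.Eventually.of_forall fun q => abs_le.2 ⟨?_, hh _ _⟩
  have := hh q.2 q.1
  rw [dist_comm] at this
  linarith

lemma LipschitzWith.lipAt {C : NNReal} (hh : LipschitzWith C h) : LipAt C h a :=
  Filter.Eventually.of_forall fun q => by
    simpa [Real.dist_eq] using hh.dist_le_mul q.1 q.2

lemma LipAt.comp {g : ℝ → ℝ} {M : ℝ} (hM : 0 ≤ M) (hg : ∀ x y, |g x - g y| ≤ M * |x - y|)
    (hh : LipAt K h a) : LipAt (M * K) (fun b => g (h b)) a := by
  filter_upwards [hh] with q hq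
  calc _ ≤ M * |h q.1 - h q.2| := hg _ _
    _ ≤ M * (K * dist q.1 q.2) := by gcongr
    _ = _ := by ring

lemma LipAt.exists_lipschitzOnWith (hh : LipAt K h a) :
    ∃ C : NNReal, ∃ t ∈ nhds a, LipschitzOnWith C h t := by
  rw [LipAt, nhds_prod_eq] at hh
  obtain ⟨t, ht, hts⟩ := Filter.mem_prod_self_iff.1 hh
  refine ⟨K.toNNReal, t, ht, LipschitzOnWith.of_dist_le_mul fun x hx y hy => ?_⟩
  have := hts (Set.mk_mem_prod hx hy)
  simp only [mem_ofPred_eq] at this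
  rw [Real.dist_eq]
  exact this.trans (mul_le_mul_of_nonneg_right (Real.le_coe_toNNReal K) dist_nonneg)

end LipAt

lemma exists_lipschitzWith_of_lipAt {m : ℕ} {ψ : Euc m → ℝ} {R : ℝ}
    (hloc : ∀ a, ∃ K, LipAt K ψ a) (h0 : ∀ a ∉ ball (0 : Euc m) R, ψ a = 0) :
    ∃ C : NNReal, LipschitzWith C ψ := by
  have hc : Continuous ψ := continuous_iff_continuousAt.2 fun a => (hloc a).choose_spec.continuousAt
  have hl : LocallyLipschitzOn (closedBall (0 : Euc m) (R + 1)) ψ := by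
    intro a _
    obtain ⟨K, hK⟩ := hloc a
    obtain ⟨C, t, ht, hC⟩ := hK.exists_lipschitzOnWith
    exact ⟨C, t, mem_nhdsWithin_of_mem_nhds ht, hC⟩
  obtain ⟨C, hC⟩ := hl.exists_lipschitzOnWith_of_compact (isCompact_closedBall _ _)
  obtain ⟨B, hB⟩ := (isCompact_closedBall (0 : Euc m) R).exists_bound_of_continuousOn
    hc.continuousOn
  have key : ∀ x y, x ∈ ball (0 : Euc m) R → dist (ψ x) (ψ y) ≤ (C + |B|) * dist x y := by
    intro x y hx
    rw [mem_ball] at hx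
    by_cases hy : y ∈ closedBall (0 : Euc m) (R + 1)
    · refine (hC.dist_le_mul x ?_ y hy).trans ?_
      · rw [mem_closedBall]; linarith
      · have := abs_nonneg B
        gcongr
        linarith
    · rw [mem_closedBall, not_le] at hy
      rw [h0 y (by rw [mem_ball]; linarith)]
      have h1 : 1 ≤ dist x y := by
        have := dist_triangle_left y 0 x
        linarith
      have h2 := hB x (by rw [mem_closedBall]; linarith)
      rw [dist_zero_right]
      calc ‖ψ x‖ ≤ |B| * 1 := by linarith [le_abs_self B]
        _ ≤ (C + |B|) * dist x y := by
          gcongr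
          linarith [C.coe_nonneg]
  refine ⟨C + ‖B‖₊, LipschitzWith.of_dist_le_mul fun x y => ?_⟩
  push_cast
  rw [Real.norm_eq_abs]
  by_cases hx : x ∈ ball (0 : Euc m) R
  · exact key x y hx
  by_cases hy : y ∈ ball (0 : Euc m) R
  · rw [dist_comm (ψ x), dist_comm x]
    exact key y x hy
  · rw [h0 x hx, h0 y hy, dist_self]
    positivity

lemma LipschitzWith.integral_fderiv_eq_zero {m : ℕ} {ψ : Euc m → ℝ} {C : NNReal} {R : ℝ}
    (hψ : LipschitzWith C ψ) (h0 : ∀ a ∉ ball (0 : Euc m) R, ψ a = 0) (v : Euc m) :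
    ∫ a, fderiv ℝ ψ a v = 0 := by
  have hs : HasCompactSupport ψ :=
    HasCompactSupport.intro (isCompact_closedBall (0 : Euc m) R)
      fun a ha => h0 a fun h => ha (ball_subset_closedBall h)
  have h := (LipschitzWith.const (α := Euc m) (1 : ℝ)).integral_lineDeriv_mul_eq (μ := volume)
    hψ hs (-v)
  have h1 : ∀ x : Euc m, lineDeriv ℝ (fun _ : Euc m => (1 : ℝ)) x (-v) = 0 := fun x => by
    simp [lineDeriv]
  simp only [h1, zero_mul, integral_zero, neg_neg, mul_one] at h
  rw [h]
  refine integral_congr_ae ?_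
  filter_upwards [hψ.ae_differentiableAt (μ := volume)] with a ha
  exact ha.lineDeriv_eq_fderiv.symm

/-- A Lipschitz cutoff of level `j` vanishing where `S < 1 / (j + 1)`. -/
def levelCutoff {m : ℕ} (S : Euc m → ℝ) (j : ℕ) (a : Euc m) : ℝ :=
  min 1 (max 0 (((j : ℝ) + 1) * S a - 1))

section levelCutoff
variable {m : ℕ} {S : Euc m → ℝ} {K : ℝ}

lemma levelCutoff_nonneg (j : ℕ) (a : Euc m) : 0 ≤ levelCutoff S j a :=
  le_min zero_le_one (le_max_left _ _)

lemma levelCutoff_le_one (j : ℕ) (a : Euc m) : levelCutoff S j a ≤ 1 := min_le_left _ _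

lemma levelCutoff_eq_zero {j : ℕ} {a : Euc m} (h : ((j : ℝ) + 1) * S a ≤ 1) :
    levelCutoff S j a = 0 := by
  rw [levelCutoff, max_eq_left (by linarith), min_eq_right zero_le_one]

lemma levelCutoff_eq_one {j : ℕ} {a : Euc m} (h : 2 ≤ ((j : ℝ) + 1) * S a) :
    levelCutoff S j a = 1 := by
  rw [levelCutoff, max_eq_right (by linarith), min_eq_left (by linarith)]

lemma levelCutoff_sub_le (hS : ∀ a b, S a - S b ≤ K * dist a b) (hK : 0 ≤ K) (j : ℕ)
    (a b : Euc m) : levelCutoff S j a - levelCutoff S j b ≤ ((j + 1) * K) * dist a b := by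
  have hj : (0 : ℝ) ≤ (j : ℝ) + 1 := by positivity
  have h0 : 0 ≤ ((j + 1) * K) * dist a b := by positivity
  have h1 : ((j : ℝ) + 1) * S a - 1 ≤ (((j : ℝ) + 1) * S b - 1) + ((j + 1) * K) * dist a b := by
    nlinarith [mul_le_mul_of_nonneg_left (hS a b) hj]
  rw [sub_le_iff_le_add, levelCutoff, levelCutoff]
  rcases le_total 1 (max 0 (((j : ℝ) + 1) * S b - 1)) with h | h
  · rw [min_eq_left h]
    exact (min_le_left _ _).trans (by linarith)
  · rw [min_eq_right h]
    refine (min_le_right _ _).trans (max_le ?_ ?_)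
    · linarith [le_max_left 0 (((j : ℝ) + 1) * S b - 1)]
    · linarith [le_max_right 0 (((j : ℝ) + 1) * S b - 1)]

lemma continuous_of_sub_le (hS : ∀ a b, S a - S b ≤ K * dist a b) : Continuous S :=
  continuous_iff_continuousAt.2 fun _ => (lipAt_of_forall hS).continuousAt

lemma norm_fderiv_levelCutoff_le (hS : ∀ a b, S a - S b ≤ K * dist a b) (hK : 0 ≤ K) {j : ℕ}
    {a : Euc m} (ha : 0 ≤ S a) : ‖fderiv ℝ (levelCutoff S j) a‖ ≤ 2 * K / S a := by
  have hj : (0 : ℝ) < (j : ℝ) + 1 := by positivity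
  have hc := continuous_of_sub_le hS
  by_cases h1 : ((j : ℝ) + 1) * S a < 1
  · have : levelCutoff S j =ᶠ[nhds a] fun _ => 0 := by
      filter_upwards [(continuous_const.mul hc).continuousAt.eventually_lt_const h1] with b hb
      exact levelCutoff_eq_zero hb.le
    rw [this.fderiv_eq]
    simp only [fderiv_const_apply, norm_zero]
    positivity
  by_cases h2 : 2 < ((j : ℝ) + 1) * S a
  · have : levelCutoff S j =ᶠ[nhds a] fun _ => 1 := by
      filter_upwards [(continuous_const.mul hc).continuousAt.eventually_const_lt h2] with b hb
      exact levelCutoff_eq_one hb.le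
    rw [this.fderiv_eq]
    simp only [fderiv_const_apply, norm_zero]
    positivity
  push Not at h1 h2
  have hS0 : 0 < S a := by
    rcases ha.eq_or_lt with h | h
    · rw [← h] at h1; norm_num at h1
    · exact h
  refine ((lipAt_of_forall (levelCutoff_sub_le hS hK j)).norm_fderiv_le (by positivity)).trans ?_
  rw [le_div_iff₀ hS0]
  nlinarith

lemma fderiv_levelCutoff_eq_zero (hS : ∀ a b, S a - S b ≤ K * dist a b) {j : ℕ}
    {a : Euc m} (ha : 2 < ((j : ℝ) + 1) * S a) : fderiv ℝ (levelCutoff S j) a = 0 := by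
  have hc := continuous_of_sub_le hS
  have : levelCutoff S j =ᶠ[nhds a] fun _ => 1 := by
    filter_upwards [(continuous_const.mul hc).continuousAt.eventually_const_lt ha] with b hb
    exact levelCutoff_eq_one hb.le
  rw [this.fderiv_eq]
  simp

end levelCutoff

lemma integral_fderiv_eq_zero_of_locallyLipschitz {m : ℕ} {S d u : Euc m → ℝ} {K R C : ℝ}
    (hS0 : ∀ a, 0 ≤ S a) (hS : ∀ a b, S a - S b ≤ K * dist a b) (hK : 0 ≤ K)
    (hC : 0 ≤ C) (hd : ∀ a, 0 ≤ d a)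
    (hu0 : ∀ a ∉ ball (0 : Euc m) R, u a = 0) (hud : ∀ a, |u a| ≤ C * d a)
    (hloc : ∀ a, 0 < S a → ∃ K', LipAt K' u a) (hdiff : ∀ᵐ a, DifferentiableAt ℝ u a)
    (hz : ∀ᵐ a, S a = 0 → fderiv ℝ u a = 0)
    (hq : IntegrableOn (fun a => d a / S a) (ball 0 R)) (v : Euc m)
    (hint : Integrable fun a => fderiv ℝ u a v) :
    ∫ a, fderiv ℝ u a v = 0 := by
  have hc := continuous_of_sub_le hS
  set ψ : ℕ → Euc m → ℝ := fun j a => u a * levelCutoff S j a with hψ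
  have hψ0 : ∀ j, ∀ a ∉ ball (0 : Euc m) R, ψ j a = 0 := fun j a ha => by
    simp [hψ, hu0 a ha]
  have hψL : ∀ j, ∃ C : NNReal, LipschitzWith C (ψ j) := by
    intro j
    refine exists_lipschitzWith_of_lipAt (fun a => ?_) (hψ0 j)
    rcases (hS0 a).eq_or_lt with h | h
    · refine ⟨0, (LipAt.const 0).congr ?_⟩
      have h1 : ((j : ℝ) + 1) * S a < 1 := by rw [← h]; norm_num
      filter_upwards [(continuous_const.mul hc).continuousAt.eventually_lt_const h1] with b hb
      simp only [hψ, levelCutoff_eq_zero hb.le, mul_zero]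
    · obtain ⟨K', hK'⟩ := hloc a h
      exact ⟨_, hK'.mul (lipAt_of_forall (levelCutoff_sub_le hS hK j)) (lt_add_one _)
        (lt_add_one _)⟩
  have hηL : ∀ j : ℕ, LipschitzWith (((j : ℝ) + 1) * K).toNNReal (levelCutoff S j) := by
    intro j
    refine LipschitzWith.of_dist_le_mul fun a b => ?_
    rw [Real.coe_toNNReal _ (by positivity), Real.dist_eq, abs_le]
    have h1 := levelCutoff_sub_le hS hK j a b
    have h2 := levelCutoff_sub_le hS hK j b a
    rw [dist_comm b a] at h2
    constructor <;> linarith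
  have hzero : ∀ j, ∫ a, fderiv ℝ (ψ j) a v = 0 := fun j => by
    obtain ⟨D, hD⟩ := hψL j
    exact hD.integral_fderiv_eq_zero (hψ0 j) v
  have hform : ∀ᵐ a, ∀ j, fderiv ℝ (ψ j) a v
      = u a * fderiv ℝ (levelCutoff S j) a v + levelCutoff S j a * fderiv ℝ u a v := by
    have h1 : ∀ᵐ a, ∀ j, DifferentiableAt ℝ (levelCutoff S j) a :=
      ae_all_iff.2 fun j => (hηL j).ae_differentiableAt
    filter_upwards [h1, hdiff] with a h1 h2 j
    have h3 := h2.hasFDerivAt.mul (h1 j).hasFDerivAt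
    rw [show ψ j = u * levelCutoff S j from rfl, h3.fderiv]
    simp
  have hlim := tendsto_integral_of_dominated_convergence (μ := volume)
    (F := fun j a => fderiv ℝ (ψ j) a v) (f := fun a => fderiv ℝ u a v)
    (fun a => |fderiv ℝ u a v| + (ball (0 : Euc m) R).indicator
      (fun a => (2 * C * K * ‖v‖) * (d a / S a)) a)
    (fun j => (measurable_fderiv_apply_const ℝ (ψ j) v).aestronglyMeasurable)
    (hint.abs.add ((integrable_indicator_iff measurableSet_ball).2 (hq.const_mul _)))
    (fun j => by
      filter_upwards [hform] with a ha
      rw [ha j, Real.norm_eq_abs]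
      refine (abs_add_le _ _).trans ?_
      rw [add_comm]
      refine add_le_add ?_ ?_
      · rw [abs_mul, abs_of_nonneg (levelCutoff_nonneg j a)]
        exact mul_le_of_le_one_left (abs_nonneg _) (levelCutoff_le_one j a)
      · by_cases hb : a ∈ ball (0 : Euc m) R
        · rw [indicator_of_mem hb, abs_mul]
          have h1 := norm_fderiv_levelCutoff_le hS hK (j := j) (hS0 a)
          have h2 : |fderiv ℝ (levelCutoff S j) a v| ≤ 2 * K / S a * ‖v‖ :=
            (ContinuousLinearMap.le_opNorm _ v).trans
              (mul_le_mul_of_nonneg_right h1 (norm_nonneg _))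
          calc |u a| * |fderiv ℝ (levelCutoff S j) a v|
              ≤ (C * d a) * (2 * K / S a * ‖v‖) :=
                mul_le_mul (hud a) h2 (abs_nonneg _) (mul_nonneg hC (hd a))
            _ = _ := by ring
        · rw [indicator_of_notMem hb, hu0 a hb]
          simp)
    (by
      filter_upwards [hform, hz] with a ha hza
      rcases (hS0 a).eq_or_lt with h | h
      · have h1 : ∀ j : ℕ, fderiv ℝ (levelCutoff S j) a = 0 := fun j => by
          have := norm_fderiv_levelCutoff_le hS hK (j := j) (hS0 a)
          rw [← h, div_zero] at this
          exact norm_le_zero_iff.1 this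
        simp only [ha, h1, hza h.symm]
        simp
      · refine tendsto_const_nhds.congr' ?_
        obtain ⟨N, hN⟩ := exists_nat_gt (2 / S a)
        filter_upwards [Filter.eventually_ge_atTop N] with j hj
        have h1 : 2 < ((j : ℝ) + 1) * S a := by
          rw [← div_lt_iff₀ h]
          have : (N : ℝ) ≤ j := by exact_mod_cast hj
          linarith
        rw [ha j, fderiv_levelCutoff_eq_zero hS h1, levelCutoff_eq_one h1.le]
        simp)
  simp only [hzero] at hlim
  exact tendsto_nhds_unique hlim tendsto_const_nhds

lemma ae_differentiableAt_of_lipAt {m : ℕ} (h : Euc m → ℝ) :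
    ∀ᵐ a, (∃ K, LipAt K h a) → DifferentiableAt ℝ h a := by
  rw [ae_iff]
  refine measure_null_of_locally_null _ fun a ha => ?_
  simp only [Classical.not_imp, mem_ofPred_eq] at ha
  obtain ⟨⟨K, hK⟩, -⟩ := ha
  obtain ⟨C, t, ht, hC⟩ := hK.exists_lipschitzOnWith
  have hC' : LipschitzOnWith C h (interior t) := hC.mono interior_subset
  have hae := hC'.ae_differentiableWithinAt_of_mem (μ := volume)
  refine ⟨_, inter_mem_nhdsWithin _ (interior_mem_nhds.2 ht), ?_⟩
  rw [ae_iff] at hae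
  refine measure_mono_null (fun b hb => ?_) hae
  simp only [Classical.not_imp, mem_ofPred_eq, mem_inter_iff] at hb ⊢
  exact ⟨hb.2, fun hd => hb.1.2 (hd.differentiableAt (isOpen_interior.mem_nhds hb.2))⟩

lemma hasFDerivAt_zero_of_le_infDist {m : ℕ} {Z : Set (Euc m)} {w : Euc m → ℝ} {C : ℝ}
    {a : Euc m} (ha : a ∈ Z) (hd : DifferentiableAt ℝ (fun b => infDist b Z) a)
    (hw : ∀ᶠ b in nhds a, |w b| ≤ C * infDist b Z) : HasFDerivAt w (0 : Euc m →L[ℝ] ℝ) a := by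
  have hmin : IsLocalMin (fun b => infDist b Z) a := by
    refine Filter.Eventually.of_forall fun b => ?_
    simp only [infDist_zero_of_mem ha]
    exact infDist_nonneg
  have h1 := hd.hasFDerivAt
  rw [hmin.fderiv_eq_zero, hasFDerivAt_iff_isLittleO] at h1
  have hwa : w a = 0 := by
    have := hw.self_of_nhds
    rw [infDist_zero_of_mem ha, mul_zero] at this
    exact abs_eq_zero.1 (le_antisymm this (abs_nonneg _))
  rw [hasFDerivAt_iff_isLittleO]
  simp only [infDist_zero_of_mem ha, hwa, zero_apply, sub_zero] at h1 ⊢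
  refine Asymptotics.IsBigO.trans_isLittleO (Asymptotics.IsBigO.of_bound C ?_) h1
  filter_upwards [hw] with b hb
  rw [Real.norm_eq_abs, Real.norm_eq_abs, abs_of_nonneg (infDist_nonneg (x := b) (s := Z))]
  exact hb

section Weight
variable {m : ℕ} {Z : Set (Euc m)} {S : Euc m → ℝ} {p : ℝ}

lemma ae_mem_or_pos_of_lintegral_lt_top (hZ : IsClosed Z) (hSc : Continuous S)
    (hS0 : ∀ a, 0 ≤ S a) (hp1 : 1 ≤ p)
    (hp : ∀ R : ℝ, ∫⁻ a in ball 0 R \ Z, (ENNReal.ofReal (S a / infDist a Z)) ^ (-p) < ⊤) :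
    ∀ᵐ a, a ∈ Z ∨ 0 < S a := by
  have hm : Measurable fun a => (ENNReal.ofReal (S a / infDist a Z)) ^ (-p) := by
    have : Measurable fun a => infDist a Z := (continuous_infDist_pt Z).measurable
    have := hSc.measurable
    fun_prop
  have h1 : ∀ᵐ a, ∀ N : ℕ, a ∈ ball (0 : Euc m) N \ Z →
      (ENNReal.ofReal (S a / infDist a Z)) ^ (-p) < ⊤ := by
    refine ae_all_iff.2 fun N => ?_
    rw [← ae_restrict_iff' (measurableSet_ball.diff hZ.measurableSet)]
    exact ae_lt_top hm (hp N).ne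
  filter_upwards [h1] with a ha
  by_contra hcon
  push Not at hcon
  have hSa : S a = 0 := le_antisymm hcon.2 (hS0 a)
  obtain ⟨N, hN⟩ := exists_nat_gt (dist a 0)
  have := ha N ⟨hN, hcon.1⟩
  rw [hSa, zero_div, ENNReal.ofReal_zero, ENNReal.zero_rpow_of_neg (by linarith)] at this
  exact lt_irrefl _ this

lemma memLp_infDist_div (hZ : IsClosed Z) (hne : Z.Nonempty) (hSc : Continuous S)
    (hS0 : ∀ a, 0 ≤ S a) (hp1 : 1 ≤ p)
    (hp : ∀ R : ℝ, ∫⁻ a in ball 0 R \ Z, (ENNReal.ofReal (S a / infDist a Z)) ^ (-p) < ⊤)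
    (R : ℝ) :
    MemLp (fun a => infDist a Z / S a) (ENNReal.ofReal p) (volume.restrict (ball 0 R)) := by
  have hp0 : 0 < p := by linarith
  refine ⟨(((continuous_infDist_pt Z).measurable).div hSc.measurable).aestronglyMeasurable, ?_⟩
  rw [eLpNorm_lt_top_iff_lintegral_rpow_enorm_lt_top (by simpa using hp0) ENNReal.ofReal_ne_top,
    ENNReal.toReal_ofReal hp0.le, ← lintegral_inter_add_sdiff _ _ hZ.measurableSet]
  have h1 : ∫⁻ a in ball (0 : Euc m) R ∩ Z, ‖infDist a Z / S a‖ₑ ^ p = 0 := by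
    rw [setLIntegral_congr_fun (g := fun _ => 0) (measurableSet_ball.inter hZ.measurableSet)]
    · simp
    · intro a ha
      simp only [infDist_zero_of_mem ha.2, zero_div, enorm_zero]
      exact ENNReal.zero_rpow_of_pos hp0
  rw [h1, zero_add]
  refine lt_of_le_of_lt (setLIntegral_mono' (measurableSet_ball.diff hZ.measurableSet)
    fun a ha => ?_) (hp R)
  have hd : 0 < infDist a Z := (hZ.notMem_iff_infDist_pos hne).1 ha.2
  rcases (hS0 a).eq_or_lt with h | h
  · rw [← h, div_zero, enorm_zero, ENNReal.zero_rpow_of_pos hp0]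
    exact bot_le
  · rw [Real.enorm_eq_ofReal (by positivity), ← inv_div, ENNReal.ofReal_inv_of_pos (by positivity),
      ENNReal.inv_rpow, ENNReal.rpow_neg]

lemma integrableOn_infDist_div (hZ : IsClosed Z) (hne : Z.Nonempty) (hSc : Continuous S)
    (hS0 : ∀ a, 0 ≤ S a) (hp1 : 1 ≤ p)
    (hp : ∀ R : ℝ, ∫⁻ a in ball 0 R \ Z, (ENNReal.ofReal (S a / infDist a Z)) ^ (-p) < ⊤)
    (R : ℝ) :
    IntegrableOn (fun a => infDist a Z / S a) (ball 0 R) := by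
  have : IsFiniteMeasure (volume.restrict (ball (0 : Euc m) R)) :=
    ⟨by simpa using measure_ball_lt_top⟩
  exact (memLp_infDist_div hZ hne hSc hS0 hp1 hp R).integrable (by simpa using hp1)

end Weight

set_option maxHeartbeats 400000 in
/-- A function which is Lipschitz at the points of `Z`, and locally Lipschitz off `Z` with a
constant controlled by an `L^p` weight, is a Sobolev function. -/
lemma sobolev_of_lipAt {m : ℕ} {Z : Set (Euc m)} (hZ : IsCompact Z) (hne : Z.Nonempty)
    {S : Euc m → ℝ} {K : ℝ} (hK : 0 ≤ K) (hS0 : ∀ a, 0 ≤ S a)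
    (hS : ∀ a b, S a - S b ≤ K * dist a b) {p : ℝ} (hp1 : 1 ≤ p)
    (hp : ∀ R : ℝ, ∫⁻ a in ball 0 R \ Z, (ENNReal.ofReal (S a / infDist a Z)) ^ (-p) < ⊤)
    {h : Euc m → ℝ}
    (h1 : ∀ R : ℝ, ∃ C : ℝ, ∀ z ∈ Z, ∀ b ∈ ball (0 : Euc m) R, |h b - h z| ≤ C * dist b z)
    (h2 : ∀ R : ℝ, ∃ C : ℝ, ∀ a ∈ ball (0 : Euc m) R, 0 < S a →
      LipAt (C * (infDist a Z / S a)) h a) :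
    (∀ᵐ a, DifferentiableAt ℝ h a) ∧
    ∀ U : Set (Euc m), IsOpen U → Bornology.IsBounded U →
      MemW1pWith m p U h (fun k a => fderiv ℝ h a (EuclideanSpace.single k 1)) := by
  have hSc := continuous_of_sub_le hS
  have hcl := hZ.isClosed
  have hae := ae_mem_or_pos_of_lintegral_lt_top hcl hSc hS0 hp1 hp
  have hinB : ∀ a : Euc m, a ∈ ball (0 : Euc m) (dist a 0 + 1) := fun a => by
    rw [mem_ball]; linarith
  have hlip : ∀ a, 0 < S a → ∃ K', LipAt K' h a := fun a ha => by
    obtain ⟨C, hC⟩ := h2 (dist a 0 + 1)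
    exact ⟨_, hC a (hinB a) ha⟩
  -- positive constants
  replace h1 : ∀ R : ℝ, ∃ C : ℝ, 0 ≤ C ∧
      ∀ z ∈ Z, ∀ b ∈ ball (0 : Euc m) R, |h b - h z| ≤ C * dist b z := by
    intro R
    obtain ⟨C, hC⟩ := h1 R
    exact ⟨|C|, abs_nonneg _, fun z hz b hb => (hC z hz b hb).trans
      (mul_le_mul_of_nonneg_right (le_abs_self C) dist_nonneg)⟩
  replace h2 : ∀ R : ℝ, ∃ C : ℝ, 0 ≤ C ∧ ∀ a ∈ ball (0 : Euc m) R, 0 < S a →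
      LipAt (C * (infDist a Z / S a)) h a := by
    intro R
    obtain ⟨C, hC⟩ := h2 R
    exact ⟨|C|, abs_nonneg _, fun a hb ha => (hC a hb ha).mono
      (mul_le_mul_of_nonneg_right (le_abs_self C) (div_nonneg infDist_nonneg ha.le))⟩
  obtain ⟨R₀, hR₀⟩ := hZ.isBounded.subset_ball (0 : Euc m)
  obtain ⟨z₀, hz₀⟩ := hne
  -- measurability
  have hmeas : AEStronglyMeasurable h volume := by
    have hopen : IsOpen {a | 0 < S a} := isOpen_lt continuous_const hSc
    have c1 : ContinuousOn h Z := by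
      obtain ⟨C, hC0, hC⟩ := h1 R₀
      exact (LipschitzOnWith.of_dist_le_mul (K := C.toNNReal) fun x hx y hy => by
        rw [Real.coe_toNNReal _ hC0]
        exact hC y hy x (hR₀ hx)).continuousOn
    have c2 : ContinuousOn h {a | 0 < S a} := fun a ha =>
      (hlip a ha).choose_spec.continuousAt.continuousWithinAt
    have := aestronglyMeasurable_union_iff.2
      ⟨c1.aestronglyMeasurable (μ := volume) hcl.measurableSet,
        c2.aestronglyMeasurable (μ := volume) hopen.measurableSet⟩
    rwa [Measure.restrict_eq_self_of_ae_mem] at this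
    exact hae
  -- the Lipschitz comparison function
  obtain ⟨Ce, e, heL, heZ⟩ : ∃ (Ce : NNReal) (e : Euc m → ℝ), LipschitzWith Ce e ∧
      ∀ a ∈ Z, e a = h a := by
    obtain ⟨C, hC0, hC⟩ := h1 R₀
    obtain ⟨e, he1, he2⟩ := (LipschitzOnWith.of_dist_le_mul (K := C.toNNReal) (f := h) (s := Z)
      fun x hx y hy => by
        rw [Real.coe_toNNReal _ hC0]
        exact hC y hy x (hR₀ hx)).extend_real
    exact ⟨_, e, he1, fun a ha => (he2 ha).symm⟩
  have hw : ∀ R : ℝ, ∃ C : ℝ, 0 ≤ C ∧ ∀ b ∈ ball (0 : Euc m) R, |h b - e b| ≤ C * infDist b Z := by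
    intro R
    obtain ⟨C, hC0, hC⟩ := h1 R
    refine ⟨C + Ce, by positivity, fun b hb => ?_⟩
    obtain ⟨z, hz, hbz⟩ := hZ.exists_infDist_eq_dist ⟨z₀, hz₀⟩ b
    have t1 := hC z hz b hb
    have t2 := heL.dist_le_mul b z
    rw [Real.dist_eq, heZ z hz] at t2
    rw [hbz]
    calc |h b - e b| = |(h b - h z) - (e b - h z)| := by congr 1; ring
      _ ≤ |h b - h z| + |e b - h z| := abs_sub _ _
      _ ≤ _ := by linarith
  have hdd : ∀ᵐ a : Euc m, DifferentiableAt ℝ (fun b => infDist b Z) a :=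
    (lipschitz_infDist_pt Z).ae_differentiableAt
  have hed : ∀ᵐ a : Euc m, DifferentiableAt ℝ e a := heL.ae_differentiableAt
  have hw0 : ∀ᵐ a : Euc m, a ∈ Z → HasFDerivAt (fun b => h b - e b) (0 : Euc m →L[ℝ] ℝ) a := by
    filter_upwards [hdd] with a ha haZ
    obtain ⟨C, -, hC⟩ := hw (dist a 0 + 1)
    refine hasFDerivAt_zero_of_le_infDist (C := C) haZ ha ?_
    filter_upwards [isOpen_ball.mem_nhds (hinB a)] with b hb using hC b hb
  have hdiff : ∀ᵐ a, DifferentiableAt ℝ h a := by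
    filter_upwards [hw0, hed, hae, ae_differentiableAt_of_lipAt h] with a t1 t2 t3 t4
    rcases t3 with t3 | t3
    · have hh : (fun b => h b - e b) + e = h := by
        ext b
        simp
      exact hh ▸ (t1 t3).differentiableAt.add t2
    · exact t4 (hlip a t3)
  -- bounds on balls
  have hbd : ∀ R : ℝ, ∃ C : ℝ, ∀ b ∈ ball (0 : Euc m) R, |h b| ≤ C := by
    intro R
    obtain ⟨C, hC0, hC⟩ := h1 R
    refine ⟨|h z₀| + C * (R + dist z₀ 0), fun b hb => ?_⟩
    have t1 := hC z₀ hz₀ b hb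
    have t2 : dist b z₀ ≤ R + dist z₀ 0 := by
      have := dist_triangle_right b z₀ 0
      rw [mem_ball] at hb
      linarith
    have t3 := mul_le_mul_of_nonneg_left t2 hC0
    have := abs_sub_abs_le_abs_sub (h b) (h z₀)
    linarith
  have hgrad : ∀ R : ℝ, ∃ C : ℝ, 0 ≤ C ∧ ∀ᵐ a, a ∈ ball (0 : Euc m) R →
      ‖fderiv ℝ h a‖ ≤ C * (1 + infDist a Z / S a) := by
    intro R
    obtain ⟨C, hC0, hC⟩ := h1 R
    obtain ⟨C', hC0', hC'⟩ := h2 R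
    refine ⟨C + C', by positivity, ?_⟩
    filter_upwards [hae] with a ha haR
    have hq : 0 ≤ infDist a Z / S a := div_nonneg infDist_nonneg (hS0 a)
    rcases ha with ha | ha
    · have : ‖fderiv ℝ h a‖ ≤ C := by
        refine norm_fderiv_le_of_lip' ℝ hC0 ?_
        filter_upwards [isOpen_ball.mem_nhds haR] with b hb
        rw [← dist_eq_norm, ← dist_eq_norm]
        exact hC a ha b hb
      nlinarith [mul_nonneg hC0 hq, mul_nonneg hC0' hq]
    · have := (hC' a haR ha).norm_fderiv_le (by positivity)
      nlinarith [mul_nonneg hC0 hq, mul_nonneg hC0' hq]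
  refine ⟨hdiff, fun U hU hUb => ?_⟩
  obtain ⟨R, hR⟩ := hUb.subset_ball (0 : Euc m)
  have hfin : IsFiniteMeasure (volume.restrict (ball (0 : Euc m) R)) :=
    ⟨by simpa using measure_ball_lt_top⟩
  have hfinU : IsFiniteMeasure (volume.restrict U) :=
    ⟨by simpa using (measure_mono hR).trans_lt measure_ball_lt_top⟩
  obtain ⟨B, hB⟩ := hbd R
  obtain ⟨A, hA0, hA⟩ := hgrad R
  have hqLp := memLp_infDist_div hcl ⟨z₀, hz₀⟩ hSc hS0 hp1 hp R
  have hqI := integrableOn_infDist_div hcl ⟨z₀, hz₀⟩ hSc hS0 hp1 hp R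
  refine ⟨?_, fun k => ⟨?_, ?_⟩⟩
  · refine MemLp.of_bound (hmeas.restrict) B ?_
    rw [ae_restrict_iff' hU.measurableSet]
    exact Filter.Eventually.of_forall fun a ha => hB a (hR ha)
  · refine MemLp.mono_measure (Measure.restrict_mono hR le_rfl) ?_
    have hg : MemLp (fun a => A * (1 + infDist a Z / S a)) (ENNReal.ofReal p)
        (volume.restrict (ball 0 R)) := ((memLp_const (1 : ℝ)).add hqLp).const_mul A
    refine hg.mono (measurable_fderiv_apply_const ℝ h _).aestronglyMeasurable ?_
    rw [ae_restrict_iff' measurableSet_ball]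
    filter_upwards [hA] with a ha haR
    refine (ContinuousLinearMap.le_opNorm _ _).trans ?_
    rw [PiLp.norm_single]
    simp only [norm_one, mul_one]
    exact (ha haR).trans (le_abs_self _)
  · intro φ hφ hφs hφU
    set v : Euc m := EuclideanSpace.single k 1 with hv
    obtain ⟨Cφ, hCφ⟩ := hφ.lipschitzWith_of_hasCompactSupport hφs (by simp)
    obtain ⟨Bφ, hBφ⟩ := hφs.exists_bound_of_continuous hφ.continuous
    have hφ0 : ∀ a ∉ U, φ a = 0 := fun a ha => image_eq_zero_of_notMem_tsupport fun h => ha (hφU h)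
    have hdφ0 : ∀ a ∉ U, fderiv ℝ φ a = 0 := fun a ha =>
      fderiv_of_notMem_tsupport ℝ fun h => ha (hφU h)
    have hφd : ∀ a, DifferentiableAt ℝ φ a := fun a =>
      (hφ.differentiable (by simp)).differentiableAt
    have hφ0R : ∀ a ∉ ball (0 : Euc m) R, φ a = 0 := fun a ha => hφ0 a fun h => ha (hR h)
    rw [setIntegral_eq_integral_of_forall_compl_eq_zero fun a ha => by simp [hdφ0 a ha],
      setIntegral_eq_integral_of_forall_compl_eq_zero fun a ha => by simp [hφ0 a ha]]
    -- integrability of the two terms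
    have i1 : Integrable fun a => h a * fderiv ℝ φ a v := by
      rw [← integrableOn_iff_integrable_of_support_subset (s := ball (0 : Euc m) R)]
      · refine Measure.integrableOn_of_bounded (M := B * (Cφ * ‖v‖)) measure_ball_lt_top.ne
          (hmeas.mul (measurable_fderiv_apply_const ℝ φ v).aestronglyMeasurable) ?_
        rw [ae_restrict_iff' measurableSet_ball]
        refine Filter.Eventually.of_forall fun a ha => ?_
        rw [norm_mul]
        have t1 : ‖fderiv ℝ φ a v‖ ≤ Cφ * ‖v‖ := (ContinuousLinearMap.le_opNorm _ v).trans
          (mul_le_mul_of_nonneg_right (norm_fderiv_le_of_lipschitz ℝ hCφ) (norm_nonneg _))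
        exact mul_le_mul (hB a ha) t1 (norm_nonneg _) ((abs_nonneg _).trans (hB a ha))
      · intro a ha
        by_contra hcon
        exact ha (by simp [hdφ0 a fun h => hcon (hR h)])
    have i2 : Integrable fun a => fderiv ℝ h a v * φ a := by
      rw [← integrableOn_iff_integrable_of_support_subset (s := ball (0 : Euc m) R)]
      · have hg : IntegrableOn (fun a => (A * ‖v‖ * Bφ) * (1 + infDist a Z / S a))
            (ball (0 : Euc m) R) :=
          ((integrable_const (1 : ℝ)).add hqI).const_mul _
        refine hg.mono' ((measurable_fderiv_apply_const ℝ h v).aestronglyMeasurable.mul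
          hφ.continuous.aestronglyMeasurable) ?_
        rw [ae_restrict_iff' measurableSet_ball]
        filter_upwards [hA] with a ha haR
        rw [norm_mul]
        have hq : 0 ≤ infDist a Z / S a := div_nonneg infDist_nonneg (hS0 a)
        calc ‖fderiv ℝ h a v‖ * ‖φ a‖
            ≤ (A * (1 + infDist a Z / S a) * ‖v‖) * Bφ := by
              refine mul_le_mul ((ContinuousLinearMap.le_opNorm _ v).trans
                (mul_le_mul_of_nonneg_right (ha haR) (norm_nonneg _))) (hBφ a) (norm_nonneg _) ?_
              positivity
          _ = _ := by ring
      · intro a ha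
        by_contra hcon
        exact ha (by simp [hφ0R a hcon])
    have i3 : Integrable fun a => fderiv ℝ (fun b => e b * φ b) a v := by
      rw [← integrableOn_iff_integrable_of_support_subset (s := U)]
      · have hl : ∀ a, ∃ K, LipAt K (fun b => e b * φ b) a := fun a =>
          ⟨_, heL.lipAt.mul hCφ.lipAt (lt_add_one _) (lt_add_one _)⟩
        obtain ⟨D, hD⟩ := exists_lipschitzWith_of_lipAt (R := R) hl
          fun a ha => by simp [hφ0R a ha]
        refine Measure.integrableOn_of_bounded (M := D * ‖v‖)
          ((measure_mono hR).trans_lt measure_ball_lt_top).ne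
          (measurable_fderiv_apply_const ℝ _ v).aestronglyMeasurable ?_
        exact Filter.Eventually.of_forall fun a => (ContinuousLinearMap.le_opNorm _ v).trans
          (mul_le_mul_of_nonneg_right (norm_fderiv_le_of_lipschitz ℝ hD) (norm_nonneg _))
      · intro a ha
        by_contra hcon
        refine ha ?_
        have : fderiv ℝ (fun b => e b * φ b) a = 0 := by
          refine fderiv_of_notMem_tsupport ℝ fun hmem => hcon (hφU ?_)
          exact closure_mono (Function.support_mul_subset_right e φ) hmem
        show fderiv ℝ (fun b => e b * φ b) a v = 0
        rw [this]; rfl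
    have hsum : (fun a => fderiv ℝ (fun b => (h b - e b) * φ b) a v) =ᵐ[volume]
        fun a => (h a * fderiv ℝ φ a v + fderiv ℝ h a v * φ a)
          - fderiv ℝ (fun b => e b * φ b) a v := by
      filter_upwards [hdiff, hed] with a t1 t2
      have e1 := (t1.hasFDerivAt.mul (hφd a).hasFDerivAt).sub (t2.mul (hφd a)).hasFDerivAt
      have e2 : HasFDerivAt (fun b => (h b - e b) * φ b)
          (h a • fderiv ℝ φ a + φ a • fderiv ℝ h a - fderiv ℝ (e * φ) a) a := by
        refine e1.congr_of_eventuallyEq (Filter.Eventually.of_forall fun b => ?_)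
        simp only [Pi.mul_apply, Pi.sub_apply]
        ring
      rw [e2.fderiv]
      simp only [sub_apply, add_apply,
        smul_apply, smul_eq_mul]
      rw [mul_comm (φ a)]
      rfl
    have z1 : ∫ a, fderiv ℝ (fun b => e b * φ b) a v = 0 := by
      have hl : ∀ a, ∃ K, LipAt K (fun b => e b * φ b) a := fun a =>
        ⟨_, heL.lipAt.mul hCφ.lipAt (lt_add_one _) (lt_add_one _)⟩
      obtain ⟨D, hD⟩ := exists_lipschitzWith_of_lipAt (R := R) hl
        fun a ha => by simp [hφ0R a ha]
      exact hD.integral_fderiv_eq_zero (R := R) (fun a ha => by simp [hφ0R a ha]) v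
    have z2 : ∫ a, fderiv ℝ (fun b => (h b - e b) * φ b) a v = 0 := by
      obtain ⟨Cw, hCw0, hCw⟩ := hw R
      refine integral_fderiv_eq_zero_of_locallyLipschitz (S := S) (d := fun a => infDist a Z)
        (K := K) (R := R) (C := Cw * |Bφ|) hS0 hS hK (by positivity) (fun a => infDist_nonneg)
        (fun a ha => by simp [hφ0R a ha]) (fun a => ?_) (fun a ha => ?_) ?_ ?_ hqI v ?_
      · by_cases ha : a ∈ ball (0 : Euc m) R
        · rw [abs_mul]
          calc _ ≤ (Cw * infDist a Z) * |Bφ| :=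
                mul_le_mul (hCw a ha) ((hBφ a).trans (le_abs_self _)) (abs_nonneg _)
                  (mul_nonneg hCw0 infDist_nonneg)
            _ = _ := by ring
        · rw [hφ0R a ha, mul_zero, abs_zero]
          exact mul_nonneg (by positivity) infDist_nonneg
      · obtain ⟨K', hK'⟩ := hlip a ha
        exact ⟨_, ((hK'.add heL.lipAt.neg).congr (h' := fun b => h b - e b)
          (Filter.Eventually.of_forall fun b => sub_eq_add_neg _ _)).mul hCφ.lipAt
          (lt_add_one _) (lt_add_one _)⟩
      · filter_upwards [hdiff, hed] with a t1 t2
        exact (t1.sub t2).mul (hφd a)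
      · filter_upwards [hw0, hae] with a t1 t2 t3
        have haZ : a ∈ Z := t2.resolve_right (by simp [t3])
        have := (t1 haZ).mul (hφd a).hasFDerivAt
        rw [show (fun b => (h b - e b) * φ b) = (fun b => h b - e b) * φ from rfl, this.fderiv]
        simp [heZ a haZ]
      · exact ((i1.add i2).sub i3).congr hsum.symm
    have i12 : Integrable fun a => h a * fderiv ℝ φ a v + fderiv ℝ h a v * φ a := i1.add i2
    rw [integral_congr_ae hsum, integral_sub i12 i3, integral_add i1 i2, z1] at z2
    simp only
    linarith

namespace WhitneySystem
variable {m : ℕ} {Z : Set (Euc m)} (W : WhitneySystem Z) (n : ℕ)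

lemma S_nonneg (a : Euc m) : 0 ≤ W.S n a := Finset.sum_nonneg fun k _ => W.G_nonneg k a

lemma C_pos : 0 < W.C := zero_lt_one.trans_le W.one_le_C

lemma S_sub_le (a b : Euc m) : W.S n a - W.S n b ≤ ((n + 1) * W.C) * dist a b := by
  rw [S, S, ← Finset.sum_sub_distrib]
  calc _ ≤ ∑ _k ∈ Finset.range (n + 1), W.C * dist a b :=
        Finset.sum_le_sum fun k _ => by linarith [W.G_lip k a b]
    _ = _ := by simp; ring

lemma S_eq_zero {a : Euc m} (ha : a ∈ Z) : W.S n a = 0 :=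
  Finset.sum_eq_zero fun k _ => W.G_eq_zero k a ha

lemma S_le_infDist (hZ : IsCompact Z) (hne : Z.Nonempty) (a : Euc m) :
    W.S n a ≤ ((n + 1) * W.C) * infDist a Z := by
  obtain ⟨z, hz, hd⟩ := hZ.exists_infDist_eq_dist hne a
  have := W.S_sub_le n a z
  rw [W.S_eq_zero n hz] at this
  rw [hd]
  linarith

/-- A point `i.1` off the degenerate set, together with a nearby point `i.2` of `Z`. -/
def Admissible (i : Euc m × Euc m) : Prop :=
  0 < W.S n i.1 ∧ i.2 ∈ Z ∧ dist i.1 i.2 ≤ W.C * infDist i.1 Z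

/-- The family `H` is, at the admissible points satisfying `Q`, of size `d ^ r` and locally
Lipschitz with constant of size `d ^ r / S`, where `d` is the distance to `Z`. -/
def Tame (Q : Euc m × Euc m → Prop) (r : ℕ) (H : Euc m × Euc m → Euc m → ℝ) : Prop :=
  ∃ C : ℝ, 0 < C ∧ ∀ i, W.Admissible n i → Q i →
    |H i i.1| ≤ C * infDist i.1 Z ^ r ∧ LipAt (C * infDist i.1 Z ^ r / W.S n i.1) (H i) i.1

variable {W n} {Q Q' : Euc m × Euc m → Prop} {r r' : ℕ} {H H' : Euc m × Euc m → Euc m → ℝ}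

lemma Tame.of_imp (h : W.Tame n Q r H) (hQ : ∀ i, Q' i → Q i) : W.Tame n Q' r H := by
  obtain ⟨C, h0, hC⟩ := h
  exact ⟨C, h0, fun i hi hq => hC i hi (hQ i hq)⟩

lemma Tame.congr (h : W.Tame n Q r H)
    (he : ∀ i, W.Admissible n i → Q i → ∀ᶠ b in nhds i.1, H' i b = H i b) :
    W.Tame n Q r H' := by
  obtain ⟨C, h0, hC⟩ := h
  refine ⟨C, h0, fun i hi hq => ⟨?_, (hC i hi hq).2.congr (he i hi hq)⟩⟩
  rw [(he i hi hq).self_of_nhds]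
  exact (hC i hi hq).1

lemma Tame.congr' (h : W.Tame n Q r H) (he : ∀ i b, H' i b = H i b) : W.Tame n Q r H' :=
  h.congr fun i _ _ => Filter.Eventually.of_forall (he i)

lemma tame_mono_const {C C' : ℝ} {i : Euc m × Euc m} (hi : W.Admissible n i) (hCC : C ≤ C')
    {h : Euc m → ℝ}
    (hh : |h i.1| ≤ C * infDist i.1 Z ^ r ∧ LipAt (C * infDist i.1 Z ^ r / W.S n i.1) h i.1) :
    |h i.1| ≤ C' * infDist i.1 Z ^ r ∧ LipAt (C' * infDist i.1 Z ^ r / W.S n i.1) h i.1 := by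
  have hd : 0 ≤ infDist i.1 Z ^ r := pow_nonneg infDist_nonneg _
  have h1 := mul_le_mul_of_nonneg_right hCC hd
  exact ⟨hh.1.trans h1, hh.2.mono (div_le_div_of_nonneg_right h1 hi.1.le)⟩

lemma Tame.cases (P : Euc m × Euc m → Prop) (h : W.Tame n (fun i => Q i ∧ P i) r H)
    (h' : W.Tame n (fun i => Q i ∧ ¬ P i) r H) : W.Tame n Q r H := by
  obtain ⟨C, h0, hC⟩ := h
  obtain ⟨C', h0', hC'⟩ := h'
  refine ⟨max C C', lt_max_of_lt_left h0, fun i hi hq => ?_⟩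
  by_cases hP : P i
  · exact tame_mono_const hi (le_max_left _ _) (hC i hi ⟨hq, hP⟩)
  · exact tame_mono_const hi (le_max_right _ _) (hC' i hi ⟨hq, hP⟩)

lemma Tame.add (h : W.Tame n Q r H) (h' : W.Tame n Q r H') :
    W.Tame n Q r fun i b => H i b + H' i b := by
  obtain ⟨C, h0, hC⟩ := h
  obtain ⟨C', h0', hC'⟩ := h'
  refine ⟨C + C', by positivity, fun i hi hq => ⟨?_, ?_⟩⟩
  · refine (abs_add_le _ _).trans ?_
    linarith [(hC i hi hq).1, (hC' i hi hq).1]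
  · refine ((hC i hi hq).2.add (hC' i hi hq).2).mono (le_of_eq ?_)
    ring

lemma Tame.neg (h : W.Tame n Q r H) : W.Tame n Q r fun i b => - H i b := by
  obtain ⟨C, h0, hC⟩ := h
  exact ⟨C, h0, fun i hi hq => ⟨by rw [abs_neg]; exact (hC i hi hq).1, (hC i hi hq).2.neg⟩⟩

lemma Tame.sub (h : W.Tame n Q r H) (h' : W.Tame n Q r H') :
    W.Tame n Q r fun i b => H i b - H' i b :=
  (h.add h'.neg).congr' fun _ _ => sub_eq_add_neg _ _

lemma Tame.const {c : Euc m × Euc m → ℝ} {C : ℝ}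
    (hc : ∀ i, W.Admissible n i → Q i → |c i| ≤ C * infDist i.1 Z ^ r) :
    W.Tame n Q r fun i _ => c i := by
  refine ⟨|C| + 1, by positivity, fun i hi hq => ⟨?_, (LipAt.const _).mono ?_⟩⟩
  · refine (hc i hi hq).trans (mul_le_mul_of_nonneg_right ?_ (pow_nonneg infDist_nonneg _))
    linarith [le_abs_self C]
  · exact div_nonneg (mul_nonneg (by positivity) (pow_nonneg infDist_nonneg _)) hi.1.le

lemma Tame.sum {H : ℕ → Euc m × Euc m → Euc m → ℝ} (N : ℕ)
    (h : ∀ j < N, W.Tame n Q r (H j)) :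
    W.Tame n Q r fun i b => ∑ j ∈ Finset.range N, H j i b := by
  induction N with
  | zero => simpa using Tame.const (c := fun _ => 0) (C := 0) (by simp)
  | succ N ih => exact ((ih fun j hj => h j (by omega)).add (h N (by omega))).congr' fun i b => Finset.sum_range_succ _ _

lemma Admissible.infDist_pos (hZ : IsCompact Z) (hne : Z.Nonempty) {i : Euc m × Euc m}
    (hi : W.Admissible n i) : 0 < infDist i.1 Z := by
  have h1 := W.S_le_infDist n hZ hne i.1
  have h2 : 0 < ((n : ℝ) + 1) * W.C := mul_pos (by positivity) W.C_pos
  exact pos_of_mul_pos_right (hi.1.trans_le h1) h2.le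

lemma Tame.mul (hZ : IsCompact Z) (hne : Z.Nonempty) (h : W.Tame n Q r H)
    (h' : W.Tame n Q r' H') : W.Tame n Q (r + r') fun i b => H i b * H' i b := by
  obtain ⟨C, h0, hC⟩ := h
  obtain ⟨C', h0', hC'⟩ := h'
  refine ⟨4 * C * C', by positivity, fun i hi hq => ⟨?_, ?_⟩⟩
  · have hd : 0 < infDist i.1 Z := hi.infDist_pos hZ hne
    rw [abs_mul]
    calc _ ≤ (C * infDist i.1 Z ^ r) * (C' * infDist i.1 Z ^ r') :=
          mul_le_mul (hC i hi hq).1 (hC' i hi hq).1 (abs_nonneg _) (by positivity)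
      _ = 1 * (C * C' * infDist i.1 Z ^ (r + r')) := by ring
      _ ≤ 4 * (C * C' * infDist i.1 Z ^ (r + r')) := by gcongr; norm_num
      _ = _ := by ring
  · have hd : 0 < infDist i.1 Z := hi.infDist_pos hZ hne
    have h1 : 0 < C * infDist i.1 Z ^ r := by positivity
    have h2 : 0 < C' * infDist i.1 Z ^ r' := by positivity
    refine ((hC i hi hq).2.mul (hC' i hi hq).2 (A := 2 * (C * infDist i.1 Z ^ r))
      (B := 2 * (C' * infDist i.1 Z ^ r')) ?_ ?_).mono (le_of_eq ?_)
    · linarith [(hC i hi hq).1]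
    · linarith [(hC' i hi hq).1]
    · ring

lemma Tame.of_le (h : W.Tame n Q (r + 1) H) {B : ℝ} (hB : ∀ i, Q i → infDist i.1 Z ≤ B) :
    W.Tame n Q r H := by
  obtain ⟨C, h0, hC⟩ := h
  refine ⟨C * (|B| + 1), by positivity, fun i hi hq => ?_⟩
  have hd : (0 : ℝ) ≤ infDist i.1 Z := infDist_nonneg
  have hle : C * infDist i.1 Z ^ (r + 1) ≤ C * (|B| + 1) * infDist i.1 Z ^ r := by
    rw [pow_succ, mul_assoc, mul_comm (_ ^ r)]
    gcongr
    linarith [le_abs_self B, hB i hq]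
  exact ⟨(hC i hi hq).1.trans hle,
    (hC i hi hq).2.mono (div_le_div_of_nonneg_right hle hi.1.le)⟩

lemma Tame.inv_mul (hZ : IsCompact Z) (hne : Z.Nonempty) (h : W.Tame n Q (r + 1) H)
    {c : Euc m × Euc m → ℝ} {B : ℝ}
    (hc : ∀ i, W.Admissible n i → Q i → |c i| ≤ B / infDist i.1 Z) :
    W.Tame n Q r fun i b => c i * H i b := by
  obtain ⟨C, h0, hC⟩ := h
  refine ⟨(|B| + 1) * C, by positivity, fun i hi hq => ?_⟩
  have hd : 0 < infDist i.1 Z := hi.infDist_pos hZ hne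
  have hc' : |c i| ≤ (|B| + 1) / infDist i.1 Z := (hc i hi hq).trans
    (div_le_div_of_nonneg_right (by linarith [le_abs_self B]) hd.le)
  have hle : |c i| * (C * infDist i.1 Z ^ (r + 1)) ≤ (|B| + 1) * C * infDist i.1 Z ^ r := by
    calc _ ≤ (|B| + 1) / infDist i.1 Z * (C * infDist i.1 Z ^ (r + 1)) := by gcongr
      _ = _ := by
        rw [pow_succ]
        field_simp
  refine ⟨?_, ?_⟩
  · rw [abs_mul]
    exact (mul_le_mul_of_nonneg_left (hC i hi hq).1 (abs_nonneg _)).trans hle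
  · have h1 := (hC i hi hq).2.comp (g := fun t => c i * t) (M := |c i|) (abs_nonneg _)
      fun x y => by rw [← abs_mul, mul_sub]
    refine h1.mono ?_
    rw [← mul_div_assoc]
    exact div_le_div_of_nonneg_right hle hi.1.le

lemma Tame.comp (h : W.Tame n Q 0 H) {g : ℝ → ℝ} {B M : ℝ} (hM : 0 ≤ M) (hB : ∀ t, |g t| ≤ B)
    (hg : ∀ s t, |g s - g t| ≤ M * |s - t|) : W.Tame n Q 0 fun i b => g (H i b) := by
  obtain ⟨C, h0, hC⟩ := h
  refine ⟨|B| + 1 + M * C, by positivity, fun i hi hq => ⟨?_, ?_⟩⟩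
  · have := hB (H i i.1)
    have h1 : 0 ≤ M * C := by positivity
    rw [pow_zero, mul_one]
    linarith [le_abs_self B]
  · refine ((hC i hi hq).2.comp hM hg).mono ?_
    rw [pow_zero, mul_one, mul_one, ← mul_div_assoc]
    refine div_le_div_of_nonneg_right ?_ hi.1.le
    linarith [abs_nonneg B]

lemma tame_of_lipschitz (hZ : IsCompact Z) (hne : Z.Nonempty) {A : ℝ} (hA : 0 ≤ A)
    {h : Euc m → ℝ} (hh : ∀ a b, |h a - h b| ≤ A * dist a b) {c : Euc m → ℝ}
    (hc : ∀ z ∈ Z, c z = h z) : W.Tame n Q 1 fun i b => h b - c i.2 := by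
  have hC := W.C_pos
  refine ⟨A * ((n + 1) * W.C) + 1, by positivity, fun i hi _ => ⟨?_, ?_⟩⟩
  · simp only [hc _ hi.2.1, pow_one]
    have hd : 0 ≤ infDist i.1 Z := infDist_nonneg
    calc _ ≤ A * (W.C * infDist i.1 Z) :=
          (hh _ _).trans (mul_le_mul_of_nonneg_left hi.2.2 hA)
      _ = A * (1 * W.C) * infDist i.1 Z := by ring
      _ ≤ A * ((n + 1) * W.C) * infDist i.1 Z := by
          gcongr
          linarith [(Nat.cast_nonneg n : (0 : ℝ) ≤ n)]
      _ ≤ _ := by linarith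
  · have h1 : LipAt A (fun b => h b - c i.2) i.1 := Filter.Eventually.of_forall fun q => by
      simpa using hh q.1 q.2
    refine h1.mono ?_
    rw [le_div_iff₀ hi.1, pow_one]
    have := mul_le_mul_of_nonneg_left (W.S_le_infDist n hZ hne i.1) hA
    have hd : 0 ≤ infDist i.1 Z := infDist_nonneg
    linarith

variable (W n) in
/-- The normalised weights of the Whitney system. -/
def T (k : ℕ) (a : Euc m) : ℝ := 4 * (n + 1) * W.G k a / W.S n a

lemma T_nonneg (k : ℕ) (a : Euc m) : 0 ≤ W.T n k a :=
  div_nonneg (mul_nonneg (by positivity) (W.G_nonneg k a)) (W.S_nonneg n a)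

lemma T_eq_zero {k : ℕ} {a : Euc m} (h : ¬ 0 < W.G k a) : W.T n k a = 0 := by
  rw [T, le_antisymm (not_lt.1 h) (W.G_nonneg k a), mul_zero, zero_div]

lemma G_pos_of_T_pos {k : ℕ} {a : Euc m} (h : 0 < W.T n k a) : 0 < W.G k a := by
  by_contra hcon
  exact h.ne' (T_eq_zero hcon)

lemma G_le_S {k : ℕ} (hk : k ≤ n) (a : Euc m) : W.G k a ≤ W.S n a :=
  Finset.single_le_sum (f := fun k => W.G k a) (fun k _ => W.G_nonneg k a)
    (Finset.mem_range.2 (by omega))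

lemma continuous_S : Continuous (W.S n) := continuous_of_sub_le (W.S_sub_le n)

lemma abs_G_sub_le (k : ℕ) (a b : Euc m) : |W.G k a - W.G k b| ≤ W.C * dist a b := by
  rw [abs_le]
  have h1 := W.G_lip k a b
  have h2 := W.G_lip k b a
  rw [dist_comm] at h2
  constructor <;> linarith

lemma abs_S_sub_le (a b : Euc m) : |W.S n a - W.S n b| ≤ ((n + 1) * W.C) * dist a b := by
  rw [abs_le]
  have h1 := W.S_sub_le n a b
  have h2 := W.S_sub_le n b a
  rw [dist_comm] at h2
  constructor <;> linarith

lemma tame_T {k : ℕ} (hk : k ≤ n) : W.Tame n Q 0 fun _ => W.T n k := by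
  have hC := W.C_pos
  refine ⟨4 * (n + 1) * (2 * (n + 2) * W.C + 1), by positivity, fun i hi _ => ?_⟩
  obtain ⟨hs, -⟩ := hi
  rw [pow_zero, mul_one]
  refine ⟨?_, ?_⟩
  · rw [abs_of_nonneg (T_nonneg _ _), T, mul_div_assoc]
    have : W.G k i.1 / W.S n i.1 ≤ 1 := div_le_one_of_le₀ (G_le_S hk _) hs.le
    have h0 : 0 ≤ 2 * ((n : ℝ) + 2) * W.C := by positivity
    gcongr
    linarith
  · have hlt : W.S n i.1 / 2 < W.S n i.1 := by linarith
    have hev := (W.continuous_S (n := n)).continuousAt.eventually_const_lt hlt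
    filter_upwards [hev.fst_snd_diag] with q hq
    obtain ⟨hb, hc⟩ := hq
    have hb0 : 0 < W.S n q.1 := by linarith
    have hc0 : 0 < W.S n q.2 := by linarith
    have e1 : W.T n k q.1 - W.T n k q.2 = 4 * (n + 1) * (((W.G k q.1 - W.G k q.2)
        + W.G k q.2 / W.S n q.2 * (W.S n q.2 - W.S n q.1)) / W.S n q.1) := by
      rw [T, T]
      field_simp
      ring
    have g1 : |W.G k q.2 / W.S n q.2| ≤ 1 := by
      rw [abs_of_nonneg (div_nonneg (W.G_nonneg _ _) hc0.le)]
      exact div_le_one_of_le₀ (G_le_S hk _) hc0.le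
    have g2 : |(W.G k q.1 - W.G k q.2) + W.G k q.2 / W.S n q.2 * (W.S n q.2 - W.S n q.1)|
        ≤ (n + 2) * W.C * dist q.1 q.2 := by
      refine (abs_add_le _ _).trans ?_
      rw [abs_mul]
      have t1 := W.abs_G_sub_le k q.1 q.2
      have t2 := W.abs_S_sub_le (n := n) q.2 q.1
      rw [dist_comm] at t2
      have t3 := mul_le_mul g1 t2 (abs_nonneg _) zero_le_one
      linarith
    rw [e1, abs_mul, abs_div, abs_of_pos hb0, abs_of_nonneg (by positivity : (0 : ℝ) ≤ 4 * (n + 1)),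
      mul_div_assoc (4 * ((n : ℝ) + 1)), mul_assoc (4 * ((n : ℝ) + 1))]
    refine mul_le_mul_of_nonneg_left ?_ (by positivity)
    calc _ ≤ ((n + 2) * W.C * dist q.1 q.2) / (W.S n i.1 / 2) :=
          div_le_div₀ (by positivity) g2 (by linarith) hb.le
      _ = (2 * (n + 2) * W.C) * dist q.1 q.2 / W.S n i.1 := by field_simp
      _ ≤ (2 * (n + 2) * W.C + 1) * dist q.1 q.2 / W.S n i.1 := by gcongr; linarith
      _ = _ := by ring

lemma continuousAt_T {k : ℕ} {a : Euc m} (ha : 0 < W.S n a) : ContinuousAt (W.T n k) a := by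
  have h1 : Continuous (W.G k) :=
    continuous_of_sub_le (K := W.C) fun a b => by linarith [W.G_lip k a b]
  exact ((continuous_const.mul h1).continuousAt).div (W.continuous_S).continuousAt ha.ne'

end WhitneySystem

/-- The derivative of the smooth transition function. -/
def transitionDeriv (t : ℝ) : ℝ := deriv Real.smoothTransition t

lemma transitionDeriv_eq_zero {t : ℝ} (h : t < 0 ∨ 1 < t) : transitionDeriv t = 0 := by
  rcases h with h | h
  · have : Real.smoothTransition =ᶠ[nhds t] fun _ => 0 := by
      filter_upwards [gt_mem_nhds h] with s hs using Real.smoothTransition.zero_of_nonpos hs.le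
    rw [transitionDeriv, this.deriv_eq, deriv_const]
  · have : Real.smoothTransition =ᶠ[nhds t] fun _ => 1 := by
      filter_upwards [lt_mem_nhds h] with s hs using Real.smoothTransition.one_of_one_le hs.le
    rw [transitionDeriv, this.deriv_eq, deriv_const]

lemma hasDerivAt_smoothTransition (t : ℝ) :
    HasDerivAt Real.smoothTransition (transitionDeriv t) t :=
  (Real.smoothTransition.contDiff (n := 1)).differentiable (by simp) t |>.hasDerivAt

lemma contDiff_transitionDeriv : ContDiff ℝ 1 transitionDeriv :=
  (contDiff_succ_iff_deriv.1 (Real.smoothTransition.contDiff (n := 1 + 1))).2.2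

lemma hasCompactSupport_transitionDeriv : HasCompactSupport transitionDeriv :=
  HasCompactSupport.intro (isCompact_Icc (a := (0 : ℝ)) (b := 1)) fun t ht => by
    refine transitionDeriv_eq_zero ?_
    by_contra hcon
    push Not at hcon
    exact ht ⟨hcon.1, hcon.2⟩

lemma exists_bound_transitionDeriv : ∃ M : ℝ, 0 ≤ M ∧ (∀ t, |transitionDeriv t| ≤ M) ∧
    (∀ s t, |transitionDeriv s - transitionDeriv t| ≤ M * |s - t|) ∧
    ∀ s t, |Real.smoothTransition s - Real.smoothTransition t| ≤ M * |s - t| := by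
  obtain ⟨B, hB⟩ := hasCompactSupport_transitionDeriv.exists_bound_of_continuous
    contDiff_transitionDeriv.continuous
  obtain ⟨C, hC⟩ := contDiff_transitionDeriv.lipschitzWith_of_hasCompactSupport
    hasCompactSupport_transitionDeriv one_ne_zero
  have h1 : LipschitzWith ‖B‖₊ Real.smoothTransition :=
    lipschitzWith_of_nnnorm_deriv_le (fun t => (hasDerivAt_smoothTransition t).differentiableAt)
      fun t => by
        rw [← NNReal.coe_le_coe]
        exact (hB t).trans (le_abs_self B)
  refine ⟨C + |B|, by positivity, fun t => ?_, fun s t => ?_, fun s t => ?_⟩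
  · have := hB t
    rw [Real.norm_eq_abs] at this
    linarith [le_abs_self B, C.coe_nonneg]
  · have := hC.dist_le_mul s t
    rw [Real.dist_eq, Real.dist_eq] at this
    nlinarith [mul_nonneg (abs_nonneg B) (abs_nonneg (s - t))]
  · have := h1.dist_le_mul s t
    rw [Real.dist_eq, Real.dist_eq, coe_nnnorm, Real.norm_eq_abs] at this
    nlinarith [mul_nonneg C.coe_nonneg (abs_nonneg (s - t))]

/-- A Whitney-type jet `(x, p, u)` on `Z`, with `u` having the derivative `∑ p j dx j`, together
with Lipschitz extensions `Y j` of the functions `x j`. -/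
structure ContactJet {m : ℕ} (n : ℕ) (Z : Set (Euc m)) where
  x : ℕ → Euc m → ℝ
  p : ℕ → Euc m → ℝ
  u : Euc m → ℝ
  Y : ℕ → Euc m → ℝ
  A : ℝ
  A_nonneg : 0 ≤ A
  Y_lip : ∀ j a b, |Y j a - Y j b| ≤ A * dist a b
  Y_eq : ∀ j, ∀ z ∈ Z, Y j z = x j z
  p_le : ∀ j, ∀ z ∈ Z, ∀ w ∈ Z, |p j z - p j w| ≤ A * dist z w
  u_le : ∀ z ∈ Z, ∀ w ∈ Z,
    |u z - u w - ∑ j ∈ Finset.range n, p j w * (x j z - x j w)| ≤ A * dist z w ^ 2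

namespace ContactJet
variable {m n : ℕ} {Z : Set (Euc m)} (J : ContactJet n Z) (W : WhitneySystem Z)

/-- The extension of `x j`: an affine function of the weight `T (j + 1)` where it is large. -/
def X (j : ℕ) (a : Euc m) : ℝ :=
  J.Y j a + Real.smoothTransition (2 * W.T n (j + 1) a - 1) *
    (J.x j (W.z (j + 1) a) + W.l (j + 1) a * W.T n (j + 1) a - J.Y j a)

/-- The first order Taylor polynomial at `z`, evaluated along the extension `X`. -/
def aff (z b : Euc m) : ℝ :=
  J.u z + ∑ j ∈ Finset.range n, J.p j z * (J.X W j b - J.x j z)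

/-- Successive blends of the Taylor polynomials; `U n` extends `u`. -/
def U : ℕ → Euc m → ℝ
  | 0, a => J.aff W (W.z 0 a) a
  | k + 1, a => U k a + Real.smoothTransition (W.T n (k + 1) a - 2) *
      (J.aff W (W.z (k + 1) a) a - U k a)

/-- The coefficients of `dU` with respect to `dX`; `P n j` extends `p j`. -/
def P : ℕ → ℕ → Euc m → ℝ
  | 0, j, a => J.p j (W.z 0 a)
  | k + 1, j, a => P k j a + Real.smoothTransition (W.T n (k + 1) a - 2) *
      (J.p j (W.z (k + 1) a) - P k j a) +
      if j = k then transitionDeriv (W.T n (k + 1) a - 2) *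
        (1 / W.l (k + 1) a * (J.aff W (W.z (k + 1) a) a - J.U W k a)) else 0

variable (n) in
/-- One of the first `k + 1` Taylor polynomials is selected near `a`. -/
def _root_.WhitneySystem.Active (k : ℕ) (a : Euc m) : Prop :=
  0 < W.G 0 a ∨ ∃ i, 1 ≤ i ∧ i ≤ k ∧ 3 < W.T n i a

variable {J W} {Q : Euc m × Euc m → Prop}

lemma x_le (j : ℕ) {z w : Euc m} (hz : z ∈ Z) (hw : w ∈ Z) :
    |J.x j z - J.x j w| ≤ J.A * dist z w := by
  rw [← J.Y_eq j z hz, ← J.Y_eq j w hw]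
  exact J.Y_lip j z w

lemma dist_z_le {i : Euc m × Euc m} (hi : W.Admissible n i) (k : ℕ) :
    dist (W.z k i.1) i.2 ≤ 2 * W.C * infDist i.1 Z := by
  have h1 := W.dist_z k i.1
  have h2 := dist_triangle_left (W.z k i.1) i.2 i.1
  linarith [hi.2.2]

lemma tame_x_z (j k : ℕ) :
    W.Tame n Q 1 fun i _ => J.x j (W.z k i.1) - J.x j i.2 :=
  WhitneySystem.Tame.const (C := J.A * (2 * W.C)) fun i hi _ => by
    have := mul_le_mul_of_nonneg_left (dist_z_le hi k) J.A_nonneg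
    rw [pow_one]
    linarith [x_le (J := J) j (W.z_mem k i.1) hi.2.1]

lemma tame_p_z (j k : ℕ) :
    W.Tame n Q 1 fun i _ => J.p j (W.z k i.1) - J.p j i.2 :=
  WhitneySystem.Tame.const (C := J.A * (2 * W.C)) fun i hi _ => by
    have := mul_le_mul_of_nonneg_left (dist_z_le hi k) J.A_nonneg
    rw [pow_one]
    linarith [J.p_le j _ (W.z_mem k i.1) _ hi.2.1]

lemma tame_l (k : ℕ) : W.Tame n Q 1 fun i _ => W.l k i.1 :=
  WhitneySystem.Tame.const (C := W.C) fun i _ _ => by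
    have h1 := W.infDist_le k i.1
    have h2 : 0 ≤ infDist i.1 Z := infDist_nonneg
    have h3 : 0 ≤ W.l k i.1 := nonneg_of_mul_nonneg_right (h2.trans h1) W.C_pos
    rw [abs_of_nonneg h3, pow_one]
    exact W.l_le k i.1

lemma abs_smoothTransition_le (t : ℝ) : |Real.smoothTransition t| ≤ 1 := by
  rw [abs_of_nonneg (Real.smoothTransition.nonneg t)]
  exact Real.smoothTransition.le_one t

lemma tame_smoothTransition {H : Euc m × Euc m → Euc m → ℝ} (h : W.Tame n Q 0 H) :
    W.Tame n Q 0 fun i b => Real.smoothTransition (H i b) := by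
  obtain ⟨M, h0, -, -, hM⟩ := exists_bound_transitionDeriv
  exact h.comp h0 abs_smoothTransition_le hM

lemma tame_transitionDeriv {H : Euc m × Euc m → Euc m → ℝ} (h : W.Tame n Q 0 H) :
    W.Tame n Q 0 fun i b => transitionDeriv (H i b) := by
  obtain ⟨M, h0, hB, hM, -⟩ := exists_bound_transitionDeriv
  exact h.comp h0 hB hM

lemma tame_real_const (c : ℝ) : W.Tame n Q 0 fun _ _ => c :=
  WhitneySystem.Tame.const (C := |c|) fun i _ _ => by simp

lemma tame_X (hZ : IsCompact Z) (hne : Z.Nonempty) {j : ℕ} (hj : j < n) :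
    W.Tame n Q 1 fun i b => J.X W j b - J.x j i.2 := by
  have hY : ∀ Q, W.Tame n Q 1 fun i b => J.Y j b - J.x j i.2 := fun Q =>
    WhitneySystem.tame_of_lipschitz hZ hne J.A_nonneg (J.Y_lip j) fun z hz => (J.Y_eq j z hz).symm
  refine WhitneySystem.Tame.cases (fun i => 0 < W.G (j + 1) i.1) ?_ ?_
  · have hT : W.Tame n (fun i => Q i ∧ 0 < W.G (j + 1) i.1) 0 fun _ => W.T n (j + 1) :=
      WhitneySystem.tame_T (by omega)
    have hχ := tame_smoothTransition ((hT.add hT).sub (tame_real_const 1))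
    have h1 := ((tame_x_z (J := J) (Q := fun i => Q i ∧ 0 < W.G (j + 1) i.1) j (j + 1)).add
      ((tame_l (j + 1)).mul hZ hne hT)).sub (hY _)
    refine ((hY _).add (hχ.mul hZ hne h1)).congr fun i _ hq => ?_
    filter_upwards [W.eventually_eq (j + 1) i.1 hq.2] with b hb
    rw [X, hb.1, hb.2, two_mul]
    ring
  · refine (hY _).congr fun i hi hq => ?_
    have hT : W.T n (j + 1) i.1 < 1 / 2 := by
      rw [WhitneySystem.T_eq_zero hq.2]
      norm_num
    filter_upwards [(WhitneySystem.continuousAt_T hi.1).eventually_lt_const hT] with b hb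
    rw [X, Real.smoothTransition.zero_of_nonpos (by linarith)]
    ring

lemma aff_sub_aff (z w b : Euc m) : J.aff W z b - J.aff W w b =
    (J.u z - J.u w - ∑ j ∈ Finset.range n, J.p j w * (J.x j z - J.x j w)) +
      ∑ j ∈ Finset.range n, (J.p j z - J.p j w) *
        ((J.X W j b - J.x j w) - (J.x j z - J.x j w)) := by
  have h : ∑ j ∈ Finset.range n, J.p j z * (J.X W j b - J.x j z) -
      ∑ j ∈ Finset.range n, J.p j w * (J.X W j b - J.x j w) +
      ∑ j ∈ Finset.range n, J.p j w * (J.x j z - J.x j w) =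
      ∑ j ∈ Finset.range n, (J.p j z - J.p j w) *
        ((J.X W j b - J.x j w) - (J.x j z - J.x j w)) := by
    rw [← Finset.sum_sub_distrib, ← Finset.sum_add_distrib]
    exact Finset.sum_congr rfl fun j _ => by ring
  rw [← h, aff, aff]
  ring

lemma tame_aff (hZ : IsCompact Z) (hne : Z.Nonempty) (k : ℕ) :
    W.Tame n Q 2 fun i b => J.aff W (W.z k i.1) b - J.aff W i.2 b := by
  refine WhitneySystem.Tame.congr' (WhitneySystem.Tame.add
    (WhitneySystem.Tame.const (C := J.A * (2 * W.C) ^ 2) (r := 2) fun i hi _ => ?_)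
    (WhitneySystem.Tame.sum n fun j hj => (tame_p_z (J := J) j k).mul hZ hne
      ((tame_X (J := J) hZ hne hj).sub (tame_x_z (J := J) j k)))) fun i b => aff_sub_aff _ _ _
  refine (J.u_le _ (W.z_mem k i.1) _ hi.2.1).trans ?_
  rw [mul_assoc, ← mul_pow]
  have := dist_z_le hi k
  have := J.A_nonneg
  gcongr

lemma eventually_transition_eq_zero {k : ℕ} {a : Euc m} (ha : 0 < W.S n a)
    (hT : W.T n k a < 2) : ∀ᶠ b in nhds a, Real.smoothTransition (W.T n k b - 2) = 0 ∧
      transitionDeriv (W.T n k b - 2) = 0 := by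
  filter_upwards [(WhitneySystem.continuousAt_T ha).eventually_lt_const hT] with b hb
  exact ⟨Real.smoothTransition.zero_of_nonpos (by linarith),
    transitionDeriv_eq_zero (Or.inl (by linarith))⟩

lemma eventually_transition_eq_one {k : ℕ} {a : Euc m} (ha : 0 < W.S n a)
    (hT : 3 < W.T n k a) : ∀ᶠ b in nhds a, Real.smoothTransition (W.T n k b - 2) = 1 ∧
      transitionDeriv (W.T n k b - 2) = 0 := by
  filter_upwards [(WhitneySystem.continuousAt_T ha).eventually_const_lt hT] with b hb
  exact ⟨Real.smoothTransition.one_of_one_le (by linarith),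
    transitionDeriv_eq_zero (Or.inr (by linarith))⟩

lemma active_of_succ {k : ℕ} {a : Euc m} (h : W.Active n (k + 1) a) (hT : ¬ 3 < W.T n (k + 1) a) :
    W.Active n k a := by
  rcases h with h | ⟨i, h1, h2, h3⟩
  · exact Or.inl h
  · refine Or.inr ⟨i, h1, ?_, h3⟩
    by_contra hcon
    have : i = k + 1 := by omega
    exact hT (this ▸ h3)

lemma tame_U_P (hZ : IsCompact Z) (hne : Z.Nonempty) {k : ℕ} (hk : k ≤ n) :
    (W.Tame n (fun i => W.Active n k i.1) 2 fun i b => J.U W k b - J.aff W i.2 b) ∧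
    ∀ j, W.Tame n (fun i => W.Active n k i.1) 1 fun i b => J.P W k j b - J.p j i.2 := by
  induction k with
  | zero =>
    have hA : ∀ i : Euc m × Euc m, W.Active n 0 i.1 → 0 < W.G 0 i.1 := by
      rintro i (h | ⟨i, h1, h2, -⟩)
      · exact h
      · omega
    refine ⟨(tame_aff (J := J) hZ hne 0).congr fun i _ hq => ?_,
      fun j => (tame_p_z (J := J) j 0).congr fun i _ hq => ?_⟩
    · filter_upwards [W.eventually_eq 0 i.1 (hA i hq)] with b hb
      rw [U, hb.1]
    · filter_upwards [W.eventually_eq 0 i.1 (hA i hq)] with b hb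
      rw [P, hb.1]
  | succ k ih =>
    obtain ⟨ihU, ihP⟩ := ih (by omega)
    have hφ : ∀ Q, W.Tame n Q 0 fun _ b => Real.smoothTransition (W.T n (k + 1) b - 2) := fun Q =>
      tame_smoothTransition ((WhitneySystem.tame_T hk).sub (tame_real_const 2))
    have hφ' : ∀ Q, W.Tame n Q 0 fun _ b => transitionDeriv (W.T n (k + 1) b - 2) := fun Q =>
      tame_transitionDeriv ((WhitneySystem.tame_T hk).sub (tame_real_const 2))
    have hl : ∀ i, W.Admissible n i → |1 / W.l (k + 1) i.1| ≤ W.C / infDist i.1 Z := by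
      intro i hi
      have hd := hi.infDist_pos hZ hne
      have h1 := W.infDist_le (k + 1) i.1
      have h2 : 0 < W.l (k + 1) i.1 := pos_of_mul_pos_right (hd.trans_le h1) W.C_pos.le
      rw [abs_of_pos (by positivity), div_le_div_iff₀ h2 hd]
      linarith
    have hdisj : ∀ i : Euc m × Euc m, W.Active n (k + 1) i.1 ∧ ¬ W.Active n k i.1 →
        3 < W.T n (k + 1) i.1 := fun i hi => by
      by_contra hcon
      exact hi.2 (active_of_succ hi.1 hcon)
    refine ⟨?_, fun j => ?_⟩
    · refine WhitneySystem.Tame.cases (fun i => W.Active n k i.1)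
        (WhitneySystem.Tame.cases (fun i => 0 < W.G (k + 1) i.1) ?_ ?_) ?_
      · have ih' := ihU.of_imp (Q' := fun i => (W.Active n (k + 1) i.1 ∧ W.Active n k i.1) ∧
          0 < W.G (k + 1) i.1) fun i hi => hi.1.2
        refine (ih'.add ((hφ _).mul hZ hne ((tame_aff (J := J) hZ hne (k + 1)).sub ih'))).congr
          fun i _ hq => ?_
        filter_upwards [W.eventually_eq (k + 1) i.1 hq.2] with b hb
        rw [U, hb.1]
        ring
      · refine (ihU.of_imp fun i hi => hi.1.2).congr fun i hi hq => ?_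
        filter_upwards [eventually_transition_eq_zero hi.1
          (by rw [WhitneySystem.T_eq_zero hq.2]; norm_num : W.T n (k + 1) i.1 < 2)] with b hb
        rw [U, hb.1]
        ring
      · refine (tame_aff (J := J) hZ hne (k + 1)).congr fun i hi hq => ?_
        have h3 := hdisj i hq
        filter_upwards [eventually_transition_eq_one hi.1 h3,
          W.eventually_eq (k + 1) i.1 (WhitneySystem.G_pos_of_T_pos (by linarith))] with b hb hb'
        rw [U, hb.1, hb'.1]
        ring
    · refine WhitneySystem.Tame.cases (fun i => W.Active n k i.1)
        (WhitneySystem.Tame.cases (fun i => 0 < W.G (k + 1) i.1) ?_ ?_) ?_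
      · have ih' := (ihP j).of_imp (Q' := fun i => (W.Active n (k + 1) i.1 ∧ W.Active n k i.1) ∧
          0 < W.G (k + 1) i.1) fun i hi => hi.1.2
        have ihU' := ihU.of_imp (Q' := fun i => (W.Active n (k + 1) i.1 ∧ W.Active n k i.1) ∧
          0 < W.G (k + 1) i.1) fun i hi => hi.1.2
        have h1 := ih'.add ((hφ _).mul hZ hne ((tame_p_z (J := J) j (k + 1)).sub ih'))
        by_cases hjk : j = k
        · have h2 := (hφ' _).mul hZ hne (((tame_aff (J := J) hZ hne (k + 1)).sub ihU').inv_mul hZ hne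
            (c := fun i => 1 / W.l (k + 1) i.1) (B := W.C) fun i hi _ => hl i hi)
          refine (h1.add h2).congr fun i _ hq => ?_
          filter_upwards [W.eventually_eq (k + 1) i.1 hq.2] with b hb
          rw [P, hb.1, hb.2, if_pos hjk]
          ring
        · refine h1.congr fun i _ hq => ?_
          filter_upwards [W.eventually_eq (k + 1) i.1 hq.2] with b hb
          rw [P, hb.1, hb.2, if_neg hjk]
          ring
      · refine ((ihP j).of_imp fun i hi => hi.1.2).congr fun i hi hq => ?_
        filter_upwards [eventually_transition_eq_zero hi.1
          (by rw [WhitneySystem.T_eq_zero hq.2]; norm_num : W.T n (k + 1) i.1 < 2)] with b hb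
        rw [P, hb.1, hb.2]
        simp
      · refine (tame_p_z (J := J) j (k + 1)).congr fun i hi hq => ?_
        have h3 := hdisj i hq
        filter_upwards [eventually_transition_eq_one hi.1 h3,
          W.eventually_eq (k + 1) i.1 (WhitneySystem.G_pos_of_T_pos (by linarith))] with b hb hb'
        rw [P, hb.1, hb.2, hb'.1]
        simp

lemma active_self {a : Euc m} (ha : 0 < W.S n a) : W.Active n n a := by
  by_contra hcon
  rw [WhitneySystem.Active] at hcon
  push Not at hcon
  have h1 : ∀ k ∈ Finset.range (n + 1), W.G k a ≤ 3 / (4 * (n + 1)) * W.S n a := by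
    intro k hk
    rcases Nat.eq_zero_or_pos k with rfl | hk0
    · exact hcon.1.trans (by positivity)
    · have := hcon.2 k hk0 (by rw [Finset.mem_range] at hk; omega)
      rw [WhitneySystem.T, div_le_iff₀ ha] at this
      rw [div_mul_eq_mul_div, le_div_iff₀ (by positivity)]
      linarith
  have h2 : W.S n a ≤ ∑ _k ∈ Finset.range (n + 1), 3 / (4 * ((n : ℝ) + 1)) * W.S n a :=
    Finset.sum_le_sum h1
  rw [Finset.sum_const, Finset.card_range, nsmul_eq_mul] at h2
  push_cast at h2
  have h3 : ((n : ℝ) + 1) * (3 / (4 * (n + 1)) * W.S n a) = 3 / 4 * W.S n a := by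
    field_simp
  linarith

lemma hasFDerivAt_aff {a : Euc m} {X' : ℕ → Euc m →L[ℝ] ℝ}
    (hX : ∀ j < n, HasFDerivAt (J.X W j) (X' j) a) (z : Euc m) :
    HasFDerivAt (J.aff W z) (∑ j ∈ Finset.range n, J.p j z • X' j) a := by
  refine HasFDerivAt.const_add _ (HasFDerivAt.fun_sum fun j hj => ?_)
  exact ((hX j (Finset.mem_range.1 hj)).sub_const _).const_mul _

lemma hasFDerivAt_U (hZ : IsCompact Z) (hne : Z.Nonempty) {a : Euc m} (ha : 0 < W.S n a)
    {X' : ℕ → Euc m →L[ℝ] ℝ} (hX : ∀ j < n, HasFDerivAt (J.X W j) (X' j) a) {k : ℕ} (hk : k ≤ n)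
    (hA : W.Active n k a) :
    HasFDerivAt (J.U W k) (∑ j ∈ Finset.range n, J.P W k j a • X' j) a := by
  induction k with
  | zero =>
    have hG : 0 < W.G 0 a := by
      rcases hA with h | ⟨i, h1, h2, -⟩
      · exact h
      · omega
    refine (hasFDerivAt_aff hX (W.z 0 a)).congr_of_eventuallyEq ?_
    filter_upwards [W.eventually_eq 0 a hG] with b hb
    rw [U, hb.1]
  | succ k ih =>
    by_cases h3 : 3 < W.T n (k + 1) a
    · have hone := eventually_transition_eq_one ha h3
      have hfr := W.eventually_eq (k + 1) a (WhitneySystem.G_pos_of_T_pos (by linarith))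
      have hP : ∀ j, J.P W (k + 1) j a = J.p j (W.z (k + 1) a) := fun j => by
        rw [P, hone.self_of_nhds.1, hone.self_of_nhds.2]
        simp
      simp only [hP]
      refine (hasFDerivAt_aff hX (W.z (k + 1) a)).congr_of_eventuallyEq ?_
      filter_upwards [hone, hfr] with b hb hb'
      rw [U, hb.1, hb'.1]
      ring
    have ih' := ih (by omega) (active_of_succ hA h3)
    by_cases h2 : W.T n (k + 1) a < 2
    · have hzero := eventually_transition_eq_zero ha h2
      have hP : ∀ j, J.P W (k + 1) j a = J.P W k j a := fun j => by
        rw [P, hzero.self_of_nhds.1, hzero.self_of_nhds.2]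
        simp
      simp only [hP]
      refine ih'.congr_of_eventuallyEq ?_
      filter_upwards [hzero] with b hb
      rw [U, hb.1]
      ring
    push Not at h2
    have hfr := W.eventually_eq (k + 1) a (WhitneySystem.G_pos_of_T_pos (by linarith))
    set z := W.z (k + 1) a with hz
    set l := W.l (k + 1) a with hl
    have hl0 : 0 < l := by
      have hd : 0 < infDist a Z := WhitneySystem.Admissible.infDist_pos hZ hne (W := W) (n := n)
        (i := (a, W.z 0 a)) ⟨ha, W.z_mem 0 a, W.dist_z 0 a⟩
      exact pos_of_mul_pos_right (hd.trans_le (W.infDist_le (k + 1) a)) W.C_pos.le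
    have hT : HasFDerivAt (W.T n (k + 1)) ((1 / l) • X' k) a := by
      have h1 := ((hX k (by omega)).sub_const (J.x k z)).const_mul (1 / l)
      refine h1.congr_of_eventuallyEq ?_
      have hlt : 1 < W.T n (k + 1) a := by linarith
      filter_upwards [(WhitneySystem.continuousAt_T ha).eventually_const_lt hlt, hfr] with b hb hb'
      rw [X, Real.smoothTransition.one_of_one_le (by linarith), hb'.1, hb'.2]
      field_simp
      ring
    have hφ : HasFDerivAt (fun b => Real.smoothTransition (W.T n (k + 1) b - 2))
        (transitionDeriv (W.T n (k + 1) a - 2) • ((1 / l) • X' k)) a :=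
      (hasDerivAt_smoothTransition _).comp_hasFDerivAt a (hT.sub_const 2)
    have hU := ih'.add (hφ.mul ((hasFDerivAt_aff hX z).sub ih'))
    have hsum : (∑ j ∈ Finset.range n, J.P W (k + 1) j a • X' j) =
        (∑ j ∈ Finset.range n, J.P W k j a • X' j) +
        (Real.smoothTransition (W.T n (k + 1) a - 2) •
          ((∑ j ∈ Finset.range n, J.p j z • X' j) - ∑ j ∈ Finset.range n, J.P W k j a • X' j) +
        (J.aff W z a - J.U W k a) •
          (transitionDeriv (W.T n (k + 1) a - 2) • ((1 / l) • X' k))) := by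
      rw [← Finset.sum_sub_distrib, Finset.smul_sum, ← add_assoc, ← Finset.sum_add_distrib]
      have h1 : ∀ j ∈ Finset.range n, J.P W (k + 1) j a • X' j =
          (J.P W k j a • X' j + Real.smoothTransition (W.T n (k + 1) a - 2) •
            (J.p j z • X' j - J.P W k j a • X' j)) +
          if j = k then (transitionDeriv (W.T n (k + 1) a - 2) *
            (1 / l * (J.aff W z a - J.U W k a))) • X' j else 0 := by
        intro j _
        rw [P]
        split_ifs
        · module
        · module
      rw [Finset.sum_congr rfl h1, Finset.sum_add_distrib, Finset.sum_ite_eq' ,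
        if_pos (Finset.mem_range.2 (by omega))]
      congr 1
      module
    rw [hsum]
    refine hU.congr_of_eventuallyEq ?_
    filter_upwards [hfr] with b hb
    rw [U, hb.1]
    rfl

end ContactJet

namespace ContactJet
variable {m n : ℕ} {Z : Set (Euc m)} {J : ContactJet n Z} {W : WhitneySystem Z}

lemma T_of_S_eq_zero {a : Euc m} (ha : W.S n a = 0) (k : ℕ) : W.T n k a = 0 := by
  rw [WhitneySystem.T, ha, div_zero]

lemma X_of_S_eq_zero {a : Euc m} (ha : W.S n a = 0) (j : ℕ) : J.X W j a = J.Y j a := by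
  rw [X, T_of_S_eq_zero ha, Real.smoothTransition.zero_of_nonpos (by norm_num)]
  ring

lemma U_of_S_eq_zero {a : Euc m} (ha : W.S n a = 0) (k : ℕ) :
    J.U W k a = J.aff W (W.z 0 a) a := by
  induction k with
  | zero => rfl
  | succ k ih =>
    rw [U, T_of_S_eq_zero ha, Real.smoothTransition.zero_of_nonpos (by norm_num), ih]
    ring

lemma P_of_S_eq_zero {a : Euc m} (ha : W.S n a = 0) (k j : ℕ) :
    J.P W k j a = J.p j (W.z 0 a) := by
  induction k with
  | zero => rfl
  | succ k ih =>
    rw [P, T_of_S_eq_zero ha, Real.smoothTransition.zero_of_nonpos (by norm_num), ih,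
      transitionDeriv_eq_zero (Or.inl (by norm_num))]
    simp

lemma admissible_z {a : Euc m} (ha : 0 < W.S n a) : W.Admissible n (a, W.z 0 a) :=
  ⟨ha, W.z_mem 0 a, W.dist_z 0 a⟩

lemma exists_bound_of_tame {r : ℕ} {H : Euc m × Euc m → Euc m → ℝ}
    (h : W.Tame n (fun i => W.Active n n i.1) r H) {C₀ : ℝ}
    (h0 : ∀ a, W.S n a = 0 → |H (a, W.z 0 a) a| ≤ C₀ * infDist a Z ^ r) :
    ∃ C, 0 ≤ C ∧ ∀ a, |H (a, W.z 0 a) a| ≤ C * infDist a Z ^ r := by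
  obtain ⟨C, hC0, hC⟩ := h
  refine ⟨C + |C₀|, by positivity, fun a => ?_⟩
  have hd : 0 ≤ infDist a Z ^ r := pow_nonneg infDist_nonneg _
  rcases (W.S_nonneg n a).eq_or_lt with ha | ha
  · refine (h0 a ha.symm).trans (mul_le_mul_of_nonneg_right ?_ hd)
    linarith [le_abs_self C₀]
  · refine (hC _ (admissible_z ha) (active_self ha)).1.trans (mul_le_mul_of_nonneg_right ?_ hd)
    linarith [abs_nonneg C₀]

lemma dist_z_zero_le {z : Euc m} (hz : z ∈ Z) (b : Euc m) :
    dist (W.z 0 b) z ≤ (1 + W.C) * dist b z := by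
  have h1 := W.dist_z 0 b
  have h2 := mul_le_mul_of_nonneg_left (infDist_le_dist_of_mem (x := b) hz) W.C_pos.le
  have h3 := dist_triangle_left (W.z 0 b) z b
  linarith

lemma exists_X_bound (hZ : IsCompact Z) (hne : Z.Nonempty) {j : ℕ} (hj : j < n) :
    ∃ C, 0 ≤ C ∧ ∀ z ∈ Z, ∀ b, |J.X W j b - J.x j z| ≤ C * dist b z := by
  obtain ⟨C, hC0, hC⟩ := exists_bound_of_tame (tame_X (J := J) (W := W) hZ hne hj)
    (C₀ := J.A * W.C) fun a ha => by
      rw [X_of_S_eq_zero ha, ← J.Y_eq j _ (W.z_mem 0 a), pow_one, mul_assoc]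
      exact (J.Y_lip j _ _).trans (mul_le_mul_of_nonneg_left (W.dist_z 0 a) J.A_nonneg)
  have hA := J.A_nonneg
  have hW := W.C_pos
  refine ⟨C + J.A * (1 + W.C), by positivity, fun z hz b => ?_⟩
  have h1 := hC b
  have h2 := (x_le (J := J) j (W.z_mem 0 b) hz).trans
    (mul_le_mul_of_nonneg_left (dist_z_zero_le hz b) hA)
  have h3 := mul_le_mul_of_nonneg_left (infDist_le_dist_of_mem (x := b) hz) hC0
  have h4 := abs_sub_le (J.X W j b) (J.x j (W.z 0 b)) (J.x j z)
  rw [pow_one] at h1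
  linarith

lemma exists_P_bound (hZ : IsCompact Z) (hne : Z.Nonempty) (j : ℕ) :
    ∃ C, 0 ≤ C ∧ ∀ z ∈ Z, ∀ b, |J.P W n j b - J.p j z| ≤ C * dist b z := by
  obtain ⟨C, hC0, hC⟩ := exists_bound_of_tame ((tame_U_P (J := J) (W := W) hZ hne le_rfl).2 j)
    (C₀ := 0) fun a ha => by
      rw [P_of_S_eq_zero ha]
      simp
  have hA := J.A_nonneg
  have hW := W.C_pos
  refine ⟨C + J.A * (1 + W.C), by positivity, fun z hz b => ?_⟩
  have h1 := hC b
  have h2 := (J.p_le j _ (W.z_mem 0 b) _ hz).trans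
    (mul_le_mul_of_nonneg_left (dist_z_zero_le hz b) hA)
  have h3 := mul_le_mul_of_nonneg_left (infDist_le_dist_of_mem (x := b) hz) hC0
  have h4 := abs_sub_le (J.P W n j b) (J.p j (W.z 0 b)) (J.p j z)
  rw [pow_one] at h1
  linarith

lemma exists_aff_bound (hZ : IsCompact Z) (hne : Z.Nonempty) :
    ∃ C, 0 ≤ C ∧ ∀ z ∈ Z, ∀ b, |J.aff W (W.z 0 b) b - J.aff W z b| ≤ C * dist b z ^ 2 := by
  have hX : ∀ j, ∃ C, 0 ≤ C ∧ (j < n → ∀ z ∈ Z, ∀ b, |J.X W j b - J.x j z| ≤ C * dist b z) := by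
    intro j
    by_cases hj : j < n
    · obtain ⟨C, h0, hC⟩ := exists_X_bound (J := J) (W := W) hZ hne hj
      exact ⟨C, h0, fun _ => hC⟩
    · exact ⟨0, le_rfl, fun h => absurd h hj⟩
  choose C hC0 hC using hX
  have hA := J.A_nonneg
  have hW := W.C_pos
  set E := J.A * (1 + W.C) with hE
  have hE0 : 0 ≤ E := by positivity
  refine ⟨J.A * (1 + W.C) ^ 2 + ∑ j ∈ Finset.range n, E * (C j + E),
    add_nonneg (by positivity) (Finset.sum_nonneg fun j _ => mul_nonneg hE0 (add_nonneg (hC0 j) hE0)),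
    fun z hz b => ?_⟩
  have hw := W.z_mem 0 b
  have hd := dist_z_zero_le (W := W) hz b
  rw [aff_sub_aff, add_mul, Finset.sum_mul]
  refine (abs_add_le _ _).trans (add_le_add ?_ ((Finset.abs_sum_le_sum_abs _ _).trans
    (Finset.sum_le_sum fun j hj => ?_)))
  · refine (J.u_le _ hw _ hz).trans ?_
    rw [mul_assoc, ← mul_pow]
    gcongr
  · have h1 := (J.p_le j _ hw _ hz).trans (mul_le_mul_of_nonneg_left hd hA)
    have h2 := (x_le (J := J) j hw hz).trans (mul_le_mul_of_nonneg_left hd hA)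
    have h3 := hC j (Finset.mem_range.1 hj) z hz b
    rw [← mul_assoc, ← hE] at h1 h2
    rw [abs_mul]
    calc _ ≤ (E * dist b z) * (C j * dist b z + E * dist b z) :=
          mul_le_mul h1 ((abs_sub _ _).trans (add_le_add h3 h2)) (abs_nonneg _) (by positivity)
      _ = _ := by ring

lemma exists_U_bound (hZ : IsCompact Z) (hne : Z.Nonempty) :
    ∃ C, 0 ≤ C ∧ ∀ z ∈ Z, ∀ b, |J.U W n b - J.aff W z b| ≤ C * dist b z ^ 2 := by
  obtain ⟨C, hC0, hC⟩ := exists_bound_of_tame (tame_U_P (J := J) (W := W) hZ hne le_rfl).1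
    (C₀ := 0) fun a ha => by
      rw [U_of_S_eq_zero ha]
      simp
  obtain ⟨C', hC0', hC'⟩ := exists_aff_bound (J := J) (W := W) hZ hne
  refine ⟨C + C', by positivity, fun z hz b => ?_⟩
  have h1 := hC b
  have h2 : C * infDist b Z ^ 2 ≤ C * dist b z ^ 2 := by
    have := infDist_le_dist_of_mem (x := b) hz
    have h0 : 0 ≤ infDist b Z := infDist_nonneg
    gcongr
  have h4 := abs_sub_le (J.U W n b) (J.aff W (W.z 0 b) b) (J.aff W z b)
  have h5 := hC' z hz b
  simp only at h1
  linarith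

lemma X_eq (hZ : IsCompact Z) {j : ℕ} (hj : j < n) {z : Euc m} (hz : z ∈ Z) :
    J.X W j z = J.x j z := by
  obtain ⟨C, -, hC⟩ := exists_X_bound (J := J) (W := W) hZ ⟨z, hz⟩ hj
  simpa [sub_eq_zero] using hC z hz z

lemma P_eq (hZ : IsCompact Z) (j : ℕ) {z : Euc m} (hz : z ∈ Z) : J.P W n j z = J.p j z := by
  obtain ⟨C, -, hC⟩ := exists_P_bound (J := J) (W := W) hZ ⟨z, hz⟩ j
  simpa [sub_eq_zero] using hC z hz z

lemma aff_self (hZ : IsCompact Z) {z : Euc m} (hz : z ∈ Z) : J.aff W z z = J.u z := by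
  rw [aff, Finset.sum_eq_zero, add_zero]
  intro j hj
  rw [X_eq hZ (Finset.mem_range.1 hj) hz, sub_self, mul_zero]

lemma U_eq (hZ : IsCompact Z) {z : Euc m} (hz : z ∈ Z) : J.U W n z = J.u z := by
  obtain ⟨C, -, hC⟩ := exists_U_bound (J := J) (W := W) hZ ⟨z, hz⟩
  rw [← aff_self (J := J) (W := W) hZ hz]
  simpa [sub_eq_zero] using hC z hz z

lemma hasFDerivAt_U_of_mem (hZ : IsCompact Z) {z : Euc m} (hz : z ∈ Z)
    {X' : ℕ → Euc m →L[ℝ] ℝ} (hX : ∀ j < n, HasFDerivAt (J.X W j) (X' j) z) :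
    HasFDerivAt (J.U W n) (∑ j ∈ Finset.range n, J.P W n j z • X' j) z := by
  obtain ⟨C, hC0, hC⟩ := exists_U_bound (J := J) (W := W) hZ ⟨z, hz⟩
  have h1 : HasFDerivAt (fun b => J.U W n b - J.aff W z b) (0 : Euc m →L[ℝ] ℝ) z := by
    refine .of_isLittleO ?_
    have h2 : (fun b => J.U W n b - J.aff W z b) =O[nhds z] fun b => ‖b - z‖ ^ 2 :=
      Asymptotics.IsBigO.of_bound C (Filter.Eventually.of_forall fun b => by
        simpa [dist_eq_norm] using hC z hz b)
    have h3 := h2.trans_isLittleO (Asymptotics.isLittleO_pow_sub_sub z one_lt_two)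
    refine h3.congr_left fun b => ?_
    rw [U_eq hZ hz, aff_self hZ hz]
    simp
  have h2 := h1.add (hasFDerivAt_aff hX z)
  simp only [P_eq hZ _ hz]
  rw [zero_add] at h2
  refine h2.congr_of_eventuallyEq (Filter.Eventually.of_forall fun b => ?_)
  simp

end ContactJet

lemma exists_abs_le_of_isCompact {m : ℕ} {Z : Set (Euc m)} (hZ : IsCompact Z) {A : ℝ}
    (hA : 0 ≤ A) {g : Euc m → ℝ} (hg : ∀ z ∈ Z, ∀ w ∈ Z, |g z - g w| ≤ A * dist z w) :
    ∃ M, 0 ≤ M ∧ ∀ z ∈ Z, |g z| ≤ M := by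
  rcases Z.eq_empty_or_nonempty with rfl | ⟨w, hw⟩
  · exact ⟨0, le_rfl, by simp⟩
  refine ⟨|g w| + A * diam Z, add_nonneg (abs_nonneg _) (mul_nonneg hA diam_nonneg),
    fun z hz => ?_⟩
  have h1 := abs_add_le (g w) (g z - g w)
  have h2 := (hg z hz w hw).trans
    (mul_le_mul_of_nonneg_left (dist_le_diam_of_mem hZ.isBounded hz hw) hA)
  rw [add_sub_cancel] at h1
  linarith

lemma exists_sum_bound {m : ℕ} {Z B : Set (Euc m)} {h : ℕ → Euc m → Euc m → ℝ} (N : ℕ)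
    (hh : ∀ j < N, ∃ C : ℝ, ∀ z ∈ Z, ∀ b ∈ B, |h j b z| ≤ C * dist b z) :
    ∃ C : ℝ, ∀ z ∈ Z, ∀ b ∈ B, |∑ j ∈ Finset.range N, h j b z| ≤ C * dist b z := by
  induction N with
  | zero => exact ⟨0, by simp⟩
  | succ N ih =>
    obtain ⟨C, hC⟩ := ih fun j hj => hh j (by omega)
    obtain ⟨C', hC'⟩ := hh N (by omega)
    refine ⟨C + C', fun z hz b hb => ?_⟩
    rw [Finset.sum_range_succ]
    refine (abs_add_le _ _).trans ?_
    linarith [hC z hz b hb, hC' z hz b hb]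

lemma WhitneySystem.exists_lipAt_of_tame {m n : ℕ} {Z : Set (Euc m)} {W : WhitneySystem Z}
    {Q : Euc m × Euc m → Prop} {g c : Euc m → ℝ}
    (h : W.Tame n Q 1 fun i b => g b - c i.2) :
    ∃ C : ℝ, ∀ a, Q (a, W.z 0 a) → 0 < W.S n a → LipAt (C * (infDist a Z / W.S n a)) g a := by
  obtain ⟨C, -, hC⟩ := h
  refine ⟨C, fun a hq ha => ?_⟩
  have h1 := (hC _ (ContactJet.admissible_z ha) hq).2.add (LipAt.const (c (W.z 0 a)))
  rw [add_zero, pow_one, mul_div_assoc] at h1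
  exact h1.congr (Filter.Eventually.of_forall fun b => by simp)

namespace ContactJet
variable {m n : ℕ} {Z : Set (Euc m)} (J : ContactJet n Z) (W : WhitneySystem Z)

/-- The last coordinate of the horizontal extension. -/
def height (b : Euc m) : ℝ :=
  4 * J.U W n b - 2 * ∑ j ∈ Finset.range n, J.X W j b * J.P W n j b

/-- The last coordinate prescribed on `Z`. -/
def height₀ (z : Euc m) : ℝ := 4 * J.u z - 2 * ∑ j ∈ Finset.range n, J.x j z * J.p j z

variable {J W}

lemma height_eq (hZ : IsCompact Z) {z : Euc m} (hz : z ∈ Z) : J.height W z = J.height₀ z := by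
  rw [height, height₀, U_eq hZ hz]
  congr 2
  exact Finset.sum_congr rfl fun j hj => by rw [X_eq hZ (Finset.mem_range.1 hj) hz, P_eq hZ j hz]

lemma height_sub (z b : Euc m) : J.height W b - J.height₀ z =
    4 * (J.U W n b - J.aff W z b) + ∑ j ∈ Finset.range n,
      (2 * J.p j z * (J.X W j b - J.x j z) - 2 * J.x j z * (J.P W n j b - J.p j z) -
        2 * ((J.X W j b - J.x j z) * (J.P W n j b - J.p j z))) := by
  have h : ∑ j ∈ Finset.range n,
      (2 * J.p j z * (J.X W j b - J.x j z) - 2 * J.x j z * (J.P W n j b - J.p j z) -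
        2 * ((J.X W j b - J.x j z) * (J.P W n j b - J.p j z))) =
      4 * ∑ j ∈ Finset.range n, J.p j z * (J.X W j b - J.x j z) -
      2 * ∑ j ∈ Finset.range n, J.X W j b * J.P W n j b +
      2 * ∑ j ∈ Finset.range n, J.x j z * J.p j z := by
    simp only [Finset.mul_sum]
    rw [← Finset.sum_sub_distrib, ← Finset.sum_add_distrib]
    exact Finset.sum_congr rfl fun j _ => by ring
  rw [h, height, height₀, aff]
  ring

lemma tame_height (hZ : IsCompact Z) (hne : Z.Nonempty) (R : ℝ) :
    W.Tame n (fun i => W.Active n n i.1 ∧ i.1 ∈ ball 0 R) 1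
      fun i b => J.height W b - J.height₀ i.2 := by
  obtain ⟨w, hw⟩ := id hne
  have hB : ∀ i : Euc m × Euc m, W.Active n n i.1 ∧ i.1 ∈ ball 0 R →
      infDist i.1 Z ≤ R + dist 0 w := fun i hi => by
    have h1 := infDist_le_dist_of_mem (x := i.1) hw
    have h2 := dist_triangle i.1 0 w
    have h3 := mem_ball.1 hi.2
    linarith
  obtain ⟨hU, hP⟩ := tame_U_P (J := J) (W := W) hZ hne le_rfl
  have hU' := (hU.of_imp (Q' := fun i => W.Active n n i.1 ∧ i.1 ∈ ball 0 R)
    fun i hi => hi.1).of_le hB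
  have hP' := fun j => (hP j).of_imp (Q' := fun i => W.Active n n i.1 ∧ i.1 ∈ ball 0 R)
    fun i hi => hi.1
  refine (((tame_real_const 4).mul hZ hne hU').add (WhitneySystem.Tame.sum n fun j hj => ?_)).congr'
    fun i b => height_sub _ _
  have hX := tame_X (J := J) (W := W) (Q := fun i => W.Active n n i.1 ∧ i.1 ∈ ball 0 R) hZ hne hj
  obtain ⟨M, -, hM⟩ := exists_abs_le_of_isCompact hZ J.A_nonneg (J.p_le j)
  obtain ⟨M', -, hM'⟩ := exists_abs_le_of_isCompact hZ J.A_nonneg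
    fun z hz w hw => x_le (J := J) j hz hw
  have hp : W.Tame n (fun i => W.Active n n i.1 ∧ i.1 ∈ ball 0 R) 0 fun i _ => 2 * J.p j i.2 :=
    WhitneySystem.Tame.const (C := 2 * M) fun i hi _ => by
      rw [abs_mul, abs_two, pow_zero, mul_one]
      linarith [hM _ hi.2.1]
  have hx : W.Tame n (fun i => W.Active n n i.1 ∧ i.1 ∈ ball 0 R) 0 fun i _ => 2 * J.x j i.2 :=
    WhitneySystem.Tame.const (C := 2 * M') fun i hi _ => by
      rw [abs_mul, abs_two, pow_zero, mul_one]
      linarith [hM' _ hi.2.1]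
  exact ((hp.mul hZ hne hX).sub (hx.mul hZ hne (hP' j))).sub
    ((tame_real_const 2).mul hZ hne ((hX.mul hZ hne (hP' j)).of_le hB))

lemma exists_height_bound (hZ : IsCompact Z) (hne : Z.Nonempty) (R : ℝ) :
    ∃ C : ℝ, ∀ z ∈ Z, ∀ b ∈ ball (0 : Euc m) R,
      |J.height W b - J.height₀ z| ≤ C * dist b z := by
  obtain ⟨B, hB0, hB⟩ : ∃ B : ℝ, 0 ≤ B ∧ ∀ z ∈ Z, ∀ b ∈ ball (0 : Euc m) R, dist b z ≤ B := by
    obtain ⟨B, hB⟩ := hZ.isBounded.subset_closedBall (0 : Euc m)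
    refine ⟨|R + B|, abs_nonneg _, fun z hz b hb => ?_⟩
    have h1 := mem_closedBall.1 (hB hz)
    have h2 := mem_ball.1 hb
    have h3 := dist_triangle_right b z 0
    linarith [le_abs_self (R + B)]
  obtain ⟨C, hC0, hC⟩ := exists_U_bound (J := J) (W := W) hZ hne
  obtain ⟨C', hC'⟩ := exists_sum_bound (Z := Z) (B := ball (0 : Euc m) R) (h := fun j b z =>
      2 * J.p j z * (J.X W j b - J.x j z) - 2 * J.x j z * (J.P W n j b - J.p j z) -
        2 * ((J.X W j b - J.x j z) * (J.P W n j b - J.p j z))) n fun j hj => by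
    obtain ⟨D, hD0, hD⟩ := exists_X_bound (J := J) (W := W) hZ hne hj
    obtain ⟨D', hD0', hD'⟩ := exists_P_bound (J := J) (W := W) hZ hne j
    obtain ⟨M, hM0, hM⟩ := exists_abs_le_of_isCompact hZ J.A_nonneg (J.p_le j)
    obtain ⟨M', hM0', hM'⟩ := exists_abs_le_of_isCompact hZ J.A_nonneg
      fun z hz w hw => x_le (J := J) j hz hw
    refine ⟨2 * (M * D) + 2 * (M' * D') + 2 * (D * (D' * B)), fun z hz b hb => ?_⟩
    have e0 : 0 ≤ dist b z := dist_nonneg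
    have e1 := mul_le_mul (hM z hz) (hD z hz b) (abs_nonneg _) hM0
    have e2 := mul_le_mul (hM' z hz) (hD' z hz b) (abs_nonneg _) hM0'
    have e3 := mul_le_mul (hD z hz b) ((hD' z hz b).trans
      (mul_le_mul_of_nonneg_left (hB z hz b hb) hD0')) (abs_nonneg _) (by positivity)
    rw [← abs_mul] at e1 e2 e3
    refine (abs_sub _ _).trans ((add_le_add (abs_sub _ _) le_rfl).trans ?_)
    rw [mul_assoc, mul_assoc, abs_mul 2, abs_mul 2, abs_mul 2, abs_two]
    linarith
  refine ⟨4 * (C * B) + C', fun z hz b hb => ?_⟩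
  have h1 := hC z hz b
  have h2 := hC' z hz b hb
  have h3 := mul_le_mul_of_nonneg_left (hB z hz b hb)
    (mul_nonneg hC0 (dist_nonneg (x := b) (y := z)))
  rw [height_sub]
  refine (abs_add_le _ _).trans ?_
  rw [abs_mul, abs_of_pos (four_pos : (0 : ℝ) < 4)]
  linarith

end ContactJet

namespace ContactJet
variable {m n : ℕ} {Z : Set (Euc m)} {J : ContactJet n Z} {W : WhitneySystem Z}

/-- The extension of a jet to a map into the Heisenberg group. -/
def heis (J : ContactJet n Z) (W : WhitneySystem Z) (b : Euc m) : Euc (2*n+1) :=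
  heisMk n (fun j => J.X W j b) (fun j => J.P W n j b) (J.height W b)

lemma sobolev_of_tame (hZ : IsCompact Z) (hne : Z.Nonempty) {p : ℝ} (hp1 : 1 ≤ p)
    (hp : ∀ R : ℝ, ∫⁻ a in ball 0 R \ Z, (ENNReal.ofReal (W.S n a / infDist a Z)) ^ (-p) < ⊤)
    {g c : Euc m → ℝ}
    (h1 : ∀ R : ℝ, ∃ C : ℝ, ∀ z ∈ Z, ∀ b ∈ ball (0 : Euc m) R, |g b - c z| ≤ C * dist b z)
    (h2 : ∀ R : ℝ, W.Tame n (fun i => W.Active n n i.1 ∧ i.1 ∈ ball 0 R) 1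
      fun i b => g b - c i.2) :
    (∀ᵐ a, DifferentiableAt ℝ g a) ∧
    ∀ U : Set (Euc m), IsOpen U → Bornology.IsBounded U →
      MemW1pWith m p U g (fun k a => fderiv ℝ g a (EuclideanSpace.single k 1)) := by
  refine sobolev_of_lipAt hZ hne (mul_nonneg (by positivity) W.C_pos.le) (W.S_nonneg n)
    (W.S_sub_le n) hp1 hp (fun R => ?_) fun R => ?_
  · have hgc : ∀ z ∈ Z, g z = c z := fun z hz => by
      obtain ⟨C, hC⟩ := h1 (dist z 0 + 1)
      simpa [sub_eq_zero] using hC z hz z (by rw [mem_ball]; linarith)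
    obtain ⟨C, hC⟩ := h1 R
    exact ⟨C, fun z hz b hb => by rw [hgc z hz]; exact hC z hz b hb⟩
  · obtain ⟨C, hC⟩ := WhitneySystem.exists_lipAt_of_tame (h2 R)
    exact ⟨C, fun a ha hs => hC a ⟨active_self hs, ha⟩ hs⟩

lemma exists_sobolev (J : ContactJet n Z) (hZ : IsCompact Z) (hne : Z.Nonempty) {p : ℝ}
    (hp1 : 1 ≤ p)
    (hp : ∀ R : ℝ, ∫⁻ a in ball 0 R \ Z, (ENNReal.ofReal (W.S n a / infDist a Z)) ^ (-p) < ⊤) :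
    (∀ U : Set (Euc m), IsOpen U → Bornology.IsBounded U → ∀ i,
      MemW1pWith m p U (fun b => J.heis W b i)
        fun k a => fderiv ℝ (fun b => J.heis W b i) a (EuclideanSpace.single k 1)) ∧
    ContactAEOn m n univ (J.heis W)
      fun i k a => fderiv ℝ (fun b => J.heis W b i) a (EuclideanSpace.single k 1) := by
  have hX : ∀ j < n, _ := fun j hj => sobolev_of_tame (W := W) hZ hne hp1 hp (g := J.X W j)
    (c := J.x j) (fun R => by
      obtain ⟨C, -, hC⟩ := exists_X_bound (J := J) (W := W) hZ hne hj
      exact ⟨C, fun z hz b _ => hC z hz b⟩) fun R => tame_X hZ hne hj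
  have hP : ∀ j, _ := fun j => sobolev_of_tame (W := W) hZ hne hp1 hp (g := J.P W n j)
    (c := J.p j) (fun R => by
      obtain ⟨C, -, hC⟩ := exists_P_bound (J := J) (W := W) hZ hne j
      exact ⟨C, fun z hz b _ => hC z hz b⟩)
    fun R => ((tame_U_P hZ hne le_rfl).2 j).of_imp fun i hi => hi.1
  have hH := sobolev_of_tame (W := W) hZ hne hp1 hp (g := J.height W) (c := J.height₀)
    (exists_height_bound hZ hne) (tame_height hZ hne)
  have hx : ∀ j, (fun b => J.heis W b (xIdx n j)) = J.X W j := fun j => by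
    funext b
    simp [heis]
  have hy : ∀ j, (fun b => J.heis W b (yIdx n j)) = J.P W n j := fun j => by
    funext b
    simp [heis]
  have ht : (fun b => J.heis W b (tIdx n)) = J.height W := by
    funext b
    simp [heis]
  refine ⟨fun U hU hb i => ?_, ?_⟩
  · rcases heis_index_cases i with ⟨j, rfl⟩ | ⟨j, rfl⟩ | rfl
    · rw [hx]
      exact (hX j j.isLt).2 U hU hb
    · rw [hy]
      exact (hP j).2 U hU hb
    · rw [ht]
      exact hH.2 U hU hb
  · have hae := ae_mem_or_pos_of_lintegral_lt_top hZ.isClosed (W.continuous_S (n := n))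
      (W.S_nonneg n) hp1 hp
    have hXd : ∀ᵐ a, ∀ j : Fin n, DifferentiableAt ℝ (J.X W j) a :=
      ae_all_iff.2 fun j => (hX j j.isLt).1
    have hPd : ∀ᵐ a, ∀ j, DifferentiableAt ℝ (J.P W n j) a := ae_all_iff.2 fun j => (hP j).1
    rw [ContactAEOn, Measure.restrict_univ]
    filter_upwards [hae, hXd, hPd] with a ha hXa hPa k
    have hX' : ∀ j < n, HasFDerivAt (J.X W j) (fderiv ℝ (J.X W j) a) a := fun j hj =>
      (hXa ⟨j, hj⟩).hasFDerivAt
    have hU' : HasFDerivAt (J.U W n)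
        (∑ j ∈ Finset.range n, J.P W n j a • fderiv ℝ (J.X W j) a) a := by
      rcases ha with ha | ha
      · exact hasFDerivAt_U_of_mem hZ ha hX'
      · exact hasFDerivAt_U hZ hne ha hX' le_rfl (active_self ha)
    have hH' : HasFDerivAt (J.height W) _ a := (hU'.const_mul 4).sub ((HasFDerivAt.fun_sum
      (u := Finset.range n) fun j hj =>
        (hX' j (Finset.mem_range.1 hj)).mul (hPa j).hasFDerivAt).const_mul 2)
    simp only [hx, hy, ht]
    rw [hH'.fderiv]
    simp only [sub_apply, smul_apply, sum_apply, add_apply, smul_eq_mul, heis, heisMk_xIdx,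
      heisMk_yIdx, Finset.mul_sum]
    rw [← Finset.sum_sub_distrib, Finset.sum_range]
    exact Finset.sum_congr rfl fun j _ => by ring

end ContactJet

/-- A Lipschitz map into the Heisenberg group is given by a jet on `Z`. -/
lemma LipschitzOnCC.exists_contactJet {m n : ℕ} (hn : 1 ≤ n) {L : ℝ} {Z : Set (Euc m)}
    {f : Euc m → Euc (2*n+1)} (hL : 0 ≤ L) (hf : LipschitzOnCC m n L Z f) :
    ∃ J : ContactJet n Z, (∀ j, J.x j = fun a => heisX n (f a) j) ∧
      (∀ j, J.p j = fun a => heisY n (f a) j) ∧ J.height₀ = fun a => f a (tIdx n) := by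
  have hx : ∀ j, ∀ z ∈ Z, ∀ w ∈ Z, |heisX n (f z) j - heisX n (f w) j| ≤ L * dist z w := by
    intro j z hz w hw
    rw [dist_comm]
    by_cases hj : j < n
    · simpa [heisX, hj] using (hf.estimates hn hL hw hz).1 ⟨j, hj⟩
    · simpa [heisX, hj] using mul_nonneg hL dist_nonneg
  have hy : ∀ j, ∀ z ∈ Z, ∀ w ∈ Z, |heisY n (f z) j - heisY n (f w) j| ≤ L * dist z w := by
    intro j z hz w hw
    rw [dist_comm]
    by_cases hj : j < n
    · simpa [heisY, hj] using (hf.estimates hn hL hw hz).2.1 ⟨j, hj⟩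
    · simpa [heisY, hj] using mul_nonneg hL dist_nonneg
  have hext : ∀ j, ∃ Y : Euc m → ℝ, (∀ a b, |Y a - Y b| ≤ L * dist a b) ∧
      ∀ z ∈ Z, Y z = heisX n (f z) j := by
    intro j
    have h1 : LipschitzOnWith ⟨L, hL⟩ (fun a => heisX n (f a) j) Z :=
      LipschitzOnWith.of_dist_le_mul fun z hz w hw => by
        rw [Real.dist_eq]
        exact hx j z hz w hw
    obtain ⟨Y, hY, he⟩ := h1.extend_real
    exact ⟨Y, fun a b => hY.dist_le_mul a b, fun z hz => (he hz).symm⟩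
  choose Y hY hYe using hext
  have hle : L ≤ L + 6 * n * L ^ 2 := le_add_of_nonneg_right (by positivity)
  have hmono : ∀ {r : ℝ} {a b : Euc m}, r ≤ L * dist a b → r ≤ (L + 6 * n * L ^ 2) * dist a b :=
    fun h => h.trans (mul_le_mul_of_nonneg_right hle dist_nonneg)
  refine ⟨⟨fun j a => heisX n (f a) j, fun j a => heisY n (f a) j,
    fun a => (f a (tIdx n) + 2 * ∑ j ∈ Finset.range n, heisX n (f a) j * heisY n (f a) j) / 4,
    Y, L + 6 * n * L ^ 2, by positivity, fun j a b => hmono (hY j a b), hYe,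
    fun j z hz w hw => hmono (hy j z hz w hw), fun z hz w hw => ?_⟩,
    fun _ => rfl, fun _ => rfl, ?_⟩
  · have h3 := (hf.estimates hn hL hw hz).2.2
    have hsum : |∑ j ∈ Finset.range n, (heisX n (f z) j - heisX n (f w) j) *
        (heisY n (f z) j - heisY n (f w) j)| ≤ n * (L * dist z w) ^ 2 := by
      refine (Finset.abs_sum_le_sum_abs _ _).trans ((Finset.sum_le_card_nsmul _ _
        ((L * dist z w) ^ 2) fun j _ => ?_).trans_eq (by simp))
      rw [abs_mul, sq]
      exact mul_le_mul (hx j z hz w hw) (hy j z hz w hw) (abs_nonneg _)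
        (mul_nonneg hL dist_nonneg)
    have key : (f z (tIdx n) + 2 * ∑ j ∈ Finset.range n, heisX n (f z) j * heisY n (f z) j) / 4 -
        (f w (tIdx n) + 2 * ∑ j ∈ Finset.range n, heisX n (f w) j * heisY n (f w) j) / 4 -
        ∑ j ∈ Finset.range n, heisY n (f w) j * (heisX n (f z) j - heisX n (f w) j) =
        (f z (tIdx n) - f w (tIdx n) - 2 * ∑ j : Fin n,
          (f w (yIdx n j) * (f z (xIdx n j) - f w (xIdx n j))
            - f w (xIdx n j) * (f z (yIdx n j) - f w (yIdx n j)))) / 4 +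
        (∑ j ∈ Finset.range n, (heisX n (f z) j - heisX n (f w) j) *
          (heisY n (f z) j - heisY n (f w) j)) / 2 := by
      have h : ∑ j ∈ Finset.range n, (heisX n (f z) j - heisX n (f w) j) *
          (heisY n (f z) j - heisY n (f w) j) =
          ∑ j ∈ Finset.range n, heisX n (f z) j * heisY n (f z) j -
          ∑ j ∈ Finset.range n, heisX n (f w) j * heisY n (f w) j -
          2 * ∑ j ∈ Finset.range n, heisY n (f w) j * (heisX n (f z) j - heisX n (f w) j) +
          ∑ j : Fin n, (f w (yIdx n j) * (f z (xIdx n j) - f w (xIdx n j))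
            - f w (xIdx n j) * (f z (yIdx n j) - f w (yIdx n j))) := by
        simp only [Finset.sum_range, heisX_coe, heisY_coe, Finset.mul_sum]
        rw [← Finset.sum_sub_distrib, ← Finset.sum_sub_distrib, ← Finset.sum_add_distrib]
        exact Finset.sum_congr rfl fun j _ => by ring
      rw [h]
      ring
    rw [dist_comm w z] at h3
    have h0 : 0 ≤ L * dist z w ^ 2 := by positivity
    have h1 : 0 ≤ n * L ^ 2 * dist z w ^ 2 := by positivity
    simp only
    rw [key]
    refine (abs_add_le _ _).trans ?_
    rw [abs_div, abs_div, abs_two, abs_of_pos (four_pos : (0 : ℝ) < 4)]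
    linarith
  · funext a
    simp only [ContactJet.height₀]
    ring

lemma ContactJet.heis_eq {m n : ℕ} {Z : Set (Euc m)} {J : ContactJet n Z} {W : WhitneySystem Z}
    (hZ : IsCompact Z) {f : Euc m → Euc (2*n+1)} (hx : ∀ j, J.x j = fun a => heisX n (f a) j)
    (hp : ∀ j, J.p j = fun a => heisY n (f a) j) (ht : J.height₀ = fun a => f a (tIdx n))
    {z : Euc m} (hz : z ∈ Z) : J.heis W z = f z := by
  refine heis_ext (fun j => ?_) (fun j => ?_) ?_
  · rw [heis, heisMk_xIdx, X_eq hZ j.isLt hz, hx]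
    exact heisX_coe (f z) j
  · rw [heis, heisMk_yIdx, P_eq hZ j hz, hp]
    exact heisY_coe (f z) j
  · rw [heis, heisMk_tIdx, height_eq hZ hz, ht]

/-- **Corollary (local Sobolev extension on all of ℝ^m).**
For `m, n ≥ 1`, `1 ≤ p < n+1`, every compact `Z ⊂ ℝ^m` and every `L`-Lipschitz
`f : Z → ℍⁿ`, there is `F̃ : ℝ^m → ℍⁿ` extending `f` with `F̃ ∈ W^{1,p}_loc(ℝ^m, ℍⁿ)`,
i.e. `F̃ ∈ W^{1,p}(U, ℝ^{2n+1})` for every bounded open `U` and the weak contact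
equation holds a.e. on `ℝ^m`. -/
theorem local_sobolev_extension_into_heisenberg
    (m n : ℕ) (hm : 1 ≤ m) (hn : 1 ≤ n) (p : ℝ) (hp1 : 1 ≤ p) (hp2 : p < n + 1)
    (Z : Set (Euc m)) (hZ : IsCompact Z)
    (L : ℝ) (hL : 0 ≤ L) (f : Euc m → Euc (2*n+1)) (hf : LipschitzOnCC m n L Z f) :
    ∃ (F : Euc m → Euc (2*n+1)) (v : Fin (2*n+1) → Fin m → Euc m → ℝ),
      (∀ x ∈ Z, F x = f x) ∧
      (∀ U : Set (Euc m), IsOpen U → Bornology.IsBounded U →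
        ∀ i, MemW1pWith m p U (fun x => F x i) (fun k => v i k)) ∧
      ContactAEOn m n Set.univ F v := by
  rcases Z.eq_empty_or_nonempty with rfl | hne
  · refine ⟨0, 0, by simp, fun U _ _ i => ⟨MemLp.zero', fun k => ⟨MemLp.zero', ?_⟩⟩, ?_⟩
    · intro φ _ _ _
      simp
    · exact Filter.Eventually.of_forall fun x k => by simp
  · obtain ⟨W, hW⟩ := exists_whitneySystem n hZ.isClosed hne (by linarith) hp2
    obtain ⟨J, hx, hp, ht⟩ := hf.exists_contactJet hn hL
    obtain ⟨h1, h2⟩ := J.exists_sobolev hZ hne hp1 hW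
    exact ⟨J.heis W, _, fun z hz => ContactJet.heis_eq hZ hx hp ht hz, h1, h2⟩

end
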